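/- Let k be an integer with k ≥ 3, and let τ and δ be real numbers with 1/τ > 4(k−1)(k−2) and δ > k·τ. Suppose that X is sufficiently large in terms of k, δ and τ, that α ∈ ℝ^k, and that |f_k(α;X)| > X^{1−τ}. Then there exist integers q, a_1, …, a_k such that 1 ≤ q ≤ X^δ and |q·α_j − a_j| ≤ X^{δ−j} for 1 ≤ j ≤ k. -/

import Mathlib

/-- The Weyl sum `f k α X = ∑_{1 ≤ x ≤ X} e(α₁ x + … + α_k x^k)`, where the
`j`-th coordinate of `α : Fin k → ℝ` is the coefficient of `x^(j+1)`. -/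
noncomputable def fsum (k : ℕ) (α : Fin k → ℝ) (X : ℝ) : ℂ :=
  ∑ x ∈ Finset.Icc 1 ⌊X⌋₊,
    Complex.exp (2 * (Real.pi : ℂ) * Complex.I *
      ((∑ j : Fin k, α j * (x : ℝ) ^ ((j : ℕ) + 1) : ℝ) : ℂ))

set_option linter.all false
open Finset (range sum_congr mul_sum mem_range sum_le_sum Icc sum_comm mem_filter Ioc sum_const univ sum_nonneg mem_image sum_add_distrib Ico mem_Icc mem_insert sum_insert single_le_sum sum_mul sum_sub_distrib mem_Ioc sum_range_succ' sum_mul_sum sum_eq_zero mem_univ card_range mem_of_mem_erase sum_eq_single mem_Ico sum_range_succ sum_div abs_sum_le_sum_abs card_le_card sum_nbij' sum_filter)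
open Real (pi rpow_natCast rpow_mul rpow_add rpow_nonneg one_le_rpow rpow_inv_natCast_pow mul_rpow pi_pos rpow_le_rpow rpow_one rpow_le_rpow_of_exponent_le)
open ZMod (stdAddChar)
open AddChar (map_add_eq_mul)

theorem mlr {a b c : ℝ} (h : b ≤ c) (ha : 0 ≤ a) : b*a ≤ c*a := mul_le_mul_of_nonneg_right h ha
theorem mll {a b c : ℝ} (h : b ≤ c) (ha : 0 ≤ a) : a*b ≤ a*c := mul_le_mul_of_nonneg_left h ha
theorem one_lm {a b : ℝ} (h : 1 ≤ a) (g : 1 ≤ b) : 1 ≤ a*b := one_le_mul_of_one_le_of_one_le h g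


noncomputable section

theorem mink {V ι : Type*} [Fintype V] (P : Finset ι) (u : ι → V → ℝ) (hu : ∀ J a, 0 ≤ u J a)
    (s : ℕ) (hs : 1 ≤ s) :
    (∑ a, (∑ J ∈ P, u J a)^s) ≤ (∑ J ∈ P, (∑ a, u J a ^ s)^(1/(s:ℝ)))^s := by
  classical
  have key : (∑ a, (∑ J ∈ P, u J a)^s)^(1/(s:ℝ)) ≤ ∑ J ∈ P, (∑ a, u J a ^ s)^(1/(s:ℝ)) := by
    induction P using Finset.induction_on with
    | empty =>
      have : (s:ℝ) ≠ 0 := by positivity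
      simp [show s ≠ 0 by omega, this]
    | insert J P hJ ih =>
      simp only [sum_insert hJ]
      have := Real.Lp_add_le_of_nonneg (univ) (f := u J) (g := fun a => ∑ J ∈ P, u J a)
        (p := (s:ℝ)) (by exact_mod_cast hs) (fun a _ => hu J a)
        (fun a _ => sum_nonneg fun J _ => hu J a)
      simp only [rpow_natCast] at this
      linarith
  have h0 : 0 ≤ ∑ a, (∑ J ∈ P, u J a)^s :=
    sum_nonneg fun a _ => pow_nonneg (sum_nonneg fun J _ => hu J a) _
  calc _ = ((∑ a, (∑ J ∈ P, u J a)^s)^(1/(s:ℝ)))^s := by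
        rw [one_div, rpow_inv_natCast_pow h0 (by omega)]
    _ ≤ _ := pow_le_pow_left₀ (rpow_nonneg h0 _) key s

theorem absStep {V T ι : Type*} [Fintype V] [AddCommGroup V] [Fintype T] [Nonempty T]
    (v : T → V) (P : Finset ι) (h w : V → ℝ) (hJ : ι → V → ℝ) (e : ι → ℝ) (s : ℕ) (hs : 1 ≤ s)
    (D B W : ℝ) (hD : 0 ≤ D) (hB : 0 ≤ B) (hW : 0 ≤ W) (hw0 : ∀ a, 0 ≤ w a)
    (hJ0 : ∀ J a, 0 ≤ hJ J a) (he : ∀ J, 0 ≤ e J)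
    (hw : ∀ a t, w (a + v t) = w a)
    (h1 : ∀ a, ∑ t, h (a + v t) ≤ D * (∑ J ∈ P, (∑ t, hJ J (a + v t))^(1/(s:ℝ)))^s)
    (h2 : ∀ J ∈ P, ∑ a, hJ J a * w a ≤ B * e J ^ s * W) :
    ∑ a, h a * w a ≤ D * B * (∑ J ∈ P, e J)^s * W := by
  have hs0 : s ≠ 0 := by omega
  have av : ∀ g : V → ℝ, ∑ a, ∑ t, g (a + v t) = Fintype.card T * ∑ a, g a := by
    intro g
    rw [sum_comm]
    have : ∀ t, ∑ a, g (a + v t) = ∑ a, g a := fun t => Equiv.sum_comp (Equiv.addRight (v t)) g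
    simp [this]
  have hT : (0:ℝ) < Fintype.card T := by exact_mod_cast Fintype.card_pos
  refine le_of_mul_le_mul_left ?_ hT
  set u : ι → V → ℝ := fun J a => (w a * ∑ t, hJ J (a + v t))^(1/(s:ℝ)) with hu
  have hS : ∀ J a, 0 ≤ ∑ t, hJ J (a + v t) := fun J a => sum_nonneg fun t _ => hJ0 _ _
  have hu0 : ∀ J a, 0 ≤ u J a := fun J a => rpow_nonneg (mul_nonneg (hw0 a) (hS J a)) _
  have hus : ∀ J a, u J a ^ s = w a * ∑ t, hJ J (a + v t) := fun J a => by
    simp only [hu]; rw [one_div, rpow_inv_natCast_pow (mul_nonneg (hw0 a) (hS J a)) hs0]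
  have e0 : ∀ J ∈ P, (∑ a, u J a ^ s)^(1/(s:ℝ)) ≤ (Fintype.card T * (B * W))^(1/(s:ℝ)) * e J := by
    intro J hJP
    have : ∑ a, u J a ^ s = Fintype.card T * ∑ a, hJ J a * w a := by
      rw [← av]; refine sum_congr rfl fun a _ => ?_
      rw [hus, mul_sum]; refine sum_congr rfl fun t _ => ?_
      rw [hw]; ring
    have hh : ∑ a, u J a ^ s ≤ (Fintype.card T * (B * W)) * e J ^ s := by
      rw [this]; nlinarith [mll (h2 J hJP) hT.le]
    have h00 : 0 ≤ ∑ a, u J a ^ s := sum_nonneg fun a _ => pow_nonneg (hu0 J a) _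
    calc _ ≤ ((Fintype.card T * (B * W)) * e J ^ s)^(1/(s:ℝ)) :=
          rpow_le_rpow h00 hh (by positivity)
      _ = _ := by
        rw [mul_rpow (by positivity) (pow_nonneg (he J) _), one_div,
          Real.pow_rpow_inv_natCast (he J) hs0]
  calc (Fintype.card T:ℝ) * ∑ a, h a * w a = ∑ a, w a * ∑ t, h (a + v t) := by
        rw [← av (fun a => h a * w a)]
        refine sum_congr rfl fun a _ => ?_
        rw [mul_sum]; exact sum_congr rfl fun t _ => by rw [hw]; ring
    _ ≤ ∑ a, D * (∑ J ∈ P, u J a)^s := by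
        refine sum_le_sum fun a _ => ?_
        refine (mll (h1 a) (hw0 a)).trans (le_of_eq ?_)
        have : ∀ J, u J a = w a ^(1/(s:ℝ)) * (∑ t, hJ J (a + v t))^(1/(s:ℝ)) := fun J =>
          mul_rpow (hw0 a) (hS J a)
        simp only [this]
        rw [← mul_sum, mul_pow, one_div, rpow_inv_natCast_pow (hw0 a) hs0]; ring
    _ = D * ∑ a, (∑ J ∈ P, u J a)^s := by rw [mul_sum]
    _ ≤ D * (∑ J ∈ P, (Fintype.card T * (B * W))^(1/(s:ℝ)) * e J)^s := by
        refine mll ((mink P u hu0 s hs).trans ?_) hD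
        refine pow_le_pow_left₀ (sum_nonneg fun J _ => rpow_nonneg
          (sum_nonneg fun a _ => pow_nonneg (hu0 J a) _) _) (sum_le_sum e0) s
    _ = _ := by
        rw [← mul_sum, mul_pow, one_div, rpow_inv_natCast_pow (by positivity) hs0]; ring

/-- Hölder: if W^n = U V^(n-1) pointwise. -/
theorem holderN {V : Type*} [Fintype V] (n : ℕ) (hn : 1 ≤ n) (W U T : V → ℝ)
    (hW : ∀ a, 0 ≤ W a) (hU : ∀ a, 0 ≤ U a) (hT : ∀ a, 0 ≤ T a)
    (h : ∀ a, W a ^ n = U a * T a ^ (n-1)) :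
    (∑ a, W a)^n ≤ (∑ a, U a) * (∑ a, T a)^(n-1) := by
  rcases Nat.eq_or_lt_of_le hn with h1 | h1
  · subst h1
    simp only [pow_one, le_refl, Nat.sub_self, pow_zero, mul_one] at h ⊢
    exact sum_le_sum fun a _ => (h a).le
  have hn0 : (n:ℝ) ≠ 0 := by positivity
  have hn1 : (0:ℝ) < (n:ℝ) - 1 := by
    have : (1:ℝ) < n := by exact_mod_cast h1
    linarith
  have hnn : ((n-1:ℕ):ℝ) = (n:ℝ) - 1 := by push_cast [Nat.cast_sub hn]; ring
  have hc : (n:ℝ).HolderConjugate ((n:ℝ)/((n:ℝ)-1)) := by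
    rw [Real.holderConjugate_iff]; refine ⟨by linarith, ?_⟩; field_simp; ring
  have hWe : ∀ a, W a = U a ^ (1/(n:ℝ)) * T a ^ (((n:ℝ)-1)/n) := by
    intro a
    rw [← Real.pow_rpow_inv_natCast (hW a) (show n ≠ 0 by omega), h a,
      mul_rpow (hU a) (pow_nonneg (hT a) _), ← rpow_natCast, ← rpow_mul (hT a), hnn,
      one_div]; rfl
  have := Real.inner_le_Lp_mul_Lq_of_nonneg univ hc
    (f := fun a => U a ^ (1/(n:ℝ))) (g := fun a => T a ^ (((n:ℝ)-1)/n))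
    (fun a _ => rpow_nonneg (hU a) _) (fun a _ => rpow_nonneg (hT a) _)
  simp only [← hWe] at this
  have eU : ∀ a, (U a ^ (1/(n:ℝ)))^(n:ℝ) = U a := fun a => by
    rw [← rpow_mul (hU a)]; field_simp; simp
  have eT : ∀ a, (T a ^ (((n:ℝ)-1)/n))^((n:ℝ)/((n:ℝ)-1)) = T a := fun a => by
    rw [← rpow_mul (hT a)]; rw [div_mul_div_cancel₀ hn0, div_self hn1.ne']; simp
  simp only [eU, eT] at this
  have sU : 0 ≤ ∑ a, U a := sum_nonneg fun a _ => hU a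
  have sT : 0 ≤ ∑ a, T a := sum_nonneg fun a _ => hT a
  calc _ ≤ ((∑ a, U a)^(1/(n:ℝ)) * (∑ a, T a)^(1/((n:ℝ)/((n:ℝ)-1))))^n :=
        pow_le_pow_left₀ (sum_nonneg fun a _ => hW a) this n
    _ = _ := by
      rw [mul_pow, one_div, rpow_inv_natCast_pow sU (by omega), ← rpow_natCast (_ ^ _) n,
        ← rpow_mul sT, one_div_div, div_mul_cancel₀ _ hn0, ← hnn, rpow_natCast]

/-- the matrix is invertible -/
theorem detUnit (R : Type*) [CommRing R] (l d : ℕ) (z : R) (hz : IsUnit z)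
    (hun : ∀ n : ℕ, 1 ≤ n → n ≤ d + l → IsUnit (n:R)) :
    IsUnit (Matrix.of fun (i j : Fin l) =>
      ((Nat.choose (d+j+1) (i+1) : ℕ) : R) * z^(d+(j:ℕ)+1-((i:ℕ)+1))) := by
  nontriviality R
  set A := (Matrix.of fun (i j : Fin l) =>
      ((Nat.choose (d+j+1) (i+1) : ℕ) : R) * z^(d+(j:ℕ)+1-((i:ℕ)+1))) with hA
  rw [Matrix.isUnit_iff_isUnit_det]
  set v : Fin l → R := fun j => ((d + (j:ℕ) : ℕ) : R)
  set M := (Matrix.of fun i j : Fin l => Polynomial.eval (v i) (descPochhammer R j)) with hM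
  have hmon := fun i : ℕ => descPochhammer_map (Int.castRingHom R) i
  have hdet := Matrix.det_eval_matrixOfPolynomials_eq_det_vandermonde v
    (fun j => descPochhammer R j) (fun i => hmon i ▸ ((monic_descPochhammer ℤ i).natDegree_map _).trans
      (descPochhammer_natDegree ℤ i)) (fun i => hmon i ▸ (monic_descPochhammer ℤ i).map _)
  have hMu : IsUnit M.det := by
    rw [← hdet, Matrix.det_vandermonde]
    refine IsUnit.prod_univ_iff.2 fun i => ?_
    rw [IsUnit.prod_iff]
    intro j hj
    have hij : (i:ℕ) < j := by simpa using hj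
    have : v j - v i = (((j:ℕ) - (i:ℕ) : ℕ) : R) := by
      simp only [v]; push_cast [Nat.cast_sub hij.le]; ring
    rw [this]; exact hun _ (by omega) (by have := j.2; omega)
  have key : Matrix.diagonal (fun i : Fin l => ((((i:ℕ)+1).factorial : ℕ) : R) * z^((i:ℕ)+1)) * A
      = M.transpose * Matrix.diagonal (fun j : Fin l => ((d+(j:ℕ)+1 : ℕ):R) * z^(d+(j:ℕ)+1)) := by
    ext i j
    rw [Matrix.diagonal_mul, Matrix.mul_diagonal]
    simp only [hA, hM, Matrix.of_apply, Matrix.transpose_apply, v,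
      descPochhammer_eval_eq_descFactorial]
    rcases Nat.lt_or_ge (d+j+1) (i+1) with h | h
    · rw [Nat.choose_eq_zero_of_lt h, Nat.descFactorial_of_lt (by omega)]; simp
    · have e1 : ((d+(j:ℕ)+1)*(d+(j:ℕ)).descFactorial i) =
          (((i:ℕ)+1).factorial) * (Nat.choose (d+j+1) (i+1)) := by
        rw [← Nat.succ_descFactorial_succ, Nat.descFactorial_eq_factorial_mul_choose]
      have e2 : z^(d+(j:ℕ)+1) = z^((i:ℕ)+1) * z^(d+(j:ℕ)+1-((i:ℕ)+1)) := by
        rw [← pow_add]; congr 1; omega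
      have e1' : ((d+(j:ℕ)+1 : ℕ):R) * ((d+(j:ℕ)).descFactorial i : ℕ) =
          ((((i:ℕ)+1).factorial : ℕ):R) * (Nat.choose (d+j+1) (i+1) : ℕ) := by
        rw [← Nat.cast_mul, e1, Nat.cast_mul]
      rw [e2]
      linear_combination (-(z^((i:ℕ)+1) * z^(d+(j:ℕ)+1-((i:ℕ)+1)))) * e1'
  have kd := congrArg Matrix.det key
  rw [Matrix.det_mul, Matrix.det_mul, Matrix.det_transpose] at kd
  have : IsUnit (M.det * (Matrix.diagonal (fun j : Fin l => ((d+(j:ℕ)+1 : ℕ):R) * z^(d+(j:ℕ)+1))).det) := by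
    refine hMu.mul ?_
    rw [Matrix.det_diagonal]
    refine IsUnit.prod_univ_iff.2 fun j => (hun _ (by omega) (by have := j.2; omega)).mul (hz.pow _)
  rw [← kd] at this
  exact isUnit_of_mul_isUnit_right this
end

noncomputable section

def prt (x : ℕ → ℤ) (M : ℕ) (A : Finset ℕ) : Finset (Finset ℕ) :=
  A.image (fun i => A.filter (fun j => x j ≡ x i [ZMOD M]))

theorem mem_prt {x : ℕ → ℤ} {M : ℕ} {A I : Finset ℕ} (h : I ∈ prt x M A) :
    ∃ i ∈ A, i ∈ I ∧ I ⊆ A ∧ ∀ j, j ∈ I ↔ j ∈ A ∧ x j ≡ x i [ZMOD M] := by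
  obtain ⟨i, hi, rfl⟩ := mem_image.1 h
  exact ⟨i, hi, by simp [hi], Finset.filter_subset _ _, fun j => by simp⟩

theorem prt_congr {x y : ℕ → ℤ} {M M' : ℕ} {A : Finset ℕ}
    (h : ∀ i ∈ A, ∀ j ∈ A, (x j ≡ x i [ZMOD M] ↔ y j ≡ y i [ZMOD M'])) :
    prt x M A = prt y M' A :=
  Finset.image_congr fun i hi => Finset.filter_congr fun j hj => h i hi j hj

theorem prt_disj {x : ℕ → ℤ} {M : ℕ} {A I J : Finset ℕ} (hI : I ∈ prt x M A) (hJ : J ∈ prt x M A)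
    {u : ℕ} (h1 : u ∈ I) (h2 : u ∈ J) : I = J := by
  obtain ⟨i, _, _, _, hi⟩ := mem_prt hI
  obtain ⟨j, _, _, _, hj⟩ := mem_prt hJ
  have e := (((hi u).1 h1).2.symm).trans ((hj u).1 h2).2
  ext w; rw [hi, hj]
  exact ⟨fun h => ⟨h.1, h.2.trans e⟩, fun h => ⟨h.1, h.2.trans e.symm⟩⟩

theorem sum_prt {E : Type*} [AddCommMonoid E] (x : ℕ → ℤ) (M : ℕ) (A : Finset ℕ) (g : ℕ → E) :
    ∑ i ∈ A, g i = ∑ I ∈ prt x M A, ∑ i ∈ I, g i := by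
  classical
  rw [← Finset.sum_biUnion]
  · congr 1; ext u
    simp only [Finset.mem_biUnion]
    constructor
    · intro h
      exact ⟨_, mem_image.2 ⟨u, h, rfl⟩, by simp [h]⟩
    · rintro ⟨I, hI, h⟩
      obtain ⟨i, _, _, hs, _⟩ := mem_prt hI
      exact hs h
  · intro I hI J hJ hne
    rw [Function.onFun, Finset.disjoint_left]
    exact fun u h1 h2 => hne (prt_disj hI hJ h1 h2)

theorem sum_prt_prt {E : Type*} [AddCommMonoid E] (x : ℕ → ℤ) {M M' : ℕ} (hM : M ∣ M') (A : Finset ℕ)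
    (g : Finset ℕ → E) :
    ∑ I ∈ prt x M' A, g I = ∑ J ∈ prt x M A, ∑ I ∈ prt x M' J, g I := by
  classical
  rw [← Finset.sum_biUnion]
  · congr 1; ext I
    simp only [Finset.mem_biUnion]
    have hMM : ∀ {a b : ℤ}, a ≡ b [ZMOD M'] → a ≡ b [ZMOD M] := fun h =>
      h.of_dvd (by exact_mod_cast hM)
    constructor
    · intro h
      obtain ⟨i, hi, rfl⟩ := mem_image.1 h
      refine ⟨_, mem_image.2 ⟨i, hi, rfl⟩, mem_image.2 ⟨i, by simp [hi], ?_⟩⟩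
      ext u; simp only [mem_filter]
      exact ⟨fun h => ⟨h.1.1, h.2⟩, fun h => ⟨⟨h.1, hMM h.2⟩, h.2⟩⟩
    · rintro ⟨J, hJ, hI⟩
      obtain ⟨j, hj, _, _, hj'⟩ := mem_prt hJ
      obtain ⟨i, hi, rfl⟩ := mem_image.1 hI
      refine mem_image.2 ⟨i, ((hj' i).1 hi).1, ?_⟩
      ext u; simp only [mem_filter, hj']
      exact ⟨fun h => ⟨⟨h.1, (hMM h.2).trans ((hj' i).1 hi).2⟩, h.2⟩, fun h => ⟨h.1.1, h.2⟩⟩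
  · intro I hI J hJ hne
    rw [Function.onFun, Finset.disjoint_left]
    intro u h1 h2
    obtain ⟨i, _, hi, hs, _⟩ := mem_prt h1
    obtain ⟨j, _, hj, hs', _⟩ := mem_prt h2
    exact hne (prt_disj hI hJ (hs hi) (hs' hi))

theorem card_prt (x : ℕ → ℤ) (M : ℕ) (hM : 0 < M) (A : Finset ℕ) : (prt x M A).card ≤ M := by
  have hM' : (M:ℤ) ≠ 0 := by exact_mod_cast hM.ne'
  have : (prt x M A) ⊆ (range M).image (fun r : ℕ => A.filter (fun j => x j ≡ r [ZMOD M])) := by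
    intro I hI
    obtain ⟨i, hi, rfl⟩ := mem_image.1 hI
    refine mem_image.2 ⟨(x i % M).toNat, ?_, ?_⟩
    · have := Int.emod_lt_of_pos (x i) (show (0:ℤ) < M by exact_mod_cast hM)
      have := Int.emod_nonneg (x i) hM'
      rw [mem_range]; omega
    · ext u; simp only [mem_filter]
      rw [Int.toNat_of_nonneg (Int.emod_nonneg (x i) hM')]
      simp [Int.ModEq]
  calc _ ≤ _ := card_le_card this
    _ ≤ _ := Finset.card_image_le
    _ = M := by simp

def tri (l : ℕ) : ℕ := l*(l+1)/2
theorem two_tri (l : ℕ) : 2 * tri l = l*(l+1) := Nat.mul_div_cancel' (Nat.even_mul_succ_self l).two_dvd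
theorem tri_pos {l : ℕ} (h : 1 ≤ l) : 1 ≤ tri l := by have := two_tri l; nlinarith
theorem tri_mono {l k : ℕ} (h : l ≤ k) : tri l ≤ tri k := by
  have := two_tri l; have := two_tri k; nlinarith

section
variable (p L k : ℕ) [hp : Fact p.Prime] (m : ℕ → ℕ) (x : ℕ → ℤ) (c : ℕ → ℂ)

def Ff (A : Finset ℕ) (α : Fin k → ZMod (p^L)) : ℂ :=
  ∑ i ∈ A, c i * stdAddChar (∑ j : Fin k, α j * (p:ZMod (p^L))^(m j) * (x i:ZMod (p^L))^((j:ℕ)+1))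

def Mo (s : ℕ) (A : Finset ℕ) : ℝ := ∑ α, ‖Ff p L k m x c A α‖^(2*s)

def Sd (s N : ℕ) (A : Finset ℕ) : ℝ := ∑ I ∈ prt x (p^N) A, (Mo p L k m x c s I)^(1/(s:ℝ))

def Dec (N : ℕ) (C : ℝ) : Prop := ∀ (L : ℕ) (m : ℕ → ℕ), Monotone m → (∀ j, j < k → m j + (j+1)*N ≤ L) →
  ∀ (x : ℕ → ℤ) (c : ℕ → ℂ) (A : Finset ℕ),
    Mo p L k m x c (tri k) A ≤ C * Sd p L k m x c (tri k) N A ^ (tri k)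
end

variable {p L k : ℕ} [hp : Fact p.Prime] {m : ℕ → ℕ} {x : ℕ → ℤ} {c : ℕ → ℂ}

theorem Mo_nonneg {s A} : 0 ≤ Mo p L k m x c s A := sum_nonneg fun _ _ => by positivity
theorem Sd_nonneg {s N A} : 0 ≤ Sd p L k m x c s N A :=
  sum_nonneg fun _ _ => rpow_nonneg Mo_nonneg _

theorem Ff_prt (M : ℕ) (A : Finset ℕ) (α) : Ff p L k m x c A α = ∑ I ∈ prt x M A, Ff p L k m x c I α := by
  unfold Ff; exact sum_prt x M A _

theorem Sd_prt {s N a : ℕ} (h : a ≤ N) (A : Finset ℕ) :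
    Sd p L k m x c s N A = ∑ J ∈ prt x (p^a) A, Sd p L k m x c s N J := by
  unfold Sd; exact sum_prt_prt x (pow_dvd_pow p h) A _

theorem Sd_le {s N a : ℕ} (h : a ≤ N) {A J : Finset ℕ} (hJ : J ∈ prt x (p^a) A) :
    Sd p L k m x c s N J ≤ Sd p L k m x c s N A := by
  rw [Sd_prt h A]
  exact single_le_sum (f := fun J => Sd p L k m x c s N J) (fun _ _ => Sd_nonneg) hJ

theorem prt_aff {A : Finset ℕ} {y : ℕ → ℤ} {ξ : ℤ} {a : ℕ} (N : ℕ) (h : ∀ i ∈ A, x i = ξ + (p:ℤ)^a * y i) :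
    prt x (p^(a+N)) A = prt y (p^N) A := by
  refine prt_congr fun i hi j hj => ?_
  have : (p:ℤ)^a ≠ 0 := pow_ne_zero _ (by exact_mod_cast hp.out.ne_zero)
  rw [h i hi, h j hj, Int.modEq_iff_dvd, Int.modEq_iff_dvd]
  push_cast
  rw [pow_add, show ξ + (p:ℤ)^a * y i - (ξ + (p:ℤ)^a * y j) = (p:ℤ)^a * (y i - y j) by ring]
  exact mul_dvd_mul_iff_left this

theorem tri_bij (R : Type*) [CommRing R] (k : ℕ) (T : Matrix (Fin k) (Fin k) R)
    (h1 : ∀ i, T i i = 1) (h0 : ∀ i j, j < i → T i j = 0) : IsUnit T := by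
  rw [Matrix.isUnit_iff_isUnit_det, Matrix.det_of_isUpperTriangular]
  · simp [h1]
  · intro i j hij; exact h0 i j hij

theorem bij_of_unit {R : Type*} [CommRing R] [Finite R] {k : ℕ} {T : Matrix (Fin k) (Fin k) R} (h : IsUnit T) :
    Function.Bijective T.mulVec :=
  (Finite.surjective_iff_bijective).1 (Matrix.mulVec_surjective_iff_isUnit.2 h)

theorem norm_phase {N : ℕ} [NeZero N] (A : Finset ℕ) (c : ℕ → ℂ) (u w : ℕ → ZMod N) (z : ZMod N)
    (h : ∀ i ∈ A, u i = z + w i) :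
    ‖∑ i ∈ A, c i * stdAddChar (u i)‖ = ‖∑ i ∈ A, c i * stdAddChar (w i)‖ := by
  have : ∑ i ∈ A, c i * stdAddChar (u i) = stdAddChar z * ∑ i ∈ A, c i * stdAddChar (w i) := by
    rw [mul_sum]; refine sum_congr rfl fun i hi => ?_
    rw [h i hi, map_add_eq_mul]; ring
  rw [this, norm_mul, AddChar.norm_apply, one_mul]

theorem binom_split {R : Type*} [CommRing R] (n k : ℕ) (hk : n ≤ k) (ξ y : R) :
    (ξ + y)^n = ξ^n + ∑ i : Fin k, (n.choose ((i:ℕ)+1) : R) * ξ^(n-((i:ℕ)+1)) * y^((i:ℕ)+1) := by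
  rw [Fin.sum_univ_eq_sum_range (fun i => (n.choose (i+1) : R) * ξ^(n-(i+1)) * y^(i+1)) k,
    add_comm ξ y, add_pow]
  have := sum_range_succ' (fun i => (n.choose i : R) * ξ^(n-i) * y^i) k
  simp only [Nat.choose_zero_right, Nat.cast_one, Nat.sub_zero, pow_zero, mul_one, one_mul] at this
  rw [add_comm (ξ^n), ← this]
  rw [Finset.sum_subset (s₁ := range (n+1)) (Finset.range_mono (show n+1 ≤ k+1 by omega))
    (f := fun m => y^m * ξ^(n-m) * (n.choose m : R))]
  · exact sum_congr rfl fun i _ => by ring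
  · intro i _ hi
    rw [Nat.choose_eq_zero_of_lt (by simpa using hi)]; simp

theorem Mo_aff (hm : Monotone m) {s : ℕ} {A : Finset ℕ} {y : ℕ → ℤ} {ξ : ℤ} {a : ℕ}
    (h : ∀ i ∈ A, x i = ξ + (p:ℤ)^a * y i) :
    Mo p L k m x c s A = Mo p L k (fun j => m j + a*(j+1)) y c s A := by
  set T : Matrix (Fin k) (Fin k) (ZMod (p^L)) := Matrix.of fun i j =>
    if i ≤ j then (p:ZMod (p^L))^(m j - m i) * (((j:ℕ)+1).choose ((i:ℕ)+1) : ZMod (p^L)) * (ξ:ZMod (p^L))^((j:ℕ)+1-((i:ℕ)+1)) else 0 with hT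
  have hTu := bij_of_unit (tri_bij _ k T (fun i => by simp [hT]) (fun i j hij => by simp [hT, hij]))
  unfold Mo
  rw [← hTu.sum_comp (fun α => ‖Ff p L k (fun j => m j + a*(j+1)) y c A α‖^(2*s))]
  refine sum_congr rfl fun α _ => ?_
  congr 1
  unfold Ff
  refine norm_phase A c _ _ (∑ j : Fin k, α j * (p:ZMod (p^L))^(m j) * (ξ:ZMod (p^L))^((j:ℕ)+1)) fun i hi => ?_
  rw [h i hi]; push_cast
  simp only [binom_split (R := ZMod (p^L)) _ k (Nat.succ_le_of_lt (Fin.is_lt _)), mul_add, sum_add_distrib]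
  congr 1
  simp only [Matrix.mulVec, dotProduct, mul_sum, sum_mul]
  rw [sum_comm]
  refine sum_congr rfl fun u _ => sum_congr rfl fun j _ => ?_
  simp only [hT, Matrix.of_apply]
  split_ifs with hu
  · have e : (p:ZMod (p^L))^(m j) = (p:ZMod (p^L))^(m j - m u) * (p:ZMod (p^L))^(m u) := by
      rw [← pow_add]; congr 1; have := hm (show (u:ℕ) ≤ j from hu); omega
    rw [e, mul_pow, ← pow_mul, pow_add]; ring
  · rw [Nat.choose_eq_zero_of_lt (by simpa using hu)]; simp

theorem choose_aff {A : Finset ℕ} {ξ : ℤ} {M : ℕ} (h : ∀ i ∈ A, x i ≡ ξ [ZMOD M]) :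
    ∃ y : ℕ → ℤ, ∀ i ∈ A, x i = ξ + M * y i := by
  have hy : ∀ i, ∃ y : ℤ, i ∈ A → x i = ξ + M * y := by
    intro i
    by_cases hi : i ∈ A
    · obtain ⟨y, hy⟩ := (Int.modEq_iff_dvd.1 (h i hi).symm)
      exact ⟨y, fun _ => by linarith⟩
    · exact ⟨0, fun h => absurd h hi⟩
  choose y hy using hy
  exact ⟨y, hy⟩
theorem Dec_aff {N a : ℕ} {C : ℝ} (hD : Dec p k N C) (hm : Monotone m)
    (hL : ∀ j, j < k → m j + (j+1)*(a+N) ≤ L) {A : Finset ℕ} {ξ : ℤ}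
    (h : ∀ i ∈ A, x i ≡ ξ [ZMOD (p^a:ℕ)]) :
    Mo p L k m x c (tri k) A ≤ C * Sd p L k m x c (tri k) (a+N) A ^ (tri k) := by
  obtain ⟨y, hy⟩ := choose_aff h
  push_cast at hy
  have := hD L (fun j => m j + a*(j+1)) (fun i j hij => by
    have := hm hij; simp only; gcongr) (fun j hj => by have := hL j hj; nlinarith) y c A
  rw [Mo_aff hm hy]
  convert this using 3
  unfold Sd
  rw [prt_aff N hy]
  refine sum_congr rfl fun I hI => ?_
  obtain ⟨_, _, _, hs, _⟩ := mem_prt hI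
  rw [Mo_aff hm fun i hi => hy i (hs hi)]

end

noncomputable section
variable {p L k : ℕ} [hp : Fact p.Prime] {m : ℕ → ℕ} {x : ℕ → ℤ} {c : ℕ → ℂ}

theorem tri_one : tri 1 = 1 := rfl

theorem p_dvd_of_zero {n e : ℕ} {d : ℤ} (h : (p:ZMod (p^L))^e * (d:ZMod (p^L)) = 0) (hL : e + n ≤ L) :
    ((p^n:ℕ):ℤ) ∣ d := by
  have h1 : (((p:ℤ)^e * d : ℤ) : ZMod (p^L)) = 0 := by push_cast; exact h
  rw [ZMod.intCast_zmod_eq_zero_iff_dvd] at h1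
  have : (p:ℤ)^e ≠ 0 := pow_ne_zero _ (by exact_mod_cast hp.out.ne_zero)
  have h2 : (p:ℤ)^e * (p:ℤ)^n ∣ (p:ℤ)^e * d := by
    rw [← pow_add]; push_cast at h1; exact (pow_dvd_pow _ hL).trans h1
  push_cast
  exact (mul_dvd_mul_iff_left this).1 h2

theorem orth {N : ℕ} (hL : m 0 + N ≤ L) {A I J : Finset ℕ} (hI : I ∈ prt x (p^N) A) (hJ : J ∈ prt x (p^N) A)
    (hne : I ≠ J) : ∑ α, Ff p L 1 m x c I α * (starRingEnd ℂ) (Ff p L 1 m x c J α) = 0 := by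
  unfold Ff
  simp only [map_sum, sum_mul_sum]
  rw [sum_comm]
  refine sum_eq_zero fun i hi => ?_
  rw [sum_comm]
  refine sum_eq_zero fun j hj => ?_
  have hd : (p:ZMod (p^L))^(m 0) * ((x i - x j : ℤ):ZMod (p^L)) ≠ 0 := by
    intro h
    have := p_dvd_of_zero h hL
    obtain ⟨i0, _, _, _, h0⟩ := mem_prt hI
    have hiA := ((h0 i).1 hi)
    obtain ⟨j0, _, _, _, h0'⟩ := mem_prt hJ
    have : x j ≡ x i [ZMOD (p^N:ℕ)] := Int.modEq_iff_dvd.2 this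
    refine hne (prt_disj hI hJ (u := j) ((h0 j).2 ⟨((h0' j).1 hj).1, this.trans hiA.2⟩) hj)
  set d := (p:ZMod (p^L))^(m 0) * ((x i - x j : ℤ):ZMod (p^L))
  have key : ∀ α : Fin 1 → ZMod (p^L), c i * stdAddChar (∑ u : Fin 1, α u * (p:ZMod (p^L))^(m u) * (x i:ZMod (p^L))^((u:ℕ)+1)) *
      (starRingEnd ℂ) (c j * stdAddChar (∑ u : Fin 1, α u * (p:ZMod (p^L))^(m u) * (x j:ZMod (p^L))^((u:ℕ)+1))) =
      c i * (starRingEnd ℂ) (c j) * stdAddChar (α 0 * d) := by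
    intro α
    rw [map_mul, ← AddChar.map_neg_eq_conj]
    have : ∀ a b e f : ℂ, a * b * (e * f) = a * e * (b * f) := fun a b e f => by ring
    rw [this, ← map_add_eq_mul]
    congr 2
    simp [d]; ring
  rw [sum_congr rfl fun α _ => key α, ← mul_sum]
  have := AddChar.sum_mulShift d (ZMod.isPrimitive_stdAddChar (p^L))
  rw [if_neg hd] at this
  rw [← (Equiv.funUnique (Fin 1) (ZMod (p^L))).symm.sum_comp]
  simp only [Equiv.funUnique_symm_apply, uniqueElim_const]
  rw [this]; simp

theorem Dec_one (N : ℕ) : Dec p 1 N 1 := by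
  intro L m hm hL x c A
  have hL0 : m 0 + N ≤ L := by simpa using hL 0 (by norm_num)
  rw [tri_one]
  simp only [one_mul, pow_one, Sd, Nat.cast_one, div_one, rpow_one]
  have cx : ∀ I, ((Mo p L 1 m x c 1 I : ℝ) : ℂ) = ∑ α, Ff p L 1 m x c I α * (starRingEnd ℂ) (Ff p L 1 m x c I α) := by
    intro I; unfold Mo; push_cast
    exact sum_congr rfl fun α _ => by rw [Complex.mul_conj']
  refine le_of_eq ?_
  have : ((Mo p L 1 m x c 1 A : ℝ) : ℂ) = ((∑ I ∈ prt x (p^N) A, Mo p L 1 m x c 1 I : ℝ) : ℂ) := by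
    rw [cx]; push_cast
    simp only [cx]
    simp only [Ff_prt (p^N) A, map_sum, sum_mul_sum]
    rw [sum_comm]
    refine sum_congr rfl fun I hI => ?_
    rw [sum_comm, sum_eq_single I]
    · intro J hJ hne; exact orth hL0 hI hJ hne.symm
    · exact fun h => absurd hI h
  exact_mod_cast this

section
variable (p L k m x c)
def Bil (N l a b : ℕ) (B : ℝ) : Prop := ∀ (A1 A2 : Finset ℕ) (ξ η : ℤ),
  (∀ i ∈ A1, x i ≡ ξ [ZMOD (p^a:ℕ)]) → (∀ i ∈ A2, x i ≡ η [ZMOD (p^b:ℕ)]) → ¬ (p:ℤ) ∣ ξ - η →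
  ∑ α, ‖Ff p L k m x c A1 α‖^(2*tri l) * ‖Ff p L k m x c A2 α‖^(2*(tri k - tri l)) ≤
    B * Sd p L k m x c (tri k) N A1 ^ tri l * Sd p L k m x c (tri k) N A2 ^ (tri k - tri l)
end

theorem isUnit_of_not_dvd {z : ℤ} (h : ¬ (p:ℤ) ∣ z) : IsUnit (z : ZMod (p^L)) := by
  have : IsCoprime (p:ℤ) z := (Nat.prime_iff_prime_int.1 hp.out).coprime_iff_not_dvd.2 h
  have := (this.pow_left (m := L)).symm
  obtain ⟨u, v, huv⟩ := this
  refine IsUnit.of_mul_eq_one (u : ZMod (p^L)) ?_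
  have := congrArg (Int.cast : ℤ → ZMod (p^L)) huv
  push_cast at this
  have hz : (p:ZMod (p^L))^L = 0 := by
    have := ZMod.natCast_self (p^L); push_cast at this; exact this
  rw [hz, mul_zero, add_zero] at this
  rw [mul_comm]; exact this

theorem pz {e : ℕ} (h : L ≤ e) : (p:ZMod (p^L))^e = 0 := by
  have hz : (p:ZMod (p^L))^L = 0 := by
    have := ZMod.natCast_self (p^L); push_cast at this; exact this
  rw [← Nat.add_sub_cancel' h, pow_add, hz, zero_mul]

/-- Step 1 -/
theorem step1 (hpk : k < p) {N N' l a b : ℕ} {B D : ℝ} (hB : 0 ≤ B) (hD0 : 0 ≤ D) (hm : Monotone m)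
    (hL : ∀ j, j < k → m j + (j+1)*N ≤ L) (hl : 1 ≤ l) (hlk : l < k) (ha : a ≠ 0) (h1 : l * N' ≤ a)
    (h2 : l * (a + N') ≤ (k-l+1)*b) (h3 : l * (a+N') ≤ N)
    (hD : Dec p l N' D) (hBil : Bil p L k m x c N l (a+N') b B) : Bil p L k m x c N l a b (D * B) := by
  intro A1 A2 ξ η hA1 hA2 hξη
  obtain ⟨y, hy⟩ := choose_aff hA1
  obtain ⟨z, hz⟩ := choose_aff hA2
  push_cast at hy hz
  set d := k - l with hd
  set B' := l*(a+N') with hB'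
  set ζ : ℤ := ξ - η with hζ
  have hBm : ∀ j : Fin k, m j + B' ≤ L := fun j => by
    have := hL j j.2; nlinarith [Nat.zero_le ((j:ℕ)*N)]
  have hBL : B' ≤ L := le_trans (Nat.le_add_left _ _) (hBm ⟨0, by omega⟩)
  set M := (Matrix.of fun (i j : Fin l) =>
      ((Nat.choose (d+j+1) (i+1) : ℕ) : ZMod (p^L)) * (ζ:ZMod (p^L))^(d+(j:ℕ)+1-((i:ℕ)+1))) with hM
  have hMb : Function.Bijective M.mulVec := by
    refine bij_of_unit (detUnit (ZMod (p^L)) l d (ζ:ZMod (p^L)) (isUnit_of_not_dvd hξη) fun n hn hn' => ?_)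
    have := isUnit_of_not_dvd (p := p) (L := L) (z := (n:ℤ)) (by
      intro h; have := Nat.le_of_dvd hn (Int.natCast_dvd_natCast.1 h); omega)
    simpa using this
  -- the shift
  set v : (Fin l → ZMod (p^L)) → (Fin k → ZMod (p^L)) := fun t i => (p:ZMod (p^L))^(L - B' - m i) *
    ∑ j : Fin l, t j * ((Nat.choose (d+j+1) ((i:ℕ)+1) : ℕ):ZMod (p^L)) * (-(η:ZMod (p^L)))^(d+(j:ℕ)+1-((i:ℕ)+1)) with hv
  have hvx : ∀ t (X : ZMod (p^L)), ∑ i : Fin k, v t i * (p:ZMod (p^L))^(m i) * X^((i:ℕ)+1) =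
      (p:ZMod (p^L))^(L-B') * ∑ j : Fin l, t j * (((-(η:ZMod (p^L))) + X)^(d+(j:ℕ)+1) - (-(η:ZMod (p^L)))^(d+(j:ℕ)+1)) := by
    intro t X
    have : ∀ j : Fin l, ((-(η:ZMod (p^L))) + X)^(d+(j:ℕ)+1) - (-(η:ZMod (p^L)))^(d+(j:ℕ)+1) = _ := fun j => by
      rw [binom_split (d+(j:ℕ)+1) k (by have := j.2; omega), add_sub_cancel_left]
    simp only [this, hv, mul_sum, sum_mul]
    rw [sum_comm]
    refine sum_congr rfl fun j _ => sum_congr rfl fun i _ => ?_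
    have e : (p:ZMod (p^L))^(L-B') = (p:ZMod (p^L))^(L-B'-m i) * (p:ZMod (p^L))^(m i) := by
      rw [← pow_add]; congr 1; have := hBm i; omega
    rw [e]; ring
  have hFv : ∀ (A : Finset ℕ) (α : Fin k → ZMod (p^L)) t, Ff p L k m x c A (α + v t) = ∑ i ∈ A, c i * stdAddChar
      (∑ j : Fin k, α j * (p:ZMod (p^L))^(m j) * (x i:ZMod (p^L))^((j:ℕ)+1) + (p:ZMod (p^L))^(L-B') * ∑ j : Fin l, t j *
        (((-(η:ZMod (p^L))) + x i)^(d+(j:ℕ)+1) - (-(η:ZMod (p^L)))^(d+(j:ℕ)+1))) := by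
    intro A α t
    unfold Ff
    refine sum_congr rfl fun i _ => ?_
    rw [← hvx, ← sum_add_distrib]
    congr 2
    exact sum_congr rfl fun j _ => by simp only [Pi.add_apply]; ring
  have hw : ∀ (α : Fin k → ZMod (p^L)) t, ‖Ff p L k m x c A2 (α + v t)‖ = ‖Ff p L k m x c A2 α‖ := by
    intro α t
    rw [hFv]
    refine norm_phase A2 c _ _ ((p:ZMod (p^L))^(L-B') * ∑ j : Fin l, t j * (- (-(η:ZMod (p^L)))^(d+(j:ℕ)+1))) fun i hi => ?_
    rw [add_comm]; congr 1
    simp only [mul_sum]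
    refine sum_congr rfl fun j _ => ?_
    have : (p:ZMod (p^L))^(L-B') * ((-(η:ZMod (p^L))) + x i)^(d+(j:ℕ)+1) = 0 := by
      rw [hz i hi]; push_cast
      rw [neg_add_cancel_left, mul_pow, ← pow_mul, ← mul_assoc, ← pow_add, pz, zero_mul]
      have : (d+1)*b ≤ b*(d+j+1) := by nlinarith [Nat.zero_le ((j:ℕ)*b)]
      omega
    linear_combination (t j) * this
  set m' : ℕ → ℕ := fun i => L - B' + a*(i+1) with hm'
  -- identity on A1 pieces
  have hF1 : ∀ (J : Finset ℕ), J ⊆ A1 → ∀ (α : Fin k → ZMod (p^L)), ∑ t, ‖Ff p L k m x c J (α + v t)‖^(2*tri l) =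
      Mo p L l m' y (fun i => c i * stdAddChar (∑ j : Fin k, α j * (p:ZMod (p^L))^(m j) * (x i:ZMod (p^L))^((j:ℕ)+1))) (tri l) J := by
    intro J hJ α
    unfold Mo
    rw [← hMb.sum_comp (fun t => ‖Ff p L l m' y (fun i => c i * stdAddChar (∑ j : Fin k, α j * (p:ZMod (p^L))^(m j) * (x i:ZMod (p^L))^((j:ℕ)+1))) J t‖^(2*tri l))]
    refine sum_congr rfl fun t _ => ?_
    congr 1
    rw [hFv]
    simp only [map_add_eq_mul]
    unfold Ff
    simp only [← mul_assoc]
    refine norm_phase J _ _ _ ((p:ZMod (p^L))^(L-B') * ∑ j : Fin l, t j * ((ζ:ZMod (p^L))^(d+(j:ℕ)+1)-(-(η:ZMod (p^L)))^(d+(j:ℕ)+1))) fun i hi => ?_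
    rw [hy i (hJ hi)]
    have e : ∀ j : Fin l, (p:ZMod (p^L))^(L-B') * ((-(η:ZMod (p^L))) + ((ξ + (p:ℤ)^a * y i : ℤ):ZMod (p^L)))^(d+(j:ℕ)+1) =
        (p:ZMod (p^L))^(L-B') * (ζ:ZMod (p^L))^(d+(j:ℕ)+1) + ∑ u : Fin l, M u j * (p:ZMod (p^L))^(m' u) * (y i:ZMod (p^L))^((u:ℕ)+1) := by
      intro j
      have : (-(η:ZMod (p^L))) + ((ξ + (p:ℤ)^a * y i : ℤ):ZMod (p^L)) = (ζ:ZMod (p^L)) + (p:ZMod (p^L))^a * (y i:ZMod (p^L)) := by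
        rw [hζ]; push_cast; ring
      rw [this, binom_split (d+(j:ℕ)+1) k (by have := j.2; omega), mul_add]
      congr 1
      rw [Fin.sum_univ_eq_sum_range (fun i_1 => (((d+(j:ℕ)+1).choose (i_1+1)):ZMod (p^L)) * (ζ:ZMod (p^L))^(d+(j:ℕ)+1-(i_1+1)) * ((p:ZMod (p^L))^a * (y i:ZMod (p^L)))^(i_1+1)) k]
      have := Finset.sum_range_add_sum_Ico (fun i_1 => (((d+(j:ℕ)+1).choose (i_1+1)):ZMod (p^L)) * (ζ:ZMod (p^L))^(d+(j:ℕ)+1-(i_1+1)) * ((p:ZMod (p^L))^a * (y i:ZMod (p^L)))^(i_1+1)) hlk.le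
      rw [← this, mul_add, ← Fin.sum_univ_eq_sum_range (fun i_1 => (((d+(j:ℕ)+1).choose (i_1+1)):ZMod (p^L)) * (ζ:ZMod (p^L))^(d+(j:ℕ)+1-(i_1+1)) * ((p:ZMod (p^L))^a * (y i:ZMod (p^L)))^(i_1+1)) l]
      have z0 : (p:ZMod (p^L))^(L-B') * ∑ u ∈ Ico l k, (((d+(j:ℕ)+1).choose (u+1)):ZMod (p^L)) * (ζ:ZMod (p^L))^(d+(j:ℕ)+1-(u+1)) * ((p:ZMod (p^L))^a * (y i:ZMod (p^L)))^(u+1) = 0 := by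
        rw [mul_sum]
        refine sum_eq_zero fun u hu => ?_
        have : (p:ZMod (p^L))^(L-B') * ((p:ZMod (p^L))^a)^(u+1) = 0 := by
          rw [← pow_mul, ← pow_add, pz]
          have := (mem_Ico.1 hu).1
          have : B' ≤ a*(u+1) := by nlinarith
          omega
        rw [mul_pow]; linear_combination ((((d+(j:ℕ)+1).choose (u+1)):ZMod (p^L)) * (ζ:ZMod (p^L))^(d+(j:ℕ)+1-(u+1)) * (y i:ZMod (p^L))^(u+1)) * this
      rw [z0, add_zero, mul_sum]
      refine sum_congr rfl fun u _ => ?_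
      simp only [hM, Matrix.of_apply, hm', pow_add (p:ZMod (p^L)), mul_pow, pow_mul]
      ring
    have e2 : ∑ u : Fin l, (M.mulVec t) u * (p:ZMod (p^L))^(m' u) * (y i:ZMod (p^L))^((u:ℕ)+1) =
        ∑ j : Fin l, t j * ∑ u : Fin l, M u j * (p:ZMod (p^L))^(m' u) * (y i:ZMod (p^L))^((u:ℕ)+1) := by
      simp only [Matrix.mulVec, dotProduct, sum_mul, mul_sum]
      rw [sum_comm]
      exact sum_congr rfl fun j _ => sum_congr rfl fun u _ => by ring
    rw [e2, mul_sum, mul_sum, ← sum_add_distrib]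
    refine sum_congr rfl fun j _ => ?_
    linear_combination (t j) * e j
  have haN : a + N' ≤ N := le_trans (Nat.le_mul_of_pos_left _ hl) h3
  rw [Sd_prt haN A1]
  refine absStep v (prt x (p^(a+N')) A1) (fun α => ‖Ff p L k m x c A1 α‖^(2*tri l))
    (fun α => ‖Ff p L k m x c A2 α‖^(2*(tri k - tri l))) (fun J α => ‖Ff p L k m x c J α‖^(2*tri l))
    (fun J => Sd p L k m x c (tri k) N J) (tri l) (tri_pos hl) D B
    (Sd p L k m x c (tri k) N A2 ^ (tri k - tri l)) hD0 hB (pow_nonneg Sd_nonneg _)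
    (fun α => by positivity) (fun _ α => by positivity) (fun _ => Sd_nonneg)
    (fun α t => by simp only [hw]) ?_ ?_
  · intro α
    rw [hF1 A1 (le_refl _), prt_aff N' hy]
    refine (hD L m' (fun i j hij => by simp only [hm']; gcongr) (fun j hj => ?_) y _ A1).trans (le_of_eq ?_)
    · simp only [hm']
      have : a*(j+1) + (j+1)*N' ≤ B' := by rw [hB']; nlinarith [Nat.mul_le_mul_right (a+N') (show j+1 ≤ l from hj)]
      omega
    · unfold Sd
      congr 2
      refine sum_congr rfl fun J hJ => ?_
      obtain ⟨_, _, _, hs, _⟩ := mem_prt hJ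
      rw [hF1 J hs]
  · intro J hJ
    obtain ⟨i, hi, _, hs, hh⟩ := mem_prt hJ
    refine hBil J A2 (x i) η (fun j hj => ((hh j).1 hj).2) hA2 ?_
    intro hdv
    apply hξη
    have : (p:ℤ) ∣ ξ - x i := by
      have := Int.modEq_iff_dvd.1 (hA1 i hi)
      refine dvd_trans ?_ this
      push_cast; exact dvd_pow_self _ ha
    have := dvd_add this hdv
    simpa using this
end

noncomputable section
variable {p L k : ℕ} [hp : Fact p.Prime] {m : ℕ → ℕ} {x : ℕ → ℤ} {c : ℕ → ℂ}

theorem Dec_mono {N : ℕ} {C C' : ℝ} (h : C ≤ C') (hD : Dec p k N C) : Dec p k N C' :=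
  fun L m hm hL x c A => (hD L m hm hL x c A).trans
    (mlr h (pow_nonneg Sd_nonneg _))

theorem Bil_mono {N l a b : ℕ} {B B' : ℝ} (h : B ≤ B') (hD : Bil p L k m x c N l a b B) :
    Bil p L k m x c N l a b B' := fun A1 A2 ξ η h1 h2 h3 => (hD A1 A2 ξ η h1 h2 h3).trans (by
  rw [mul_assoc, mul_assoc]
  exact mlr h (mul_nonneg (pow_nonneg Sd_nonneg _) (pow_nonneg Sd_nonneg _)))

theorem tri_id {k l : ℕ} (hl : 1 ≤ l) (hlk : l < k) :
    tri l * (k-l+1) = (tri k - tri (k-l)) + tri (l-1) * (k-l) ∧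
    (tri k - tri l) * (k-l+1) = tri (k-l) + (tri k - tri (l-1)) * (k-l) := by
  obtain ⟨d, rfl⟩ := Nat.exists_eq_add_of_le hlk.le
  obtain ⟨e, rfl⟩ := Nat.exists_eq_add_of_le' hl
  have h1 := two_tri (e+1); have h2 := two_tri (e+1+d); have h3 := two_tri d; have h4 := two_tri e
  have m1 := tri_mono (show e+1 ≤ e+1+d by omega); have m2 := tri_mono (show d ≤ e+1+d by omega)
  have m3 := tri_mono (show e ≤ e+1+d by omega)
  simp only [Nat.add_sub_cancel_left, Nat.add_sub_cancel]
  zify [m1, m2, m3] at *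
  constructor
  · refine mul_left_cancel₀ (show (2:ℤ) ≠ 0 by norm_num) ?_
    linear_combination (d+1:ℤ) * h1 - h2 + h3 - (d:ℤ)*h4
  · refine mul_left_cancel₀ (show (2:ℤ) ≠ 0 by norm_num) ?_
    linear_combination -(d+1:ℤ) * h1 + h2 - h3 + (d:ℤ)*h4

theorem step2 {N l a b : ℕ} {B1 B2 : ℝ} (h1 : 0 ≤ B1) (h2 : 0 ≤ B2) (hl : 1 ≤ l) (hlk : l < k)
    (hb1 : Bil p L k m x c N (k-l) b a B1) (hb2 : Bil p L k m x c N (l-1) a b B2) :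
    Bil p L k m x c N l a b ((B1 * B2^(k-l))^(1/((k-l+1:ℕ):ℝ))) := by
  intro A1 A2 ξ η hA1 hA2 hne
  have g1 := hb1 A2 A1 η ξ hA2 hA1 (fun h => hne (by have := (dvd_neg (a := (p:ℤ))).2 h; simpa using this))
  have g2 := hb2 A1 A2 ξ η hA1 hA2 hne
  obtain ⟨t1, t2⟩ := tri_id hl hlk
  set S1 := Sd p L k m x c (tri k) N A1
  set S2 := Sd p L k m x c (tri k) N A2
  have hS1 : 0 ≤ S1 := Sd_nonneg
  have hS2 : 0 ≤ S2 := Sd_nonneg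
  have pw : ∀ u v : ℝ, (u^(2*tri l) * v^(2*(tri k - tri l)))^(k-l+1) =
      (v^(2*tri (k-l)) * u^(2*(tri k - tri (k-l)))) * (u^(2*tri (l-1)) * v^(2*(tri k - tri (l-1))))^(k-l) := by
    intro u v
    rw [mul_pow, mul_pow, ← pow_mul, ← pow_mul, ← pow_mul, ← pow_mul, mul_assoc 2, mul_assoc 2, t1, t2,
      mul_add, mul_add, pow_add, pow_add]; ring
  have pw' : ∀ u v : ℝ, (u^(tri l) * v^((tri k - tri l)))^(k-l+1) =
      (v^(tri (k-l)) * u^((tri k - tri (k-l)))) * (u^(tri (l-1)) * v^((tri k - tri (l-1))))^(k-l) := by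
    intro u v
    rw [mul_pow, mul_pow, ← pow_mul, ← pow_mul, ← pow_mul, ← pow_mul, t1, t2, pow_add, pow_add]; ring
  have hh := holderN (k-l+1) (by omega)
    (fun α => ‖Ff p L k m x c A1 α‖^(2*tri l) * ‖Ff p L k m x c A2 α‖^(2*(tri k - tri l)))
    (fun α => ‖Ff p L k m x c A2 α‖^(2*tri (k-l)) * ‖Ff p L k m x c A1 α‖^(2*(tri k - tri (k-l))))
    (fun α => ‖Ff p L k m x c A1 α‖^(2*tri (l-1)) * ‖Ff p L k m x c A2 α‖^(2*(tri k - tri (l-1))))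
    (fun α => by positivity) (fun α => by positivity) (fun α => by positivity) (fun α => pw _ _)
  simp only [Nat.add_sub_cancel] at hh
  refine le_of_pow_le_pow_left₀ (n := k-l+1) (by omega) (by positivity) (hh.trans ?_)
  calc _ ≤ (B1 * S2^tri (k-l) * S1^(tri k - tri (k-l))) * (B2 * S1^tri (l-1) * S2^(tri k - tri (l-1)))^(k-l) := by
        gcongr
    _ = (B1 * B2^(k-l)) * (S1^(tri l) * S2^((tri k - tri l)))^(k-l+1) := by rw [pw']; ring
    _ = _ := by
        rw [mul_assoc (_ ^ _) _ _, mul_pow ((B1 * B2^(k-l))^(1/((k-l+1:ℕ):ℝ))), one_div, rpow_inv_natCast_pow (by positivity) (by omega)]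

theorem Bil_zero {N a b : ℕ} {D : ℝ} (hm : Monotone m) (hL : ∀ j, j < k → m j + (j+1)*N ≤ L) (hb : b ≤ N)
    (hD : Dec p k (N-b) D) : Bil p L k m x c N 0 a b D := by
  intro A1 A2 ξ η hA1 hA2 hne
  have e : b + (N-b) = N := by omega
  have := Dec_aff (x := x) (c := c) hD hm (by rw [e]; exact hL) hA2
  rw [e] at this
  simpa [tri, Mo] using this

theorem Bil_triv {N l a b : ℕ} {D : ℝ} (hk : 1 ≤ k) (hD0 : 0 ≤ D) (hm : Monotone m) (hL : ∀ j, j < k → m j + (j+1)*N ≤ L)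
    (hlk : l ≤ k) (hD : Dec p k N D) : Bil p L k m x c N l a b D := by
  intro A1 A2 ξ η hA1 hA2 hne
  have h1 := hD L m hm hL x c A1
  have h2 := hD L m hm hL x c A2
  set s := tri k
  have hs : 1 ≤ s := tri_pos hk
  have hls : tri l ≤ s := tri_mono hlk
  set S1 := Sd p L k m x c s N A1
  set S2 := Sd p L k m x c s N A2
  have hS1 : 0 ≤ S1 := Sd_nonneg
  have hS2 : 0 ≤ S2 := Sd_nonneg
  have sR : (0:ℝ) < s := by exact_mod_cast hs
  set w1 : ℝ := tri l / s
  set w2 : ℝ := ((s - tri l : ℕ):ℝ) / s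
  have w12 : w1 + w2 = 1 := by
    simp only [w1, w2]; push_cast [Nat.cast_sub hls]; field_simp; ring
  have hw1 : 0 ≤ w1 := by positivity
  have hw2 : 0 ≤ w2 := by positivity
  have hold : ∑ α, ‖Ff p L k m x c A1 α‖^(2*tri l) * ‖Ff p L k m x c A2 α‖^(2*(s - tri l)) ≤
      Mo p L k m x c s A1 ^ w1 * Mo p L k m x c s A2 ^ w2 := by
    have pe : ∀ (u : ℝ) (e : ℕ), 0 ≤ u → u^(2*e) = (u^(2*s))^((e:ℝ)/s) := by
      intro u e hu
      rw [← rpow_natCast, ← rpow_natCast, ← rpow_mul hu]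
      congr 1; push_cast; field_simp
    calc _ = ∑ α, (‖Ff p L k m x c A1 α‖^(2*s))^w1 * (‖Ff p L k m x c A2 α‖^(2*s))^w2 := by
          refine sum_congr rfl fun α _ => ?_
          rw [pe _ _ (norm_nonneg _), pe _ (s - tri l) (norm_nonneg _)]
      _ ≤ _ := by
        rcases eq_or_lt_of_le hw1 with h | h
        · rw [← h] at w12 ⊢
          have : w2 = 1 := by linarith
          simp [this, Mo]
        rcases eq_or_lt_of_le hw2 with h' | h'
        · rw [← h'] at w12 ⊢
          have : w1 = 1 := by linarith
          simp [this, Mo]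
        have hc : (1/w1).HolderConjugate (1/w2) := by
          rw [Real.holderConjugate_iff]; refine ⟨?_, by simp [w12]⟩
          rw [lt_div_iff₀ h]; linarith
        have := Real.inner_le_Lp_mul_Lq_of_nonneg univ hc
          (f := fun α => (‖Ff p L k m x c A1 α‖^(2*s))^w1) (g := fun α => (‖Ff p L k m x c A2 α‖^(2*s))^w2)
          (fun _ _ => by positivity) (fun _ _ => by positivity)
        have e1 : ∀ (u w : ℝ), 0 ≤ u → 0 < w → (u^w)^(1/w) = u := fun u w hu hw => by
          rw [← rpow_mul hu]; field_simp; simp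
        simp only [one_div_one_div] at this
        refine this.trans (le_of_eq ?_)
        unfold Mo
        congr 2 <;> exact sum_congr rfl fun α _ => e1 _ _ (by positivity) (by assumption)
  refine hold.trans ?_
  have re : ∀ (u : ℝ) (e : ℕ), 0 ≤ u → (D * u^s)^((e:ℝ)/s) = D^((e:ℝ)/s) * u^e := by
    intro u e hu
    rw [mul_rpow hD0 (by positivity), ← rpow_natCast u s, ← rpow_mul hu,
      mul_div_cancel₀ _ sR.ne', rpow_natCast]
  calc _ ≤ (D*S1^s)^w1 * (D*S2^s)^w2 := by
        gcongr <;> first | exact Mo_nonneg | exact rpow_nonneg Mo_nonneg _ | assumption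
    _ = D^w1 * S1^(tri l) * (D^w2 * S2^(s - tri l)) := by rw [re _ _ hS1, re _ _ hS2]
    _ = (D^w1 * D^w2) * S1^(tri l) * S2^(s - tri l) := by ring
    _ = _ := by rw [← Real.rpow_add_of_nonneg hD0 hw1 hw2, w12, rpow_one]

theorem iter1 (hpk : k < p) {N l b as : ℕ} {B D : ℝ} (hB : 0 ≤ B) (hD1 : 1 ≤ D) (hm : Monotone m)
    (hL : ∀ j, j < k → m j + (j+1)*N ≤ L) (hl : 1 ≤ l) (hlk : l < k)
    (has : l * as = (k-l+1)*b) (hN : (k-l+1)*b ≤ N)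
    (hD : ∀ N', N' ≤ N → Dec p l N' D) (hBil : Bil p L k m x c N l as b B) :
    ∀ r a, l ≤ a → a ≤ as → as*(2*k)^r ≤ a*(2*k+1)^r → Bil p L k m x c N l a b (D^r * B) := by
  intro r
  induction r with
  | zero =>
    intro a h1 h2 h3
    have : a = as := by simp at h3; omega
    subst this; simpa using hBil
  | succ r ih =>
    intro a h1 h2 h3
    have hdiv : 1 ≤ a / l := (Nat.one_le_div_iff (by omega)).2 h1
    have hdm := Nat.div_add_mod a l
    have hml := Nat.mod_lt a (show 0 < l by omega)
    have hN' : l * min (a/l) (as - a) ≤ a := (Nat.mul_le_mul_left _ (min_le_left _ _)).trans (Nat.mul_div_le a l)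
    have hle : a + min (a/l) (as-a) ≤ as := by have := min_le_right (a/l) (as-a); omega
    have hle' : l * (a + min (a/l) (as-a)) ≤ (k-l+1)*b := by rw [← has]; exact Nat.mul_le_mul_left _ hle
    have := ih (a + min (a/l) (as-a)) (by omega) hle (by
      rcases le_total (a/l) (as-a) with h | h
      · rw [min_eq_left h]
        have e1 : a * (2*k+1) ≤ (a + a/l) * (2*k) := by
          have : a ≤ a/l * (2*k) := by
            calc a ≤ 2 * (l * (a/l)) := by nlinarith
              _ ≤ 2 * (k * (a/l)) := by gcongr
              _ = _ := by ring
          nlinarith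
        have e2 : as * (2*k)^r * (2*k) ≤ (a + a/l) * (2*k+1)^r * (2*k) := by
          calc _ = as*(2*k)^(r+1) := by ring
            _ ≤ a*(2*k+1)^(r+1) := h3
            _ = (a*(2*k+1))*(2*k+1)^r := by ring
            _ ≤ ((a + a/l) * (2*k))*(2*k+1)^r := by gcongr
            _ = _ := by ring
        exact Nat.le_of_mul_le_mul_right e2 (by omega)
      · rw [min_eq_right h, Nat.add_sub_cancel' h2]; gcongr; omega)
    have := step1 hpk (by positivity) (by linarith) hm hL hl hlk (by omega) hN' hle' (hle'.trans hN)
      (hD _ (by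
        have := Nat.le_mul_of_pos_left (a + min (a/l) (as-a)) (show 0 < l by omega)
        omega)) this
    rwa [pow_succ', mul_assoc]
end

noncomputable section
variable {p L k : ℕ} [hp : Fact p.Prime] {m : ℕ → ℕ} {x : ℕ → ℤ} {c : ℕ → ℂ}

def Adm (p k : ℕ) [Fact p.Prime] (η : ℝ) : Prop := ∃ C : ℝ, 1 ≤ C ∧ ∀ N : ℕ, Dec p k N (C * (p:ℝ)^(η*N))

def Aw (k : ℕ) (η : ℝ) : ℕ → ℕ → ℝ
  | 0, _ => 0
  | n+1, l => Aw k η n (k-l) / l + ((k-l:ℕ):ℝ)/((k-l+1:ℕ):ℝ) * (if l = 1 then η else Aw k η n (l-1))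

theorem Aw_sum (hk : 2 ≤ k) (η : ℝ) (n : ℕ) :
    ∑ l ∈ Ico 1 k, Aw k η n l = n * (((k:ℝ)-1)/k * η) := by
  induction n with
  | zero => simp [Aw]
  | succ n ih =>
    simp only [Aw, sum_add_distrib]
    have e1 : ∑ l ∈ Ico 1 k, Aw k η n (k-l) / (l:ℝ) = ∑ l ∈ Ico 1 k, Aw k η n l / ((k-l:ℕ):ℝ) := by
      refine sum_nbij' (fun l => k - l) (fun l => k - l) ?_ ?_ ?_ ?_ ?_ <;>
        simp only [mem_Ico] <;> intro l hl
      · omega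
      · omega
      · omega
      · omega
      · rw [Nat.sub_sub_self hl.2.le]
    have e2 : ∑ l ∈ Ico 1 k, ((k-l:ℕ):ℝ)/((k-l+1:ℕ):ℝ) * (if l = 1 then η else Aw k η n (l-1)) =
        ((k:ℝ)-1)/k * η + ∑ l ∈ Ico 1 k, ((k-l-1:ℕ):ℝ)/((k-l:ℕ):ℝ) * Aw k η n l := by
      rw [Finset.sum_eq_sum_Ico_succ_bot (by omega)]
      congr 1
      · have : k - 1 + 1 = k := by omega
        simp only [if_true, this]; push_cast [Nat.cast_sub (show 1 ≤ k by omega)]; ring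
      · obtain ⟨K, rfl⟩ := Nat.exists_eq_add_of_le' (show 1 ≤ k by omega)
        rw [← Finset.sum_Ico_add' _ 1 K 1, Finset.sum_Ico_succ_top (show 1 ≤ K by omega)]
        simp only [Nat.add_sub_cancel, Nat.add_sub_cancel_left, Nat.sub_self, Nat.cast_zero, zero_div, zero_mul, add_zero]
        refine sum_congr rfl fun l hl => ?_
        have := mem_Ico.1 hl
        rw [if_neg (by omega), show K+1-(l+1) = K+1-l-1 by omega, show K+1-l-1+1 = K+1-l by omega]
    rw [e1, e2]
    have : ∑ l ∈ Ico 1 k, Aw k η n l / ((k-l:ℕ):ℝ) + ∑ l ∈ Ico 1 k, ((k-l-1:ℕ):ℝ)/((k-l:ℕ):ℝ) * Aw k η n l = ∑ l ∈ Ico 1 k, Aw k η n l := by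
      rw [← sum_add_distrib]
      refine sum_congr rfl fun l hl => ?_
      have := mem_Ico.1 hl
      have h1 : (0:ℝ) < ((k-l:ℕ):ℝ) := by exact_mod_cast (by omega : 0 < k - l)
      push_cast [Nat.cast_sub (show 1 ≤ k - l by omega)]
      field_simp; ring
    push_cast
    linear_combination this + ih

theorem pone : (1:ℝ) < p := by exact_mod_cast hp.out.one_lt
theorem ppos : (0:ℝ) < p := by exact_mod_cast hp.out.pos

theorem St (hpk : k < p) (hk : 2 ≤ k) {η : ℝ} (hη : ∀ ε > 0, Adm p k (η+ε))
    (hlow : ∀ l, 1 ≤ l → l < k → ∀ ε > 0, Adm p l ε) (n : ℕ) :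
    ∀ ε > 0, ∃ C : ℝ, 1 ≤ C ∧ ∀ (N L : ℕ) (m : ℕ → ℕ) (x : ℕ → ℤ) (c : ℕ → ℂ), Monotone m →
      (∀ j, j < k → m j + (j+1)*N ≤ L) → ∀ l a b, 1 ≤ l → l < k → 0 < b → (k*k*k.factorial)^(n+1) ∣ b →
      k^(n+1)*b ≤ N → l*a ≤ (k-l+1)*b → b ≤ k*a →
      Bil p L k m x c N l a b (C * (p:ℝ)^((η+ε)*N - Aw k η n l * b)) := by
  induction n with
  | zero =>
    intro ε hε
    obtain ⟨C, hC, hD⟩ := hη ε hε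
    refine ⟨C, hC, fun N L m x c hm hL l a b h1 h2 _ _ _ _ _ => ?_⟩
    simp only [Aw, zero_mul, sub_zero]
    exact Bil_triv (by omega) (by positivity) hm hL h2.le (hD N)
  | succ n ih =>
    intro ε hε
    obtain ⟨C1, hC1, h1⟩ := ih (ε/2) (by positivity)
    obtain ⟨C2, hC2, h2⟩ := hη (ε/2) (by positivity)
    have hkR : (0:ℝ) < k := by exact_mod_cast (by omega : 0 < k)
    obtain ⟨r, hr⟩ := pow_unbounded_of_one_lt ((k:ℝ)^2) (show 1 < (2*(k:ℝ)+1)/(2*k) by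
      rw [lt_div_iff₀ (by positivity)]; linarith)
    have hr' : k^2*(2*k)^r ≤ (2*k+1)^r := by
      rw [div_pow, lt_div_iff₀ (by positivity)] at hr
      exact_mod_cast hr.le
    set ε3 := ε/(2*(r+1)) with hε3
    have hε3p : 0 < ε3 := by positivity
    have hall : ∀ l : ℕ, ∃ C : ℝ, 1 ≤ C ∧ (1 ≤ l → l < k → ∀ N : ℕ, Dec p l N (C * (p:ℝ)^(ε3*N))) := by
      intro l
      by_cases h : 1 ≤ l ∧ l < k
      · obtain ⟨C, hC, hD⟩ := hlow l h.1 h.2 ε3 hε3p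
        exact ⟨C, hC, fun _ _ => hD⟩
      · exact ⟨1, le_refl _, fun a b => absurd ⟨a, b⟩ h⟩
    choose C3 hC3 hD3 using hall
    set C4 := 1 + ∑ l ∈ range k, C3 l with hC4
    have hC4l : ∀ l, l < k → C3 l ≤ C4 := fun l hl => by
      have := single_le_sum (f := C3) (fun i _ => by linarith [hC3 i]) (mem_range.2 hl)
      linarith
    have hC41 : 1 ≤ C4 := by
      have := sum_nonneg (s := range k) (f := C3) (fun i _ => by linarith [hC3 i])
      linarith
    set C12 := max C1 C2
    have hC12 : 1 ≤ C12 := le_max_of_le_left hC1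
    refine ⟨C4^r * C12, one_lm (one_le_pow₀ hC41) hC12, ?_⟩
    intro N L m x c hm hL l a b hl hlk hb hdvd hbN hla hba
    obtain ⟨w, hw⟩ := hdvd
    set Λ := k*k*k.factorial with hΛ
    have hkf : 0 < k.factorial := Nat.factorial_pos k
    obtain ⟨Λ', hΛ'⟩ : l ∣ Λ := (Nat.dvd_factorial (by omega) hlk.le).mul_left _
    have hb' : b = l * (Λ' * Λ^(n+1) * w) := by rw [hw, pow_succ, hΛ']; ring
    set as := (k-l+1) * (Λ' * Λ^(n+1) * w) with has
    have hase : l * as = (k-l+1)*b := by rw [has, hb']; ring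
    have hasb : as ≤ k*b := by
      have : l*as ≤ l*(k*b) := by
        rw [hase]; calc (k-l+1)*b ≤ k*b := by gcongr; omega
          _ ≤ l*(k*b) := Nat.le_mul_of_pos_left _ hl
      exact Nat.le_of_mul_le_mul_left this hl
    have hbka : b ≤ k * as := by
      rw [has, hb']
      calc l * (Λ' * Λ^(n+1) * w) ≤ k * (Λ' * Λ^(n+1) * w) := by gcongr
        _ ≤ k * ((k-l+1) * (Λ' * Λ^(n+1) * w)) := Nat.mul_le_mul_left _ (Nat.le_mul_of_pos_left _ (by omega))
    have has0 : 0 < as := by rcases Nat.eq_zero_or_pos as with h | h <;> [(rw [h] at hbka; omega); exact h]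
    have hkbN : k*b ≤ N := le_trans (by rw [pow_succ]; gcongr; exact Nat.le_mul_of_pos_left _ (by positivity)) hbN
    have hbN0 : b ≤ N := (Nat.le_mul_of_pos_left _ (by omega)).trans hkbN
    -- first bilinear
    have b1 := h1 N L m x c hm hL (k-l) b as (by omega) (by omega) has0
      ⟨(k-l+1)*Λ'*w, by rw [has]; ring⟩
      (le_trans (by rw [pow_succ k (n+1), mul_assoc]; gcongr) hbN) (by
        rw [Nat.sub_sub_self hlk.le]
        have : l*((k-l)*b) ≤ l * ((l+1)*as) := by
          calc l*((k-l)*b) ≤ (l+1)*((k-l+1)*b) := by gcongr <;> omega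
            _ = l * ((l+1)*as) := by rw [← hase]; ring
        exact Nat.le_of_mul_le_mul_left this hl) hasb
    set A' : ℝ := if l = 1 then η else Aw k η n (l-1) with hA'
    have b2 : Bil p L k m x c N (l-1) as b (C12 * (p:ℝ)^((η+ε/2)*N - A' * b)) := by
      by_cases h : l = 1
      · subst h
        refine Bil_mono ?_ (Bil_zero hm hL hbN0 (h2 (N-b)))
        rw [hA', if_pos rfl]
        gcongr
        · exact le_max_right _ _
        · exact pone.le
        · push_cast [Nat.cast_sub hbN0]
          have : 0 ≤ ε/2 * (b:ℝ) := by positivity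
          nlinarith
      · refine Bil_mono ?_ (h1 N L m x c hm hL (l-1) as b (by omega) (by omega) hb ⟨Λ*w, by rw [hw]; ring⟩
          (le_trans (by gcongr <;> omega) hbN) (by
            calc (l-1)*as ≤ l*as := by gcongr; omega
              _ = (k-l+1)*b := hase
              _ ≤ _ := by gcongr; omega) hbka)
        rw [hA', if_neg h]
        gcongr
        exact le_max_left _ _
    have b3 := step2 (by positivity) (by positivity) hl hlk (Bil_mono (mlr
      (le_max_left C1 C2) (rpow_nonneg ppos.le _)) b1) b2
    set n' : ℝ := ((k-l+1:ℕ):ℝ) with hn'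
    have hn'0 : 0 < n' := by positivity
    have hd' : ((k-l:ℕ):ℝ) = n' - 1 := by rw [hn']; push_cast; ring
    have hlR : (0:ℝ) < l := by exact_mod_cast hl
    have haseR : (l:ℝ) * as = n' * b := by rw [hn']; exact_mod_cast hase
    have eB : (C12 * (p:ℝ)^((η+ε/2)*N - Aw k η n (k-l) * as) * (C12 * (p:ℝ)^((η+ε/2)*N - A' * b))^(k-l))^(1/n') =
        C12 * (p:ℝ)^((η+ε/2)*N - Aw k η (n+1) l * b) := by
      have hc12 : 0 < C12 := by linarith
      have e0 : C12 * (p:ℝ)^((η+ε/2)*N - Aw k η n (k-l) * as) * (C12 * (p:ℝ)^((η+ε/2)*N - A' * b))^(k-l) =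
          C12^n' * (p:ℝ)^((((η+ε/2)*N - Aw k η (n+1) l * b))*n') := by
        rw [← rpow_natCast (_ * _) (k-l), mul_rpow hc12.le (rpow_nonneg ppos.le _),
          ← rpow_mul ppos.le, hd', show n' = 1 + (n'-1) by ring, rpow_add hc12, rpow_one]
        rw [show ∀ a b c d : ℝ, a*b*(c*d) = a*c*(b*d) by intros; ring, ← rpow_add ppos]
        simp only [add_sub_cancel_left, add_sub_cancel]
        congr 2
        have : (as:ℝ) = n'*b/l := by field_simp; linarith
        rw [this]
        simp only [Aw]; rw [← hA', ← hn', hd']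
        field_simp; ring
      rw [e0, mul_rpow (by positivity) (rpow_nonneg ppos.le _), ← rpow_mul hc12.le,
        ← rpow_mul ppos.le, mul_assoc, mul_one_div_cancel hn'0.ne', mul_one, rpow_one]
    rw [eB] at b3
    have hal : l ≤ a := by
      have : k*l ≤ k*a := by
        refine le_trans ?_ hba
        have hw0 : 0 < w := by rcases Nat.eq_zero_or_pos w with h | h <;> [(rw [h] at hw; omega); exact h]
        calc k*l ≤ k*k := by gcongr
          _ ≤ Λ := Nat.le_mul_of_pos_right _ hkf
          _ ≤ Λ^(n+1+1) := Nat.le_self_pow (by omega) _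
          _ ≤ b := by rw [hw]; exact Nat.le_mul_of_pos_right _ hw0
      exact Nat.le_of_mul_le_mul_left this (by omega)
    have haas : a ≤ as := Nat.le_of_mul_le_mul_left (hla.trans hase.symm.le) hl
    have hfin := iter1 hpk (by positivity) (D := C4 * (p:ℝ)^(ε3*N))
      (one_lm hC41 (one_le_rpow pone.le (by positivity))) hm hL hl hlk hase
      (by calc (k-l+1)*b ≤ k*b := by gcongr; omega
            _ ≤ N := hkbN)
      (fun N' hN' => Dec_mono (by
        gcongr
        · exact hC4l l hlk
        · exact pone.le) (hD3 l hl hlk N')) b3 r a hal haas (by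
        calc as*(2*k)^r ≤ (k*(k*a))*(2*k)^r := by gcongr; exact hasb.trans (by gcongr)
          _ = a * (k^2*(2*k)^r) := by ring
          _ ≤ _ := by gcongr)
    refine Bil_mono ?_ hfin
    rw [mul_pow, ← rpow_natCast ((p:ℝ)^_) r, ← rpow_mul ppos.le,
      show ∀ a b c d : ℝ, a*b*(c*d) = a*c*(b*d) by intros; ring, ← rpow_add ppos]
    gcongr
    · exact pone.le
    · have : ε3 * r ≤ ε/2 := by
        rw [hε3, div_mul_eq_mul_div, div_le_div_iff₀ (by positivity) (by positivity)]; nlinarith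
      nlinarith [mlr this (Nat.cast_nonneg (α := ℝ) N)]
end

noncomputable section
variable {p L k : ℕ} [hp : Fact p.Prime] {m : ℕ → ℕ} {x : ℕ → ℤ} {c : ℕ → ℂ}

theorem crude {ι : Type*} (P : Finset ι) (f : ι → ℂ) (q M : ℕ) (hq : 1 ≤ q) (hM : P.card ≤ M) :
    ‖∑ I ∈ P, f I‖^q ≤ (M:ℝ)^q * ∑ I ∈ P, ‖f I‖^q := by
  rcases P.eq_empty_or_nonempty with rfl | hne
  · simp [show q ≠ 0 by omega]
  obtain ⟨J, hJ, hmax⟩ := P.exists_max_image (fun I => ‖f I‖) hne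
  have h1 : ‖∑ I ∈ P, f I‖ ≤ M * ‖f J‖ := by
    calc _ ≤ ∑ I ∈ P, ‖f I‖ := norm_sum_le _ _
      _ ≤ P.card • ‖f J‖ := Finset.sum_le_card_nsmul _ _ _ hmax
      _ ≤ _ := by rw [nsmul_eq_mul]; gcongr
  calc _ ≤ (M * ‖f J‖)^q := pow_le_pow_left₀ (norm_nonneg _) h1 q
    _ = (M:ℝ)^q * ‖f J‖^q := mul_pow _ _ _
    _ ≤ _ := by
      gcongr
      exact single_le_sum (f := fun I => ‖f I‖^q) (fun _ _ => by positivity) hJ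

theorem sum_pow_le' {ι : Type*} (P : Finset ι) (e : ι → ℝ) (he : ∀ J, 0 ≤ e J) (s : ℕ) (hs : 1 ≤ s) :
    ∑ J ∈ P, e J^s ≤ (∑ J ∈ P, e J)^s := by
  obtain ⟨t, rfl⟩ := Nat.exists_eq_add_of_le' hs
  rw [pow_succ, mul_sum]
  refine sum_le_sum fun J hJ => ?_
  rw [pow_succ]
  refine mlr (pow_le_pow_left₀ (he J) (single_le_sum (fun I _ => he I) hJ) t) (he J)

theorem broad {ι : Type*} [DecidableEq ι] (P : Finset ι) (f : ι → ℂ) (M u v : ℕ) (hM : P.card ≤ M) (hM1 : 1 ≤ M)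
    (hu : 1 ≤ u) {κ : ℝ} (h0 : 0 < κ) (h1 : κ ≤ 1) :
    ‖∑ I ∈ P, f I‖^(u+v) ≤ (1+κ)^(u+v) * ∑ I ∈ P, ‖f I‖^(u+v) +
      ((M:ℝ)^2/κ)^(u+v) * ∑ J ∈ P, ∑ I ∈ P.erase J, ‖f J‖^u * ‖f I‖^v := by
  have hMR : (1:ℝ) ≤ M := by exact_mod_cast hM1
  rcases P.eq_empty_or_nonempty with rfl | hne
  · simp [show u ≠ 0 by omega]
  obtain ⟨J, hJ, hmax⟩ := P.exists_max_image (fun I => ‖f I‖) hne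
  have n1 : 0 ≤ (1+κ)^(u+v) * ∑ I ∈ P, ‖f I‖^(u+v) := by positivity
  have n2 : 0 ≤ ((M:ℝ)^2/κ)^(u+v) * ∑ J ∈ P, ∑ I ∈ P.erase J, ‖f J‖^u * ‖f I‖^v := by positivity
  by_cases h : ∀ I ∈ P.erase J, ‖f I‖ ≤ κ/M * ‖f J‖
  · refine le_add_of_le_of_nonneg ?_ n2
    have : ‖∑ I ∈ P, f I‖ ≤ (1+κ) * ‖f J‖ := by
      rw [← Finset.add_sum_erase P f hJ]
      calc _ ≤ ‖f J‖ + ∑ I ∈ P.erase J, ‖f I‖ := (norm_add_le _ _).trans (by gcongr; exact norm_sum_le _ _)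
        _ ≤ ‖f J‖ + (P.erase J).card • (κ/M * ‖f J‖) := by
          gcongr; exact Finset.sum_le_card_nsmul _ _ _ h
        _ ≤ ‖f J‖ + M * (κ/M * ‖f J‖) := by
          rw [nsmul_eq_mul]; gcongr; exact (Finset.card_erase_le).trans hM
        _ = _ := by field_simp
    calc _ ≤ ((1+κ)*‖f J‖)^(u+v) := pow_le_pow_left₀ (norm_nonneg _) this _
      _ = (1+κ)^(u+v) * ‖f J‖^(u+v) := mul_pow _ _ _
      _ ≤ _ := by
        gcongr
        exact single_le_sum (f := fun I => ‖f I‖^(u+v)) (fun _ _ => by positivity) hJ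
  · push Not at h
    obtain ⟨I, hI, hlt⟩ := h
    refine le_add_of_nonneg_of_le n1 ?_
    have g1 : ‖∑ I ∈ P, f I‖ ≤ M * ‖f J‖ := by
      calc _ ≤ ∑ I ∈ P, ‖f I‖ := norm_sum_le _ _
        _ ≤ P.card • ‖f J‖ := Finset.sum_le_card_nsmul _ _ _ hmax
        _ ≤ _ := by rw [nsmul_eq_mul]; gcongr
    have g2 : ‖f J‖ ≤ M/κ * ‖f I‖ := by
      have : M/κ * (κ/M * ‖f J‖) ≤ M/κ * ‖f I‖ := by gcongr
      refine le_trans (le_of_eq ?_) this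
      field_simp
    have g3 : (1:ℝ) ≤ M/κ := by rw [le_div_iff₀ h0]; linarith
    calc _ ≤ (M*‖f J‖)^(u+v) := pow_le_pow_left₀ (norm_nonneg _) g1 _
      _ = (M:ℝ)^(u+v) * (‖f J‖^u * ‖f J‖^v) := by rw [mul_pow, pow_add ‖f J‖]
      _ ≤ (M:ℝ)^(u+v) * (‖f J‖^u * ((M/κ)^(u+v) * ‖f I‖^v)) := by
        gcongr
        calc ‖f J‖^v ≤ (M/κ * ‖f I‖)^v := by gcongr
          _ = (M/κ)^v * ‖f I‖^v := mul_pow _ _ _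
          _ ≤ _ := by
            refine mlr (pow_le_pow_right₀ g3 (by omega)) (by positivity)
      _ = ((M:ℝ)^2/κ)^(u+v) * (‖f J‖^u * ‖f I‖^v) := by
        rw [show (M:ℝ)^2/κ = M * (M/κ) by ring, mul_pow (M:ℝ)]; ring
      _ ≤ _ := by
        gcongr
        refine le_trans ?_ (single_le_sum (f := fun J => ∑ I ∈ P.erase J, ‖f J‖^u * ‖f I‖^v)
          (fun _ _ => by positivity) hJ)
        exact single_le_sum (f := fun I => ‖f J‖^u * ‖f I‖^v) (fun _ _ => by positivity) hI

theorem bilRed {N l a b : ℕ} {B D κ : ℝ} (hB : 0 ≤ B) (hD0 : 0 ≤ D) (h0 : 0 < κ) (h1 : κ ≤ 1) (hl : 1 ≤ l) (hlk : l < k)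
    (ha : 1 ≤ a) (hab : a ≤ b) (hbN : b ≤ N) (hm : Monotone m) (hL : ∀ j, j < k → m j + (j+1)*N ≤ L)
    (hBil : Bil p L k m x c N l a b B) (hD : Dec p k (N-1) D) (A : Finset ℕ) :
    Mo p L k m x c (tri k) A ≤ ((1+κ)^(2*tri k) * D + ((p:ℝ)^2/κ)^(2*tri k) * (p:ℝ)^2 * (p:ℝ)^((2*tri k+2)*b) * B) *
      Sd p L k m x c (tri k) N A ^ (tri k) := by
  classical
  set s := tri k
  set S := Sd p L k m x c s N
  have hS0 : ∀ A, 0 ≤ S A := fun A => Sd_nonneg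
  have hls : tri l < s := by have := two_tri l; have := two_tri k; simp only [s]; nlinarith
  have hs1 : 1 ≤ s := by omega
  have hl1 : 1 ≤ tri l := tri_pos hl
  set P := prt x (p^1) A
  have hpc : P.card ≤ p := (card_prt x (p^1) (pow_pos hp.out.pos 1) A).trans_eq (pow_one p)
  have e2s : 2 * tri l + 2*(s - tri l) = 2*s := by omega
  have hpt := fun α => broad P (fun I => Ff p L k m x c I α) p (2*tri l) (2*(s-tri l)) hpc hp.out.one_lt.le (by omega) h0 h1
  simp only [e2s, ← Ff_prt (p^1) A] at hpt
  have hsum := sum_le_sum (s := univ) fun α _ => hpt α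
  rw [sum_add_distrib, ← mul_sum, ← mul_sum, sum_comm] at hsum
  have lin : ∑ I ∈ P, ∑ α, ‖Ff p L k m x c I α‖^(2*s) ≤ D * S A ^ s := by
    calc _ ≤ ∑ I ∈ P, D * S I ^ s := by
          refine sum_le_sum fun I hI => ?_
          obtain ⟨i, _, _, _, hi⟩ := mem_prt hI
          have e : 1 + (N-1) = N := by omega
          have := Dec_aff (x := x) (c := c) (a := 1) hD hm (by rw [e]; exact hL) (fun j hj => ((hi j).1 hj).2)
          rwa [e] at this
      _ ≤ _ := by
        rw [← mul_sum, show S A = ∑ J ∈ P, S J from Sd_prt (by omega) A]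
        gcongr
        exact sum_pow_le' _ _ hS0 s hs1
  have pair : ∀ J ∈ P, ∀ I ∈ P.erase J, ∑ α, ‖Ff p L k m x c J α‖^(2*tri l) * ‖Ff p L k m x c I α‖^(2*(s-tri l)) ≤
      (p:ℝ)^((2*s+2)*b) * B * S A ^ s := by
    intro J hJ I hI'
    obtain ⟨hIJ, hI⟩ := Finset.mem_erase.1 hI'
    have hp1 : (1:ℝ) ≤ p := pone.le
    have bd : ∀ α, ‖Ff p L k m x c J α‖^(2*tri l) * ‖Ff p L k m x c I α‖^(2*(s-tri l)) ≤
        (p:ℝ)^(2*s*b) * ∑ J' ∈ prt x (p^a) J, ∑ I' ∈ prt x (p^b) I,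
          ‖Ff p L k m x c J' α‖^(2*tri l) * ‖Ff p L k m x c I' α‖^(2*(s-tri l)) := by
      intro α
      have c1 := crude (prt x (p^a) J) (fun I => Ff p L k m x c I α) (2*tri l) (p^a) (by omega) (card_prt x _ (pow_pos hp.out.pos a) J)
      have c2 := crude (prt x (p^b) I) (fun I => Ff p L k m x c I α) (2*(s-tri l)) (p^b) (by omega) (card_prt x _ (pow_pos hp.out.pos b) I)
      rw [← Ff_prt] at c1 c2
      rw [← sum_mul_sum]
      calc _ ≤ _ := mul_le_mul c1 c2 (by positivity) (by positivity)
        _ = (((p^a:ℕ):ℝ)^(2*tri l) * ((p^b:ℕ):ℝ)^(2*(s-tri l))) * ((∑ J' ∈ prt x (p^a) J, ‖Ff p L k m x c J' α‖^(2*tri l)) *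
            ∑ I' ∈ prt x (p^b) I, ‖Ff p L k m x c I' α‖^(2*(s-tri l))) := by ring
        _ ≤ _ := by
          refine mlr ?_ (by positivity)
          push_cast
          rw [← pow_mul, ← pow_mul, ← pow_add]
          refine pow_le_pow_right₀ hp1 ?_
          rw [← e2s]; nlinarith [Nat.mul_le_mul_right (2*tri l) hab]
    obtain ⟨j0, _, _, hJs, hj0⟩ := mem_prt hJ
    obtain ⟨i0, _, _, hIs, hi0⟩ := mem_prt hI
    have inner : ∀ J' ∈ prt x (p^a) J, ∀ I' ∈ prt x (p^b) I,
        ∑ α, ‖Ff p L k m x c J' α‖^(2*tri l) * ‖Ff p L k m x c I' α‖^(2*(s-tri l)) ≤ B * S A ^ s := by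
      intro J' hJ' I' hI'
      obtain ⟨j1, hj1J, _, _, hj1⟩ := mem_prt hJ'
      obtain ⟨i1, hi1I, _, _, hi1⟩ := mem_prt hI'
      have := hBil J' I' (x j1) (x i1) (fun j hj => ((hj1 j).1 hj).2) (fun j hj => ((hi1 j).1 hj).2) (by
        intro hd
        have h1 : x i1 ≡ x j1 [ZMOD (p^1:ℕ)] := Int.modEq_iff_dvd.2 (by simpa using hd)
        have h2 := ((hj0 j1).1 hj1J).2
        exact hIJ (prt_disj hI hJ (u := i1) hi1I ((hj0 i1).2 ⟨hIs hi1I, h1.trans h2⟩)))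
      refine this.trans ?_
      have q1 : S J' ≤ S A := (Sd_le (hab.trans hbN) hJ').trans (Sd_le (by omega) hJ)
      have q2 : S I' ≤ S A := (Sd_le hbN hI').trans (Sd_le (by omega) hI)
      calc _ ≤ B * S A ^ (tri l) * S A ^ (s - tri l) := by
            have := hS0 J'; have := hS0 I'
            have := hS0 A
            gcongr
        _ = _ := by rw [mul_assoc, ← pow_add]; congr 2; omega
    calc _ ≤ ∑ α, (p:ℝ)^(2*s*b) * ∑ J' ∈ prt x (p^a) J, ∑ I' ∈ prt x (p^b) I,
          ‖Ff p L k m x c J' α‖^(2*tri l) * ‖Ff p L k m x c I' α‖^(2*(s-tri l)) := sum_le_sum fun α _ => bd α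
      _ = (p:ℝ)^(2*s*b) * ∑ J' ∈ prt x (p^a) J, ∑ I' ∈ prt x (p^b) I, ∑ α,
          ‖Ff p L k m x c J' α‖^(2*tri l) * ‖Ff p L k m x c I' α‖^(2*(s-tri l)) := by
        rw [← mul_sum, sum_comm]
        congr 1; refine sum_congr rfl fun _ _ => ?_
        rw [sum_comm]
      _ ≤ (p:ℝ)^(2*s*b) * ∑ J' ∈ prt x (p^a) J, ∑ I' ∈ prt x (p^b) I, B * S A ^ s := by
        gcongr with J' hJ' I' hI'
        exact inner J' hJ' I' hI'
      _ = (p:ℝ)^(2*s*b) * (((prt x (p^a) J).card:ℝ) * ((prt x (p^b) I).card:ℝ) * (B * S A ^ s)) := by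
        simp only [sum_const, nsmul_eq_mul]; ring
      _ ≤ (p:ℝ)^(2*s*b) * ((p:ℝ)^b * (p:ℝ)^b * (B * S A ^ s)) := by
        have := hS0 A
        have c1 : ((prt x (p^a) J).card:ℝ) ≤ (p:ℝ)^b := by
          refine le_trans ?_ (pow_le_pow_right₀ hp1 hab)
          exact_mod_cast card_prt x _ (pow_pos hp.out.pos a) J
        have c2 : ((prt x (p^b) I).card:ℝ) ≤ (p:ℝ)^b := by exact_mod_cast card_prt x _ (pow_pos hp.out.pos b) I
        gcongr
      _ = _ := by rw [show (2*s+2)*b = 2*s*b + b + b by ring, pow_add, pow_add]; ring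
  have bil : ∑ α, ∑ J ∈ P, ∑ I ∈ P.erase J, ‖Ff p L k m x c J α‖^(2*tri l) * ‖Ff p L k m x c I α‖^(2*(s-tri l)) ≤
      (p:ℝ)^2 * ((p:ℝ)^((2*s+2)*b) * B * S A ^ s) := by
    rw [sum_comm]
    have := hS0 A
    calc _ ≤ ∑ J ∈ P, ∑ I ∈ P.erase J, (p:ℝ)^((2*s+2)*b) * B * S A ^ s := by
          refine sum_le_sum fun J hJ => ?_
          rw [sum_comm]
          exact sum_le_sum fun I hI => pair J hJ I hI
      _ ≤ ∑ J ∈ P, (p:ℝ) * ((p:ℝ)^((2*s+2)*b) * B * S A ^ s) := by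
          refine sum_le_sum fun J hJ => ?_
          rw [sum_const, nsmul_eq_mul]
          have : ((P.erase J).card:ℝ) ≤ p := by exact_mod_cast Finset.card_erase_le.trans hpc
          gcongr
      _ ≤ _ := by
          have : (P.card:ℝ) ≤ p := by exact_mod_cast hpc
          rw [sum_const, nsmul_eq_mul, pow_two, mul_assoc (p:ℝ) (p:ℝ)]
          exact mlr this (by positivity)
  have hMo : Mo p L k m x c s A = ∑ i, ‖∑ I ∈ P, Ff p L k m x c I i‖ ^ (2 * s) := by
    unfold Mo
    exact sum_congr rfl fun α _ => by rw [Ff_prt (p^1) A]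
  change Mo p L k m x c s A ≤ ((1+κ)^(2*s) * D + ((p:ℝ)^2/κ)^(2*s) * (p:ℝ)^2 * (p:ℝ)^((2*s+2)*b) * B) * S A ^ s
  rw [hMo]
  calc _ ≤ _ := hsum
    _ ≤ (1+κ)^(2*s) * (D * S A ^ s) + ((p:ℝ)^2/κ)^(2*s) * ((p:ℝ)^2 * ((p:ℝ)^((2*s+2)*b) * B * S A ^ s)) := by gcongr
    _ = _ := by ring

theorem Adm_triv (hk : 1 ≤ k) : Adm p k ((2*tri k : ℕ):ℝ) := by
  refine ⟨1, le_refl _, fun N L m hm hL x c A => ?_⟩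
  have hs := tri_pos hk
  have e : (1:ℝ) * (p:ℝ)^(((2*tri k:ℕ):ℝ)*N) = ((p^N:ℕ):ℝ)^(2*tri k) := by
    rw [one_mul]; push_cast; rw [← pow_mul, ← rpow_natCast]; congr 1; push_cast; ring
  rw [e]
  calc Mo p L k m x c (tri k) A ≤ ∑ α, ((p^N:ℕ):ℝ)^(2*tri k) * ∑ I ∈ prt x (p^N) A, ‖Ff p L k m x c I α‖^(2*tri k) := by
        refine sum_le_sum fun α _ => ?_
        rw [Ff_prt (p^N) A]
        exact crude _ _ _ _ (by omega) (card_prt x _ (pow_pos hp.out.pos N) A)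
    _ = ((p^N:ℕ):ℝ)^(2*tri k) * ∑ I ∈ prt x (p^N) A, ((Mo p L k m x c (tri k) I)^(1/((tri k:ℕ):ℝ)))^(tri k) := by
        rw [← mul_sum, sum_comm]
        congr 1; refine sum_congr rfl fun I _ => ?_
        rw [one_div, rpow_inv_natCast_pow Mo_nonneg (by omega)]; rfl
    _ ≤ _ := by
        gcongr
        exact sum_pow_le' _ _ (fun _ => rpow_nonneg Mo_nonneg _) _ hs

theorem Adm_mono {η η' : ℝ} (h : η ≤ η') : Adm p k η → Adm p k η' := fun ⟨C, hC, hD⟩ =>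
  ⟨C, hC, fun N => Dec_mono (by gcongr; exact pone.le) (hD N)⟩

theorem improve (hpk : k < p) (hk : 2 ≤ k) {η : ℝ} (hη0 : 0 < η) (hη : ∀ ε > 0, Adm p k (η+ε))
    (hlow : ∀ l, 1 ≤ l → l < k → ∀ ε > 0, Adm p l ε) : ∃ η' < η, 0 ≤ η' ∧ Adm p k η' := by
  set s := tri k with hs
  have hs1 : 1 ≤ s := tri_pos (by omega)
  set W : ℝ := 2*s+3 with hW
  have hkR : (2:ℝ) ≤ k := by exact_mod_cast hk
  obtain ⟨n, hn⟩ := exists_nat_gt (((k:ℝ)-1)*W / (((k:ℝ)-1)/k * η))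
  have hc0 : 0 < (((k:ℝ)-1)/k * η) := mul_pos (div_pos (by linarith) (by linarith)) hη0
  rw [div_lt_iff₀ hc0] at hn
  have hcard : ((Ico 1 k).card : ℝ) = (k:ℝ)-1 := by
    simp [Nat.cast_sub (show 1 ≤ k by omega)]
  obtain ⟨l, hlm, hlW⟩ : ∃ l ∈ Ico 1 k, W ≤ Aw k η n l := by
    refine Finset.exists_le_of_sum_le ⟨1, by simp; omega⟩ ?_
    rw [Aw_sum hk, sum_const, nsmul_eq_mul, hcard]; exact hn.le
  obtain ⟨hl, hlk⟩ := mem_Ico.1 hlm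
  set Λ := k*k*k.factorial with hΛ
  have hΛ0 : 0 < Λ := by have := Nat.factorial_pos k; positivity
  have hk0 : 0 < k := by omega
  set Q := Λ^(n+1) * k^(n+1) with hQ
  have hQ0 : 0 < Q := by positivity
  set κ' : ℝ := 1/(2*(k:ℝ)^(n+1)) with hκ'
  have hκ'0 : 0 < κ' := by positivity
  obtain ⟨C, hC, hSt⟩ := St hpk hk hη hlow n (κ'/2) (by positivity)
  set η' := max (η - κ'/2) (η/2) with hη'
  have hη'0 : 0 < η' := lt_max_of_lt_right (by linarith)
  refine ⟨η', max_lt (by linarith) (by linarith), hη'0.le, ?_⟩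
  set κ : ℝ := min 1 ((p:ℝ)^(η'/(4*s)) - 1) with hκ
  have sR : (0:ℝ) < s := by exact_mod_cast hs1
  have hκ0 : 0 < κ := lt_min one_pos (by
    have := Real.one_lt_rpow (pone (p := p)) (show 0 < η'/(4*s) by positivity); linarith)
  have hκp : (1+κ)^(2*s) ≤ (p:ℝ)^(η'/2) := by
    calc (1+κ)^(2*s) ≤ ((p:ℝ)^(η'/(4*s)))^(2*s) := by
          gcongr; have := min_le_right 1 ((p:ℝ)^(η'/(4*s)) - 1); linarith
      _ = _ := by
          rw [← rpow_natCast, ← rpow_mul ppos.le]; congr 1; push_cast; field_simp; ring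
  set C' := ((p:ℝ)^2/κ)^(2*s) * (p:ℝ)^2 * C with hC'
  have hpp := ppos (p := p)
  have hC'0 : 0 ≤ C' := by positivity
  obtain ⟨C1, hC1, hD1⟩ := hη 1 one_pos
  set C0 := C1 * (p:ℝ)^((η+1)*Q) with hC0
  set ρ := (p:ℝ)^(-(η'/2)) with hρ
  have hρ1 : ρ < 1 := Real.rpow_lt_one_of_one_lt_of_neg pone (by linarith)
  set Cf := max C0 (C'/(1-ρ)) with hCf
  have hCf0 : 1 ≤ Cf := le_max_of_le_left (one_lm hC1 (one_le_rpow pone.le (by positivity)))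
  have hCf1 : C' ≤ Cf * (1-ρ) := by
    have := le_max_right C0 (C'/(1-ρ)); rwa [div_le_iff₀ (by linarith)] at this
  refine ⟨Cf, hCf0, fun N => ?_⟩
  induction N with
  | zero =>
    refine Dec_mono ?_ (hD1 0)
    simp only [Nat.cast_zero, mul_zero, Real.rpow_zero, mul_one]
    refine le_trans ?_ (le_max_left C0 _)
    exact le_mul_of_one_le_right (by linarith) (one_le_rpow pone.le (by positivity))
  | succ N ih =>
    by_cases hNQ : N + 1 < Q
    · refine Dec_mono ?_ (hD1 (N+1))
      calc _ ≤ C0 := by rw [hC0]; gcongr; exact pone.le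
        _ ≤ Cf := le_max_left _ _
        _ ≤ _ := le_mul_of_one_le_right (by linarith) (one_le_rpow pone.le (by positivity))
    push Not at hNQ
    intro L m hm hL x c A
    set w := (N+1)/Q with hw
    have hw1 : 1 ≤ w := (Nat.one_le_div_iff hQ0).2 hNQ
    set b := Λ^(n+1) * w with hb
    have hb0 : 0 < b := by positivity
    have hkb : k^(n+1)*b ≤ N+1 := by
      calc _ = Q * w := by rw [hb, hQ]; ring
        _ ≤ _ := Nat.mul_div_le _ _
    obtain ⟨a, ha⟩ : k ∣ b := by
      exact Dvd.dvd.mul_right (dvd_pow ⟨k*k.factorial, by rw [hΛ, mul_assoc]⟩ (Nat.succ_ne_zero n)) w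
    have ha1 : 1 ≤ a := by rcases Nat.eq_zero_or_pos a with h | h <;> [(rw [h] at ha; omega); exact h]
    have hab : a ≤ b := by rw [ha]; exact Nat.le_mul_of_pos_left _ hk0
    have hbN : b ≤ N+1 := (Nat.le_mul_of_pos_left _ (by positivity)).trans hkb
    have hbl := hSt (N+1) L m x c hm hL l a b hl hlk hb0 ⟨w, hb⟩ hkb (by
      rw [ha]; calc l*a ≤ k*a := by gcongr
        _ ≤ _ := Nat.le_mul_of_pos_left _ (by omega)) (by rw [ha])
    have := bilRed (κ := κ) (by positivity) (by positivity) hκ0 (min_le_left _ _) hl hlk ha1 hab hbN hm hL hbl ih A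
    refine this.trans (mlr ?_ (pow_nonneg Sd_nonneg _))
    have hbig : κ' * ((N+1:ℕ):ℝ) ≤ b := by
      have h1 : N + 1 ≤ 2 * (Q*w) := by
        have h1 : Q * w + (N+1) % Q = N+1 := Nat.div_add_mod (N+1) Q
        have := Nat.mod_lt (N+1) hQ0
        have : Q ≤ Q * w := Nat.le_mul_of_pos_right _ hw1
        linarith
      have h2 : ((N+1:ℕ):ℝ) ≤ 2 * ((k:ℝ)^(n+1) * b) := by
        calc ((N+1:ℕ):ℝ) ≤ ((2*(Q*w):ℕ):ℝ) := by exact_mod_cast h1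
          _ = _ := by rw [hQ, hb]; push_cast; ring
      rw [hκ', div_mul_eq_mul_div, div_le_iff₀ (by positivity)]; linarith
    have e1 : (p:ℝ)^((2*s+2)*b) * (p:ℝ)^((η+κ'/2)*((N+1:ℕ):ℝ) - Aw k η n l * b) ≤ (p:ℝ)^(η'*((N+1:ℕ):ℝ)) := by
      rw [← rpow_natCast, ← rpow_add ppos]
      refine rpow_le_rpow_of_exponent_le pone.le ?_
      have h1 : W * b ≤ Aw k η n l * b := by gcongr
      have h2 : (η - κ'/2) * ((N+1:ℕ):ℝ) ≤ η' * ((N+1:ℕ):ℝ) := by gcongr; exact le_max_left _ _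
      rw [hW] at h1
      push_cast at *
      linarith
    have e2 : (p:ℝ)^(η'/2) * (p:ℝ)^(η'*(N:ℝ)) = ρ * (p:ℝ)^(η'*((N+1:ℕ):ℝ)) := by
      rw [hρ, ← rpow_add ppos, ← rpow_add ppos]; congr 1; push_cast; ring
    calc _ ≤ (p:ℝ)^(η'/2) * (Cf * (p:ℝ)^(η'*(N:ℝ))) + ((p:ℝ)^2/κ)^(2*s) * (p:ℝ)^2 * C *
          ((p:ℝ)^((2*s+2)*b) * (p:ℝ)^((η+κ'/2)*((N+1:ℕ):ℝ) - Aw k η n l * b)) := by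
          rw [show ∀ a b c d e : ℝ, a*b*c*(d*e) = a*b*d*(c*e) by intros; ring]
          gcongr
      _ ≤ Cf * (ρ * (p:ℝ)^(η'*((N+1:ℕ):ℝ))) + C' * (p:ℝ)^(η'*((N+1:ℕ):ℝ)) := by
          rw [← e2, ← hC']
          have := mll e1 hC'0
          linarith
      _ = (Cf*ρ + C') * (p:ℝ)^(η'*((N+1:ℕ):ℝ)) := by ring
      _ ≤ _ := by gcongr; linarith

theorem decoupling : ∀ k, 1 ≤ k → k < p → ∀ ε > 0, Adm p k ε := by
  intro k
  induction k using Nat.strong_induction_on with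
  | _ k ih =>
    intro hk hpk
    rcases Nat.eq_or_lt_of_le hk with h | h
    · subst h
      exact fun ε hε => ⟨1, le_refl _, fun N => Dec_mono (by
        rw [one_mul]; exact one_le_rpow pone.le (by positivity)) (Dec_one N)⟩
    set E : Set ℝ := {η | 0 ≤ η ∧ Adm p k η} with hE
    have hne : E.Nonempty := ⟨_, Nat.cast_nonneg _, Adm_triv hk⟩
    have hbd : BddBelow E := ⟨0, fun η h => h.1⟩
    have hI : ∀ ε > 0, Adm p k (sInf E + ε) := by
      intro ε hε
      obtain ⟨η, hη, hlt⟩ := exists_lt_of_csInf_lt hne (show sInf E < sInf E + ε by linarith)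
      exact Adm_mono hlt.le hη.2
    have hI0 : 0 ≤ sInf E := le_csInf hne fun η h => h.1
    rcases eq_or_lt_of_le hI0 with h0 | h0
    · intro ε hε; have := hI ε hε; rwa [← h0, zero_add] at this
    · obtain ⟨η', h1, h2, h3⟩ := improve hpk h h0 hI (fun l hl hlk => ih l hlk hl (hlk.trans hpk))
      exact absurd (csInf_le hbd ⟨h2, h3⟩) (not_le.2 h1)
end

noncomputable section

def ex (t : ℝ) : ℂ := Complex.exp (2 * (pi:ℂ) * Complex.I * (t:ℂ))

theorem ex_add (a b : ℝ) : ex (a+b) = ex a * ex b := by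
  unfold ex; rw [← Complex.exp_add]; push_cast; ring_nf

theorem ex_int (n : ℤ) : ex n = 1 := by
  unfold ex
  have := Complex.exp_int_mul_two_pi_mul_I n
  rw [← this]; push_cast; ring_nf

theorem ex_zero : ex 0 = 1 := by simpa using ex_int 0

theorem ex_add_int (a : ℝ) (n : ℤ) : ex (a+n) = ex a := by rw [ex_add, ex_int, mul_one]

theorem norm_ex (t : ℝ) : ‖ex t‖ = 1 := by
  unfold ex
  have := Complex.norm_exp_ofReal_mul_I (2*pi*t)
  rw [← this]; push_cast; ring_nf

theorem ex_sub_le (a b : ℝ) : ‖ex a - ex b‖ ≤ 2*pi*|a-b| := by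
  have h : ex a - ex b = ex b * (Complex.exp (Complex.I * ((2*pi*(a-b):ℝ):ℂ)) - 1) := by
    have : Complex.exp (Complex.I * ((2*pi*(a-b):ℝ):ℂ)) = ex (a-b) := by unfold ex; push_cast; ring_nf
    rw [this, mul_sub, ← ex_add, mul_one, add_sub_cancel]
  rw [h, norm_mul, norm_ex, one_mul]
  refine (Real.norm_exp_I_mul_ofReal_sub_one_le).trans (le_of_eq ?_)
  rw [Real.norm_eq_abs, abs_mul, abs_of_pos (by positivity)]

theorem ex_sub_one_ge (t : ℝ) : 4 * |t - round t| ≤ ‖ex t - 1‖ := by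
  have h0 : ex t = ex (t - round t) := by
    have := ex_add_int (t - round t) (round t); rw [sub_add_cancel] at this; exact this
  rw [h0]
  set u := t - round t
  have hu : |u| ≤ 1/2 := abs_sub_round t
  have h : ex u = Complex.exp (Complex.I * ((2*pi*u:ℝ):ℂ)) := by unfold ex; push_cast; ring_nf
  rw [h, Complex.norm_exp_I_mul_ofReal_sub_one, Real.norm_eq_abs, abs_mul, abs_two,
    show 2*pi*u/2 = pi*u by ring]
  have hpi := pi_pos
  have key : ∀ v : ℝ, 0 ≤ v → v ≤ 1/2 → 2*v ≤ Real.sin (pi*v) := by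
    intro v h0 h1
    have := Real.mul_le_sin (x := pi*v) (by positivity) (by nlinarith)
    calc 2*v = 2/pi*(pi*v) := by field_simp
      _ ≤ _ := this
  rcases abs_cases u with ⟨e, h1⟩ | ⟨e, h1⟩
  · have := key u h1 (by linarith)
    rw [e]; have := le_abs_self (Real.sin (pi*u)); linarith
  · have := key (-u) (by linarith) (by linarith)
    rw [e]; rw [mul_neg pi, Real.sin_neg] at this
    have := neg_abs_le (Real.sin (pi*u)); linarith

theorem abel_id (a b : ℕ → ℂ) (n : ℕ) : ∑ i ∈ range n, a i * b i =
    (∑ i ∈ range n, a i) * b n -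
      ∑ i ∈ range n, (∑ l ∈ range (i+1), a l) * (b (i+1) - b i) := by
  induction n with
  | zero => simp
  | succ n ih => simp only [sum_range_succ _ n] at *; rw [ih]; ring

theorem abel_bd (a b : ℕ → ℂ) (n : ℕ) {B V : ℝ} (hB : 0 ≤ B) (hA : ∀ m ≤ n, ‖∑ i ∈ range m, a i‖ ≤ B)
    (hb : ‖b n‖ ≤ 1) (hV : ∑ i ∈ range n, ‖b (i+1) - b i‖ ≤ V) :
    ‖∑ i ∈ range n, a i * b i‖ ≤ B * (1+V) := by
  rw [abel_id]
  calc _ ≤ ‖(∑ i ∈ range n, a i) * b n‖ + ‖∑ i ∈ range n, (∑ l ∈ range (i+1), a l) * (b (i+1) - b i)‖ := norm_sub_le _ _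
    _ ≤ B * 1 + ∑ i ∈ range n, B * ‖b (i+1) - b i‖ := by
      refine add_le_add ?_ ?_
      · rw [norm_mul]; exact mul_le_mul (hA n le_rfl) hb (norm_nonneg _) hB
      · refine (norm_sum_le _ _).trans (sum_le_sum fun i hi => ?_)
        rw [norm_mul]
        exact mlr (hA _ (mem_range.1 hi)) (norm_nonneg _)
    _ ≤ _ := by rw [← mul_sum, mul_add]; gcongr

theorem ex_nat_mul (t : ℝ) (m : ℕ) : ex (m*t) = ex t ^ m := by
  induction m with
  | zero => simp [ex_zero]
  | succ m ih => rw [pow_succ, ← ih, ← ex_add]; congr 1; push_cast; ring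

theorem geo_bd (t : ℝ) (m : ℕ) : ‖∑ i ∈ range m, ex (i*t)‖ * |t - round t| ≤ 1/2 := by
  have h1 : (∑ i ∈ range m, ex (i*t)) * (ex t - 1) = ex (m*t) - 1 := by
    simp only [ex_nat_mul]; exact geom_sum_mul _ _
  have h2 : ‖∑ i ∈ range m, ex (i*t)‖ * ‖ex t - 1‖ ≤ 2 := by
    rw [← norm_mul, h1]
    refine (norm_sub_le _ _).trans ?_
    rw [norm_ex]; norm_num
  have h3 := mll (ex_sub_one_ge t) (norm_nonneg (∑ i ∈ range m, ex (i*t)))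
  linarith
end

noncomputable section

theorem orthH (H : ℕ) (hH : 0 < H) (x z : ℕ) (hx : x < H) (hz : z < H) :
    ∑ h ∈ range H, ex (h * (((x:ℝ) - z)/H)) = if x = z then (H:ℂ) else 0 := by
  have hHR : (0:ℝ) < H := by exact_mod_cast hH
  split_ifs with h
  · subst h; simp [ex_zero]
  · have h1 : (∑ i ∈ range H, ex (i*(((x:ℝ) - z)/H))) * (ex (((x:ℝ) - z)/H) - 1) = 0 := by
      simp only [ex_nat_mul]; rw [geom_sum_mul, ← ex_nat_mul, mul_div_cancel₀ _ hHR.ne']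
      have := ex_int ((x:ℤ)-z); push_cast at this; rw [this, sub_self]
    rcases mul_eq_zero.1 h1 with h1 | h1
    · exact h1
    exfalso
    have h2 := ex_sub_one_ge (((x:ℝ) - z)/H)
    rw [h1, norm_zero] at h2
    have h3 : |((x:ℝ) - z)/H - round (((x:ℝ) - z)/H)| = 0 := le_antisymm (by linarith) (abs_nonneg _)
    rw [abs_eq_zero, sub_eq_zero, div_eq_iff hHR.ne'] at h3
    have h4 : (x:ℤ) - z = round (((x:ℝ) - z)/H) * H := by exact_mod_cast h3
    have h5 : |(x:ℤ)-z| < H := by rw [abs_lt]; constructor <;> omega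
    have := Int.eq_zero_of_abs_lt_dvd (m := (H:ℤ)) ⟨_, h4.trans (mul_comm _ _)⟩ h5
    omega

def kap (H h : ℕ) : ℝ := if h = 0 then 1 else 1/(2*(h:ℝ)) + 1/(2*((H:ℝ)-h))

theorem kap_nonneg {H h : ℕ} (hh : h < H) : 0 ≤ kap H h := by
  have : (h:ℝ) < H := by exact_mod_cast hh
  unfold kap; split_ifs
  · norm_num
  · have : 0 < (H:ℝ) - h := by linarith
    positivity

theorem kap_bd {H h : ℕ} (hh : h < H) (A m : ℕ) (hm : m ≤ H) :
    ‖∑ i ∈ range m, ex (-(h * (((A + i : ℕ):ℝ))/H))‖ ≤ H * kap H h := by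
  have hR : (h:ℝ) < H := by exact_mod_cast hh
  have hH : (0:ℝ) < H := lt_of_le_of_lt (Nat.cast_nonneg _) hR
  unfold kap; split_ifs with h0
  · subst h0; simp [ex_zero]; exact hm
  have h1 : (1:ℝ) ≤ h := by exact_mod_cast Nat.pos_of_ne_zero h0
  set t : ℝ := -(h/H) with ht
  have e : ∑ i ∈ range m, ex (-(h * (((A + i : ℕ):ℝ))/H)) = ex (A*t) * ∑ i ∈ range m, ex (i*t) := by
    rw [mul_sum]; refine sum_congr rfl fun i _ => ?_
    rw [← ex_add]; congr 1; rw [ht]; push_cast; ring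
  rw [e, norm_mul, norm_ex, one_mul]
  have hg := geo_bd t m
  have hd : 1/(h:ℝ) ≤ (1/(h:ℝ)+1/((H:ℝ)-h)) ∧ 1/((H:ℝ)-h) ≤ (1/(h:ℝ)+1/((H:ℝ)-h)) := by
    have : 0 < (H:ℝ) - h := by linarith
    constructor
    · have : 0 < 1/((H:ℝ)-h) := by positivity
      linarith
    · have : 0 < 1/(h:ℝ) := by positivity
      linarith
  have hmin : 1 ≤ |t - round t| * (H * (1/(h:ℝ)+1/((H:ℝ)-h))) := by
    have hp : 0 < (H:ℝ) - h := by linarith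
    have hlow : (h:ℝ)/H ≤ |t - round t| ∨ ((H:ℝ)-h)/H ≤ |t - round t| := by
      rcases le_or_gt 0 (round t) with hr | hr
      · left
        have : (0:ℝ) ≤ round t := by exact_mod_cast hr
        rw [abs_of_nonpos (by rw [ht]; have : 0 ≤ (h:ℝ)/H := by positivity
                              linarith)]
        rw [ht] at *; linarith
      · right
        have : ((round t : ℤ):ℝ) ≤ -1 := by exact_mod_cast (by omega : round t ≤ -1)
        rw [sub_div, div_self hH.ne']
        refine le_trans ?_ (le_abs_self _)
        rw [ht] at *; linarith
    rcases hlow with hl | hl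
    · calc (1:ℝ) = h/H * (H * (1/h)) := by field_simp
        _ ≤ _ := by gcongr; exact hd.1
    · calc (1:ℝ) = ((H:ℝ)-h)/H * (H * (1/((H:ℝ)-h))) := by field_simp
        _ ≤ _ := by gcongr; exact hd.2
  set Z := H * (1/(h:ℝ)+1/((H:ℝ)-h))
  have hZ0 : 0 ≤ Z := by
    have : 0 < (H:ℝ) - h := by linarith
    positivity
  set G := ‖∑ i ∈ range m, ex (i*t)‖
  have hG0 : 0 ≤ G := norm_nonneg _
  have : H * (1/(2*(h:ℝ)) + 1/(2*((H:ℝ)-h))) = Z/2 := by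
    have : (H:ℝ) - h ≠ 0 := by linarith
    simp only [Z]; field_simp
  rw [this]
  calc G = G*1 := (mul_one _).symm
    _ ≤ G * (|t - round t| * Z) := by gcongr
    _ = (G * |t - round t|) * Z := by ring
    _ ≤ 1/2 * Z := by gcongr
    _ = _ := by ring

theorem complete (H : ℕ) (a : ℕ → ℂ) (A m : ℕ) (hA : A + m ≤ H) :
    ‖∑ i ∈ range m, a (A+i)‖ ≤ ∑ h ∈ range H, kap H h * ‖∑ x ∈ range H, a x * ex (h*(x:ℝ)/H)‖ := by
  rcases Nat.eq_zero_or_pos H with rfl | hH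
  · have : m = 0 := by omega
    subst this; simp
  have hHR : (0:ℝ) < H := by exact_mod_cast hH
  have hHC : (H:ℂ) ≠ 0 := by exact_mod_cast hH.ne'
  have key : (H:ℂ) * ∑ i ∈ range m, a (A+i) = ∑ h ∈ range H,
      (∑ i ∈ range m, ex (-(h * (((A + i : ℕ):ℝ))/H))) * ∑ x ∈ range H, a x * ex (h*(x:ℝ)/H) := by
    simp only [sum_mul_sum]
    rw [sum_comm, mul_sum]
    refine sum_congr rfl fun i hi => ?_
    have hi := mem_range.1 hi
    rw [sum_comm]
    have : ∀ x ∈ range H, ∑ h ∈ range H, ex (-(h * (((A + i : ℕ):ℝ))/H)) * (a x * ex (h*(x:ℝ)/H)) =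
        if x = A+i then (H:ℂ) * a x else 0 := by
      intro x hx
      have := orthH H hH x (A+i) (mem_range.1 hx) (by omega)
      calc _ = a x * ∑ h ∈ range H, ex (h * (((x:ℝ) - (A+i:ℕ))/H)) := by
            rw [mul_sum]; refine sum_congr rfl fun h _ => ?_
            rw [mul_left_comm, ← ex_add]; congr 2; ring
        _ = _ := by rw [this]; split_ifs <;> ring
    rw [sum_congr rfl this, Finset.sum_ite_eq' , if_pos (mem_range.2 (by omega))]
  have h2 : (H:ℝ) * ‖∑ i ∈ range m, a (A+i)‖ ≤ H * ∑ h ∈ range H, kap H h * ‖∑ x ∈ range H, a x * ex (h*(x:ℝ)/H)‖ := by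
    have : (H:ℝ) * ‖∑ i ∈ range m, a (A+i)‖ = ‖(H:ℂ) * ∑ i ∈ range m, a (A+i)‖ := by
      rw [norm_mul, Complex.norm_natCast]
    rw [this, key, mul_sum]
    refine (norm_sum_le _ _).trans (sum_le_sum fun h hh => ?_)
    rw [norm_mul, ← mul_assoc]
    exact mlr (kap_bd (mem_range.1 hh) A m (by omega)) (norm_nonneg _)
  exact le_of_mul_le_mul_left h2 hHR

theorem kap_sum (H : ℕ) : ∑ h ∈ range H, kap H h ≤ 2 + Real.log H := by
  rcases Nat.eq_zero_or_pos H with rfl | hH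
  · simp
  obtain ⟨N, rfl⟩ := Nat.exists_eq_add_of_le' hH
  rw [sum_range_succ']
  have h1 : ∑ h ∈ range N, kap (N+1) (h+1) = ((harmonic N : ℚ):ℝ) := by
    have e : ∀ h ∈ range N, kap (N+1) (h+1) = (1/2) * (1/((h:ℝ)+1)) + (1/2) * (1/((N:ℝ)-h)) := by
      intro h hh
      have hh : (h:ℝ) + 1 ≤ N := by exact_mod_cast (mem_range.1 hh)
      have : (N:ℝ) - h ≠ 0 := by intro h; linarith
      unfold kap; rw [if_neg (by omega)]; push_cast
      rw [show (N:ℝ)+1-(h+1) = N - h by ring]; field_simp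
    rw [sum_congr rfl e, sum_add_distrib, ← mul_sum, ← mul_sum]
    have r : ∑ h ∈ range N, (1/((N:ℝ)-h)) = ∑ h ∈ range N, (1/((h:ℝ)+1)) := by
      rw [← Finset.sum_range_reflect]
      refine sum_congr rfl fun h hh => ?_
      have hh := mem_range.1 hh
      rw [Nat.sub_sub, Nat.cast_sub (by omega)]; push_cast; congr 1; ring
    rw [r, harmonic]; push_cast
    simp only [one_div]; ring
  rw [h1]
  have h2 := harmonic_le_one_add_log N
  have h3 : kap (N+1) 0 = 1 := by simp [kap]
  rw [h3]
  rcases Nat.eq_zero_or_pos N with rfl | hN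
  · simp
  have : Real.log N ≤ Real.log (N+1:ℕ) := Real.log_le_log (by exact_mod_cast hN) (by push_cast; linarith)
  linarith

theorem wjensen {ι : Type*} (S : Finset ι) (w z : ι → ℝ) (hw : ∀ i ∈ S, 0 ≤ w i) (hz : ∀ i ∈ S, 0 ≤ z i) (q : ℕ) :
    (∑ i ∈ S, w i * z i)^(q+1) ≤ (∑ i ∈ S, w i)^q * ∑ i ∈ S, w i * z i^(q+1) := by
  rcases (sum_nonneg hw).eq_or_lt with h | h
  · have : ∀ i ∈ S, w i = 0 := (Finset.sum_eq_zero_iff_of_nonneg hw).1 h.symm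
    have e : ∀ f : ι → ℝ, ∑ i ∈ S, w i * f i = 0 := fun f => sum_eq_zero fun i hi => by rw [this i hi, zero_mul]
    rw [e, e (fun i => z i^(q+1))]; simp
  set W := ∑ i ∈ S, w i with hW
  have := Real.pow_arith_mean_le_arith_mean_pow S (fun i => w i / W) z (fun i hi => div_nonneg (hw i hi) h.le)
    (by rw [← sum_div, div_self h.ne']) hz (q+1)
  simp only [div_mul_eq_mul_div, ← sum_div] at this
  rw [div_pow, div_le_div_iff₀ (by positivity) h, pow_succ W] at this
  have h2 : (∑ i ∈ S, w i * z i)^(q+1) * W ≤ (W^q * ∑ i ∈ S, w i * z i^(q+1)) * W := by linarith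
  exact le_of_mul_le_mul_right h2 h
end

noncomputable section
variable {p : ℕ} [hp : Fact p.Prime]

def gg (p L K : ℕ) [Fact p.Prime] (c : ℕ → ℂ) (N : ℕ) (u : Fin K → ZMod (p^L)) : ℂ :=
  Ff p L K (fun _ => 0) (fun i => (i:ℤ)) c (range (p^N)) u

theorem mean {K : ℕ} (hK : 1 ≤ K) {ε : ℝ} (h : Adm p K ε) : ∃ C : ℝ, 1 ≤ C ∧ ∀ (N : ℕ) (c : ℕ → ℂ), (∀ x, ‖c x‖ ≤ 1) →
    ∑ u : Fin K → ZMod (p^(K*N)), ‖gg p (K*N) K c N u‖^(2*tri K) ≤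
      C * (p:ℝ)^(ε*N) * (((p^N:ℕ):ℝ)^(tri K) * ((p^(K*N):ℕ):ℝ)^K) := by
  obtain ⟨C, hC, hD⟩ := h
  refine ⟨C, hC, fun N c hc => ?_⟩
  have hs : 1 ≤ tri K := tri_pos hK
  have h1 := hD N (K*N) (fun _ => 0) monotone_const (fun j hj => by
    rw [zero_add]; exact Nat.mul_le_mul_right _ hj) (fun i => (i:ℤ)) c (range (p^N))
  refine h1.trans ?_
  have hpp := ppos (p := p)
  refine mll ?_ (by positivity)
  have hMo : ∀ I ∈ prt (fun i => (i:ℤ)) (p^N) (range (p^N)),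
      Mo p (K*N) K (fun _ => 0) (fun i => (i:ℤ)) c (tri K) I ≤ ((p^(K*N):ℕ):ℝ)^K := by
    intro I hI
    obtain ⟨i, hi, hiI, _, hI'⟩ := mem_prt hI
    have hI2 : I = {i} := by
      ext j; rw [hI', Finset.mem_singleton]
      constructor
      · rintro ⟨hj, hm⟩
        have := (Int.natCast_modEq_iff.1 hm)
        exact Nat.ModEq.eq_of_lt_of_lt this (mem_range.1 hj) (mem_range.1 hi)
      · rintro rfl; exact ⟨hi, rfl⟩
    rw [hI2]
    unfold Mo Ff
    calc _ ≤ ∑ α : Fin K → ZMod (p^(K*N)), (1:ℝ) := by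
          refine sum_le_sum fun α _ => ?_
          rw [Finset.sum_singleton, norm_mul, AddChar.norm_apply, mul_one]
          exact pow_le_one₀ (norm_nonneg _) (hc i)
      _ = _ := by simp [ZMod.card]
  have hSd : Sd p (K*N) K (fun _ => 0) (fun i => (i:ℤ)) c (tri K) N (range (p^N)) ≤
      ((p^N:ℕ):ℝ) * (((p^(K*N):ℕ):ℝ)^K)^(1/(tri K:ℝ)) := by
    unfold Sd
    calc _ ≤ ∑ I ∈ prt (fun i => (i:ℤ)) (p^N) (range (p^N)), (((p^(K*N):ℕ):ℝ)^K)^(1/(tri K:ℝ)) :=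
          sum_le_sum fun I hI => rpow_le_rpow Mo_nonneg (hMo I hI) (by positivity)
      _ ≤ _ := by
        rw [sum_const, nsmul_eq_mul]
        refine mlr ?_ (by positivity)
        exact_mod_cast card_prt _ _ (pow_pos hp.out.pos N) _
  calc _ ≤ (((p^N:ℕ):ℝ) * (((p^(K*N):ℕ):ℝ)^K)^(1/(tri K:ℝ)))^(tri K) := pow_le_pow_left₀ Sd_nonneg hSd _
    _ = _ := by
      rw [mul_pow, one_div, rpow_inv_natCast_pow (by positivity) (by omega)]

def sh (p L K N h : ℕ) : Fin K → ZMod (p^L) := fun j => if (j:ℕ) = 0 then (h:ZMod (p^L)) * (p:ZMod (p^L))^(L-N) else 0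

def Gs (p L K : ℕ) [Fact p.Prime] (c : ℕ → ℂ) (N : ℕ) (u : Fin K → ZMod (p^L)) : ℝ :=
  ∑ h ∈ range (p^N), kap (p^N) h * ‖gg p L K c N (u + sh p L K N h)‖

theorem Gs_sum {L K N s : ℕ} (hs : 1 ≤ s) (c : ℕ → ℂ) : ∑ u : Fin K → ZMod (p^L), Gs p L K c N u ^ (2*s) ≤
    (2 + Real.log ((p^N:ℕ):ℝ))^(2*s) * ∑ u : Fin K → ZMod (p^L), ‖gg p L K c N u‖^(2*s) := by
  obtain ⟨q, hq⟩ : ∃ q, 2*s = q+1 := ⟨2*s-1, by omega⟩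
  rw [hq]
  have hk0 : ∀ h ∈ range (p^N), 0 ≤ kap (p^N) h := fun h hh => kap_nonneg (mem_range.1 hh)
  have hW := kap_sum (p^N)
  have hW0 := sum_nonneg hk0
  calc _ ≤ ∑ u : Fin K → ZMod (p^L), (∑ h ∈ range (p^N), kap (p^N) h)^q *
        ∑ h ∈ range (p^N), kap (p^N) h * ‖gg p L K c N (u + sh p L K N h)‖^(q+1) :=
        sum_le_sum fun u _ => wjensen _ _ _ hk0 (fun _ _ => norm_nonneg _) q
    _ = (∑ h ∈ range (p^N), kap (p^N) h)^q * ∑ h ∈ range (p^N), kap (p^N) h *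
        ∑ u : Fin K → ZMod (p^L), ‖gg p L K c N u‖^(q+1) := by
      rw [← mul_sum, sum_comm]
      congr 1; refine sum_congr rfl fun h _ => ?_
      rw [← mul_sum]; congr 1
      exact Equiv.sum_comp (Equiv.addRight (sh p L K N h)) (fun u => ‖gg p L K c N u‖^(q+1))
    _ = (∑ h ∈ range (p^N), kap (p^N) h)^(q+1) * ∑ u : Fin K → ZMod (p^L), ‖gg p L K c N u‖^(q+1) := by
      rw [← sum_mul, pow_succ]; ring
    _ ≤ _ := by gcongr

theorem std_ex (R : ℕ) [NeZero R] (j : ℤ) : stdAddChar (j : ZMod R) = ex ((j:ℝ)/R) := by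
  rw [ZMod.stdAddChar_coe, ex]; push_cast; ring_nf

theorem gg_int {L K N : ℕ} (hNL : N ≤ L) (hK : 1 ≤ K) (c : ℕ → ℂ) (w : Fin K → ℤ) (h : ℕ) :
    gg p L K c N ((fun j => (w j : ZMod (p^L))) + sh p L K N h) =
      ∑ x ∈ range (p^N), (c x * ex ((∑ j : Fin K, (w j:ℝ) * (x:ℝ)^((j:ℕ)+1))/((p^L:ℕ):ℝ))) * ex (h*(x:ℝ)/((p^N:ℕ):ℝ)) := by
  unfold gg Ff
  refine sum_congr rfl fun x _ => ?_
  rw [mul_assoc, ← ex_add]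
  congr 1
  have e : (∑ j : Fin K, ((fun j => (w j : ZMod (p^L))) + sh p L K N h) j * (p:ZMod (p^L))^0 * (((x:ℕ):ℤ):ZMod (p^L))^((j:ℕ)+1)) =
      (((∑ j : Fin K, w j * (x:ℤ)^((j:ℕ)+1)) + h * p^(L-N) * x : ℤ) : ZMod (p^L)) := by
    push_cast
    simp only [Pi.add_apply, pow_zero, mul_one, add_mul, sum_add_distrib]
    congr 1
    rw [sum_eq_single ⟨0, hK⟩]
    · simp [sh]
    · intro j _ hj
      have : (j:ℕ) ≠ 0 := fun h => hj (Fin.ext h)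
      simp [sh, this]
    · simp
  rw [e, std_ex]
  congr 1
  have hpp := ppos (p := p)
  push_cast
  rw [add_div]; congr 1
  rw [div_eq_div_iff (by positivity) (by positivity)]
  calc _ = (h:ℝ)*x*((p:ℝ)^(L-N)*p^N) := by ring
    _ = _ := by rw [← pow_add, Nat.sub_add_cancel hNL]

theorem pointwise {L K N n y : ℕ} (hNL : N ≤ L) (hK : 1 ≤ K) (hy : y < n) (hn : 2*n ≤ p^N) (γ : Fin K → ℝ) (γ0 : ℝ) (c : ℕ → ℂ)
    (w : Fin K → ℤ) (hw : ∀ j : Fin K, |γ j - (w j:ℝ)/((p^L:ℕ):ℝ)| ≤ 1/((p^N:ℕ):ℝ)^((j:ℕ)+1)) :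
    ‖∑ i ∈ range n, c (1+y+i) * ex (γ0 + ∑ j : Fin K, γ j * ((1+y+i:ℕ):ℝ)^((j:ℕ)+1))‖ ≤
      Gs p L K c N (fun j => (w j : ZMod (p^L))) * (1 + 2*pi*K) := by
  set H := p^N with hH
  have hHpos : (0:ℝ) < H := by exact_mod_cast (show 0 < H by omega)
  set a : ℕ → ℂ := fun x => c x * ex ((∑ j : Fin K, (w j:ℝ) * (x:ℝ)^((j:ℕ)+1))/((p^L:ℕ):ℝ)) with ha
  set ψ : ℕ → ℝ := fun x => γ0 + ∑ j : Fin K, (γ j - (w j:ℝ)/((p^L:ℕ):ℝ)) * (x:ℝ)^((j:ℕ)+1) with hψ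
  have hG : ∀ m ≤ n, ‖∑ i ∈ range m, a (1+y+i)‖ ≤ Gs p L K c N (fun j => (w j : ZMod (p^L))) := by
    intro m hm
    refine (complete H a (1+y) m (by omega)).trans (le_of_eq ?_)
    unfold Gs
    refine sum_congr rfl fun h _ => ?_
    rw [gg_int hNL hK c w h]
  have hG0 := (norm_nonneg _).trans (hG 0 (Nat.zero_le _))
  have main := abel_bd (fun i => a (1+y+i)) (fun i => ex (ψ (1+y+i))) n hG0 hG (by rw [norm_ex])
    (V := 2*pi*K) (by
      calc _ ≤ ∑ i ∈ range n, 2*pi * ∑ j : Fin K, 1/(H:ℝ)^((j:ℕ)+1) * (((1+y+(i+1):ℕ):ℝ)^((j:ℕ)+1) - ((1+y+i:ℕ):ℝ)^((j:ℕ)+1)) := by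
            refine sum_le_sum fun i _ => (ex_sub_le _ _).trans ?_
            refine mll ?_ (by positivity)
            simp only [hψ, add_sub_add_left_eq_sub, ← sum_sub_distrib, ← mul_sub]
            refine (abs_sum_le_sum_abs _ _).trans (sum_le_sum fun j _ => ?_)
            have hm : ((1+y+i:ℕ):ℝ)^((j:ℕ)+1) ≤ ((1+y+(i+1):ℕ):ℝ)^((j:ℕ)+1) :=
              pow_le_pow_left₀ (by positivity) (by push_cast; linarith) _
            rw [abs_mul, abs_of_nonneg (sub_nonneg.2 hm)]
            exact mlr (hw j) (sub_nonneg.2 hm)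
        _ = 2*pi * ∑ j : Fin K, 1/(H:ℝ)^((j:ℕ)+1) * (((1+y+n:ℕ):ℝ)^((j:ℕ)+1) - ((1+y+0:ℕ):ℝ)^((j:ℕ)+1)) := by
            rw [← mul_sum, sum_comm]
            congr 1; refine sum_congr rfl fun j _ => ?_
            rw [← mul_sum]; congr 1
            exact Finset.sum_range_sub (fun i => ((1+y+i:ℕ):ℝ)^((j:ℕ)+1)) n
        _ ≤ 2*pi * ∑ j : Fin K, (1:ℝ) := by
            gcongr with j
            have h1 : ((1+y+n:ℕ):ℝ)^((j:ℕ)+1) ≤ (H:ℝ)^((j:ℕ)+1) := by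
              gcongr; omega
            rw [div_mul_eq_mul_div, one_mul, div_le_one (by positivity)]
            have : 0 ≤ ((1+y+0:ℕ):ℝ)^((j:ℕ)+1) := by positivity
            linarith
        _ = _ := by simp)
  refine le_trans (le_of_eq ?_) main
  congr 1; refine sum_congr rfl fun i _ => ?_
  simp only [ha, hψ]
  rw [mul_assoc, ← ex_add]; congr 2
  rw [add_left_comm, sum_div, ← sum_add_distrib]
  congr 1; refine sum_congr rfl fun j _ => ?_
  ring
end

noncomputable section
open Polynomial

theorem tay_coeff {R : Type*} [CommRing R] (P : R[X]) {k : ℕ} (hP : P.natDegree ≤ k) (r : R) (i : ℕ) :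
    (taylor r P).coeff i = ∑ j ∈ range (k+1), (j.choose i : R) * P.coeff j * r^(j-i) := by
  rw [taylor_coeff, hasseDeriv_apply, P.sum_over_range' (by simp) (k+1) (by omega), eval_finset_sum]
  refine sum_congr rfl fun j _ => ?_
  rw [eval_monomial]

theorem tay_top {R : Type*} [CommRing R] (P : R[X]) {k : ℕ} (hP : P.natDegree ≤ k) (r : R) :
    (taylor r P).coeff k = P.coeff k := by
  rw [tay_coeff P hP, sum_eq_single k]
  · simp
  · intro j hj hjk
    rw [Nat.choose_eq_zero_of_lt (by have := mem_range.1 hj; omega)]; simp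
  · simp

def Wy (P : ℝ[X]) (n : ℕ) : ℂ := ∑ x ∈ Icc 1 n, ex (P.eval (x:ℝ))

theorem Wy_range (P : ℝ[X]) (n : ℕ) : Wy P n = ∑ i ∈ range n, ex (P.eval ((1+i:ℕ):ℝ)) := by
  unfold Wy
  rw [show Icc 1 n = (range n).image (fun i => 1+i) by
    ext x; simp only [mem_Icc, mem_image, mem_range]
    exact ⟨fun h => ⟨x-1, by omega, by omega⟩, by rintro ⟨i, hi, rfl⟩; omega⟩]
  rw [Finset.sum_image (by intro a _ b _ h; simpa using h)]
variable {p : ℕ} [hp : Fact p.Prime]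

theorem Wy_shift {K : ℕ} (P : ℝ[X]) (hP : P.natDegree ≤ K+1) (n y : ℕ) : Wy P n = ∑ i ∈ range n,
    ex (P.coeff (K+1) * ((1+y+i:ℕ):ℝ)^(K+1)) * ex ((taylor (-(y:ℝ)) P).coeff 0 +
      ∑ j : Fin K, (taylor (-(y:ℝ)) P).coeff ((j:ℕ)+1) * ((1+y+i:ℕ):ℝ)^((j:ℕ)+1)) := by
  rw [Wy_range]
  refine sum_congr rfl fun i _ => ?_
  rw [← ex_add]; congr 1
  have h1 : P.eval ((1+i:ℕ):ℝ) = (taylor (-(y:ℝ)) P).eval ((1+y+i:ℕ):ℝ) := by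
    rw [taylor_eval]; congr 1; push_cast; ring
  rw [h1, eval_eq_sum_range' (n := K+2) (by rw [natDegree_taylor]; omega), sum_range_succ, tay_top P hP,
    sum_range_succ', Finset.sum_range]
  simp; ring

theorem exists_N (n : ℕ) (hn : 1 ≤ n) : ∃ N, 2*n ≤ p^N ∧ p^N ≤ 2*n*p ∧ 1 ≤ N := by
  have h2 := hp.out.two_le
  refine ⟨Nat.clog p (2*n), Nat.le_pow_clog h2 _, ?_, Nat.clog_pos h2 (by omega)⟩
  have := Nat.pow_pred_clog_lt_self h2 (x := 2*n) (by omega)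
  have h3 := Nat.clog_pos h2 (show 2 ≤ 2*n by omega)
  calc p^(Nat.clog p (2*n)) = p^((Nat.clog p (2*n)).pred) * p := by
        rw [← pow_succ]; congr 1; exact (Nat.succ_pred_eq_of_pos h3).symm
    _ ≤ _ := by gcongr

theorem pigeon {K N n Y : ℕ} (hK : 1 ≤ K) (hYn : Y ≤ n) (hn : 2*n ≤ p^N) (P : ℝ[X]) (hP : P.natDegree ≤ K+1)
    {T : ℝ} (hT0 : 0 < T) (hT : T ≤ ‖Wy P n‖) {Bd : ℝ}
    (hBd : ∑ u : Fin K → ZMod (p^(K*N)), Gs p (K*N) K (fun x => ex (P.coeff (K+1) * (x:ℝ)^(K+1))) N u ^ (2*tri K) ≤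
      Bd * ((p^(K*N):ℕ):ℝ)^K) :
    ∃ YY : Finset ℕ, YY ⊆ range Y ∧ (∀ y ∈ YY, ∀ y' ∈ YY, ∀ j, j < K → ∃ b : ℤ,
      |(taylor (-(y:ℝ)) P).coeff (j+1) - (taylor (-(y':ℝ)) P).coeff (j+1) - b| ≤ 2/((p^N:ℕ):ℝ)^(j+1)) ∧
      Y * (T/(1+2*pi*K))^(2*tri K) ≤ YY.card * Bd * ((p^N:ℕ):ℝ)^(tri K) := by
  classical
  set R := p^(K*N) with hR
  have hpp := hp.out.pos
  have hRpos : (0:ℝ) < R := by exact_mod_cast (pow_pos hpp (K*N) : 0 < p^(K*N))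
  set c : ℕ → ℂ := fun x => ex (P.coeff (K+1) * (x:ℝ)^(K+1)) with hc
  set V : Fin K → ℕ := fun j => p^(K*N - ((j:ℕ)+1)*N) with hV
  have hjN : ∀ j : Fin K, ((j:ℕ)+1)*N ≤ K*N := fun j => Nat.mul_le_mul_right _ j.2
  have hV1 : ∀ j, 1 ≤ V j := fun j => Nat.one_le_pow _ _ hpp
  have hVH : ∀ j : Fin K, V j * (p^N)^((j:ℕ)+1) = R := by
    intro j; simp only [hV, hR]; rw [← pow_mul, ← pow_add]; congr 1
    rw [mul_comm N, Nat.sub_add_cancel (hjN j)]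
  set γ : ℕ → Fin K → ℝ := fun y j => (taylor (-(y:ℝ)) P).coeff ((j:ℕ)+1) with hγ
  set w : ℕ → ((j : Fin K) → Fin (V j)) → Fin K → ℤ := fun y v j => ⌊(R:ℝ) * γ y j⌋ + (v j : ℕ) with hw
  have hHpos : (0:ℝ) < ((p^N:ℕ):ℝ) := by exact_mod_cast pow_pos hpp N
  have hwb : ∀ y v j, |γ y j - (w y v j:ℝ)/(R:ℝ)| ≤ 1/((p^N:ℕ):ℝ)^((j:ℕ)+1) := by
    intro y v j
    have h1 := Int.floor_le ((R:ℝ) * γ y j)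
    have h2 := Int.lt_floor_add_one ((R:ℝ) * γ y j)
    have h3 : ((v j:ℕ):ℝ) + 1 ≤ V j := by exact_mod_cast (v j).2
    have h4 : (0:ℝ) ≤ ((v j:ℕ):ℝ) := by positivity
    have e1 : γ y j - (w y v j:ℝ)/(R:ℝ) = (R * γ y j - w y v j)/R := by field_simp
    have e2 : 1/((p^N:ℕ):ℝ)^((j:ℕ)+1) = V j/R := by
      rw [div_eq_div_iff (by positivity) hRpos.ne', one_mul]; exact_mod_cast (hVH j).symm
    rw [e1, e2, abs_div, abs_of_pos hRpos]
    gcongr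
    simp only [hw]; push_cast
    rw [abs_le]; constructor <;> linarith
  set U : ℕ → ((j : Fin K) → Fin (V j)) → Fin K → ZMod (p^(K*N)) := fun y v j => (w y v j : ZMod (p^(K*N))) with hU
  have hinj : ∀ y, Function.Injective (U y) := by
    intro y v v' h
    funext j
    have hj := congrFun h j
    simp only [hU, hw] at hj
    push_cast at hj
    have hj := add_left_cancel hj
    have hlt : ∀ v : (j : Fin K) → Fin (V j), ((v j : ℕ)) < p^(K*N) := fun v => (v j).2.trans_le (Nat.pow_le_pow_right hpp (Nat.sub_le _ _))
    have := (ZMod.natCast_eq_natCast_iff _ _ _).1 hj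
    exact Fin.ext (Nat.ModEq.eq_of_lt_of_lt this (hlt v) (hlt v'))
  set t := T/(1+2*pi*K) with ht
  have hpi := pi_pos
  have hden : 0 < 1+2*pi*K := by positivity
  have hG : ∀ y < Y, ∀ v, t ≤ Gs p (K*N) K c N (U y v) := by
    intro y hy v
    rw [ht, div_le_iff₀ hden]
    refine hT.trans ?_
    rw [Wy_shift (K := K) P hP n y]
    exact pointwise (Nat.le_mul_of_pos_left _ hK) hK (by omega) hn (γ y) _ c (w y v) (hwb y v)
  set F : (Fin K → ZMod (p^(K*N))) → Finset ℕ := fun u => (range Y).filter (fun y => ∃ v, U y v = u) with hF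
  obtain ⟨u0, -, hu0⟩ := Finset.exists_max_image (univ : Finset (Fin K → ZMod (p^(K*N)))) (fun u => (F u).card) ⟨0, mem_univ _⟩
  refine ⟨F u0, Finset.filter_subset _ _, ?_, ?_⟩
  · intro y hy y' hy' j hj
    obtain ⟨v, hv⟩ := (mem_filter.1 hy).2
    obtain ⟨v', hv'⟩ := (mem_filter.1 hy').2
    have h := congrFun (hv.trans hv'.symm) ⟨j, hj⟩
    simp only [hU] at h
    obtain ⟨b, hb⟩ := (ZMod.intCast_eq_intCast_iff_dvd_sub _ _ _).1 h
    refine ⟨-b, ?_⟩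
    have hbR : (w y' v' ⟨j,hj⟩:ℝ) = w y v ⟨j,hj⟩ + R * b := by
      have : w y' v' ⟨j,hj⟩ = w y v ⟨j,hj⟩ + (R:ℤ) * b := by rw [hR]; push_cast at hb ⊢; linarith
      exact_mod_cast this
    have h1 := hwb y v ⟨j,hj⟩
    have h2 := hwb y' v' ⟨j,hj⟩
    have e : (taylor (-(y:ℝ)) P).coeff (j+1) - (taylor (-(y':ℝ)) P).coeff (j+1) - ((-b:ℤ):ℝ) =
        (γ y ⟨j,hj⟩ - (w y v ⟨j,hj⟩:ℝ)/R) - (γ y' ⟨j,hj⟩ - (w y' v' ⟨j,hj⟩:ℝ)/R) := by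
      rw [hbR, add_div, mul_div_cancel_left₀ _ hRpos.ne']; push_cast; simp only [hγ]; ring
    rw [e]
    refine (abs_sub _ _).trans ?_
    simp only at h1 h2
    calc _ ≤ 1/((p^N:ℕ):ℝ)^(j+1) + 1/((p^N:ℕ):ℝ)^(j+1) := add_le_add h1 h2
      _ = _ := by ring
  · set VV : ℕ := ∏ j, V j with hVV
    have hprod : (R:ℝ)^K = VV * ((p^N:ℕ):ℝ)^(tri K) := by
      have : R^K = VV * (p^N)^(tri K) := by
        calc R^K = ∏ j : Fin K, R := by simp
          _ = ∏ j : Fin K, V j * (p^N)^((j:ℕ)+1) := Finset.prod_congr rfl fun j _ => (hVH j).symm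
          _ = _ := by
            rw [Finset.prod_mul_distrib]; congr 1; rw [Finset.prod_pow_eq_pow_sum]; congr 1
            rw [Fin.sum_univ_eq_sum_range (fun j => j+1)]
            have h1 := two_tri K
            have h2 := Finset.sum_range_id_mul_two (K+1)
            rw [sum_range_succ'] at h2
            simp only [add_tsub_cancel_right] at h2
            nlinarith
      exact_mod_cast this
    have hVV0 : (0:ℝ) < VV := by exact_mod_cast Finset.prod_pos fun j _ => hV1 j
    have t0 : 0 ≤ t := by positivity
    have key : (Y:ℝ) * (VV * t^(2*tri K)) ≤ (F u0).card * (Bd * (R:ℝ)^K) := by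
      calc (Y:ℝ) * (VV * t^(2*tri K)) = ∑ y ∈ range Y, ∑ v : ((j : Fin K) → Fin (V j)), t^(2*tri K) := by
            simp [hVV]
        _ ≤ ∑ y ∈ range Y, ∑ v : ((j : Fin K) → Fin (V j)), Gs p (K*N) K c N (U y v)^(2*tri K) := by
            gcongr with y hy v
            exact hG y (mem_range.1 hy) v
        _ = ∑ y ∈ range Y, ∑ u, if (∃ v, U y v = u) then Gs p (K*N) K c N u^(2*tri K) else 0 := by
            refine sum_congr rfl fun y _ => ?_
            rw [← sum_filter, ← Finset.sum_image (f := fun u => Gs p (K*N) K c N u^(2*tri K)) (g := U y) (fun a _ b _ h => hinj y h)]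
            congr 1; ext u; simp
        _ = ∑ u, (F u).card * Gs p (K*N) K c N u^(2*tri K) := by
            rw [sum_comm]; refine sum_congr rfl fun u _ => ?_
            rw [← sum_filter, sum_const, nsmul_eq_mul]
        _ ≤ ∑ u, ((F u0).card:ℝ) * Gs p (K*N) K c N u^(2*tri K) := by
            refine sum_le_sum fun u _ => mlr (by exact_mod_cast hu0 u (mem_univ _)) ?_
            rw [pow_mul]; positivity
        _ ≤ _ := by rw [← mul_sum]; gcongr
    rw [hprod] at key
    have : (VV:ℝ) * (Y * t^(2*tri K)) ≤ VV * ((F u0).card * Bd * ((p^N:ℕ):ℝ)^(tri K)) := by linarith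
    exact le_of_mul_le_mul_left this hVV0
end

noncomputable section
open Polynomial

theorem orbit {K : ℕ} (hK : 1 ≤ K) {ε : ℝ} (hε : 0 < ε) : ∃ C : ℝ, 1 ≤ C ∧ ∀ (n Y : ℕ), 1 ≤ n → Y ≤ n → ∀ P : ℝ[X],
    P.natDegree ≤ K+1 → ∀ T : ℝ, 0 < T → T ≤ ‖Wy P n‖ →
    ∃ YY : Finset ℕ, YY ⊆ range Y ∧ (∀ y ∈ YY, ∀ y' ∈ YY, ∀ j, j < K → ∃ b : ℤ,
      |(taylor (-(y:ℝ)) P).coeff (j+1) - (taylor (-(y':ℝ)) P).coeff (j+1) - b| ≤ 2/(n:ℝ)^(j+1)) ∧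
      Y * T^(2*tri K) ≤ YY.card * (C * (n:ℝ)^ε * (n:ℝ)^(2*tri K)) := by
  obtain ⟨p, hpK, hpp⟩ := Nat.exists_infinite_primes (K+1)
  haveI hp : Fact p.Prime := ⟨hpp⟩
  obtain ⟨Cm, hCm, hmean⟩ := mean hK (decoupling (p := p) K hK (by omega) (ε/2) (by positivity))
  set s := tri K with hs
  have hs1 : 1 ≤ s := tri_pos hK
  have hsR : (0:ℝ) < s := by exact_mod_cast hs1
  set e := ε/(4*s) with he
  have he0 : 0 < e := by positivity
  have hpi := pi_pos
  set c0 := 1+2*pi*K with hc0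
  have hc01 : 1 ≤ c0 := by have : 0 ≤ 2*pi*K := by positivity
                           linarith
  have hpR : (1:ℝ) ≤ p := by exact_mod_cast hpp.one_lt.le
  set C := c0^(2*s) * ((2+1/e)^(2*s) * Cm * ((2*p:ℝ)^ε * (2*p:ℝ)^(2*s))) with hC
  have h2e : 1 ≤ 2+1/e := by have : 0 < 1/e := by positivity
                             linarith
  refine ⟨C, ?_, ?_⟩
  · refine one_lm (one_le_pow₀ hc01) (one_lm
      (one_lm (one_le_pow₀ h2e) hCm) (one_lm
        (one_le_rpow (by linarith) hε.le) (one_le_pow₀ (by linarith))))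
  intro n Y hn hY P hP T hT0 hT
  obtain ⟨N, hN1, hN2, hN3⟩ := exists_N (p := p) n hn
  set H : ℝ := ((p^N:ℕ):ℝ) with hH
  have hH1 : 1 ≤ H := by rw [hH]; exact_mod_cast (show 1 ≤ p^N by omega)
  have hnR : (1:ℝ) ≤ n := by exact_mod_cast hn
  have hG := Gs_sum (p := p) (L := K*N) (K := K) (N := N) hs1 (fun x => ex (P.coeff (K+1) * (x:ℝ)^(K+1)))
  have hm := hmean N (fun x => ex (P.coeff (K+1) * (x:ℝ)^(K+1))) (fun x => (norm_ex _).le)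
  have hlog0 : 0 ≤ Real.log H := Real.log_nonneg hH1
  obtain ⟨YY, h1, h2, h3⟩ := pigeon (p := p) (N := N) hK hY hN1 P hP hT0 hT
    (Bd := (2+Real.log H)^(2*s) * (Cm * (p:ℝ)^(ε/2*N) * H^s)) (by
      refine hG.trans ?_
      rw [mul_assoc]
      refine mll (hm.trans (le_of_eq ?_)) (by positivity)
      ring)
  refine ⟨YY, h1, ?_, ?_⟩
  · intro y hy y' hy' j hj
    obtain ⟨b, hb⟩ := h2 y hy y' hy' j hj
    refine ⟨b, hb.trans ?_⟩
    have : (n:ℝ) ≤ ((p^N:ℕ):ℝ) := by exact_mod_cast (show n ≤ p^N by omega)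
    gcongr
  · have hHe : H^e ≥ 1 := one_le_rpow hH1 he0.le
    have hl : 2+Real.log H ≤ (2+1/e) * H^e := by
      have := Real.log_le_rpow_div (show 0 ≤ H by linarith) he0
      rw [add_mul, one_div_mul_eq_div]; linarith
    have hl2 : (2+Real.log H)^(2*s) ≤ (2+1/e)^(2*s) * H^(ε/2) := by
      calc _ ≤ ((2+1/e) * H^e)^(2*s) := by gcongr
        _ = _ := by
          rw [mul_pow, ← rpow_natCast (H^e), ← rpow_mul (by linarith)]
          congr 2; push_cast; rw [he]; field_simp; ring
    have hpN : (p:ℝ)^(ε/2*N) = H^(ε/2) := by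
      rw [hH]; push_cast; rw [← rpow_natCast, ← rpow_mul (by linarith)]; congr 1; ring
    have hHn : H ≤ 2*p*n := by
      rw [hH]; have : p^N ≤ 2*p*n := by linarith
      exact_mod_cast this
    rw [hpN] at h3
    have hTe : Y * T^(2*s) = c0^(2*s) * (Y * (T/c0)^(2*s)) := by
      rw [div_pow]; field_simp
    rw [hTe]
    calc _ ≤ c0^(2*s) * (YY.card * ((2+Real.log H)^(2*s) * (Cm * H^(ε/2) * H^s)) * H^s) := by gcongr
      _ ≤ c0^(2*s) * (YY.card * (((2+1/e)^(2*s) * H^(ε/2)) * (Cm * H^(ε/2) * H^s)) * H^s) := by gcongr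
      _ = c0^(2*s) * YY.card * ((2+1/e)^(2*s) * Cm * (H^ε * H^(2*s))) := by
        rw [show ε = ε/2+ε/2 by ring, rpow_add (by linarith), ← show ε = ε/2+ε/2 by ring]
        ring
      _ ≤ c0^(2*s) * YY.card * ((2+1/e)^(2*s) * Cm * ((2*p*n:ℝ)^ε * (2*p*n:ℝ)^(2*s))) := by gcongr
      _ = _ := by
        rw [mul_rpow (by positivity) (by positivity), mul_pow (2*p:ℝ), hC]; ring
end

noncomputable section

theorem frac (DD : Finset ℕ) (D : ℕ) (hD : D ∈ DD) (hDD : ∀ d ∈ DD, 1 ≤ d ∧ d ≤ D) (θ η : ℝ) (hη : 2*η*D < 1)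
    (h : ∀ d ∈ DD, ∃ a : ℤ, |θ*d - a| ≤ η) : ∃ t : ℕ, 1 ≤ t ∧ ∃ a : ℤ, (∀ d ∈ DD, t ∣ d) ∧ |θ - a/t| ≤ η/D := by
  have hD1 := (hDD D hD).1
  have hDR : (1:ℝ) ≤ D := by exact_mod_cast hD1
  obtain ⟨A, hA⟩ := h D hD
  have hη0 : 0 ≤ η := (abs_nonneg _).trans hA
  set r : ℚ := (A:ℚ)/D with hr
  have hrR : (r.num:ℝ)/r.den = (A:ℝ)/D := by
    have : ((r:ℚ):ℝ) = (A:ℝ)/D := by rw [hr]; push_cast; rfl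
    rw [← this, Rat.cast_def]
  refine ⟨r.den, r.den_pos, r.num, ?_, ?_⟩
  · intro d hd
    obtain ⟨a, ha⟩ := h d hd
    have hdD : (d:ℝ) ≤ D := by exact_mod_cast (hDD d hd).2
    have e : a * D = A * d := by
      have h1 : |((a*D - A*d:ℤ):ℝ)| < 1 := by
        calc |((a*D - A*d:ℤ):ℝ)| = |(θ*D - A)*d - (θ*d-a)*D| := by push_cast; ring_nf
          _ ≤ |(θ*D - A)*d| + |(θ*d-a)*D| := abs_sub _ _
          _ = |θ*D - A| * d + |θ*d-a| * D := by rw [abs_mul, abs_mul, abs_of_nonneg (show (0:ℝ) ≤ d by positivity), abs_of_nonneg (show (0:ℝ) ≤ D by positivity)]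
          _ ≤ η*D + η*D := by gcongr
          _ < 1 := by linarith
      have h2 : |a*D - A*d| < 1 := by exact_mod_cast h1
      have := Int.abs_lt_one_iff.1 h2
      linarith
    have hq : (r.num:ℚ) * d = a * r.den := by
      have hD0 : (D:ℚ) ≠ 0 := by exact_mod_cast (show D ≠ 0 by omega)
      have h1 : (a:ℚ) * D = A * d := by exact_mod_cast e
      have h2 : (r.num:ℚ) = r * r.den := (Rat.mul_den_eq_num r).symm
      rw [h2, hr]; rw [mul_right_comm]; congr 1
      rw [div_mul_eq_mul_div, ← h1, mul_div_cancel_right₀ _ hD0]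
    have hz : r.num * d = a * r.den := by exact_mod_cast hq
    have hdvd : (r.den:ℤ) ∣ r.num * d := ⟨a, by rw [hz, mul_comm]⟩
    have hco : IsCoprime (r.den:ℤ) r.num := by
      rw [Int.isCoprime_iff_gcd_eq_one, Int.gcd_comm, Int.gcd_def]; simpa using r.reduced
    exact_mod_cast hco.dvd_of_dvd_mul_left hdvd
  · rw [hrR, show θ - (A:ℝ)/D = (θ*D - A)/D by field_simp, abs_div, abs_of_pos (show (0:ℝ) < D by linarith)]
    gcongr

theorem structL (k : ℕ) (m : ℕ) (hm : m + 1 ≤ k) : ∃ (C : ℝ) (c : ℕ), 1 ≤ C ∧ 1 ≤ c ∧ ∀ (n : ℕ) (DD : Finset ℕ) (D : ℕ) (g : ℕ → ℝ),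
    1 ≤ n → D ∈ DD → (∀ d ∈ DD, 1 ≤ d ∧ d ≤ D) → C * D ≤ n →
    (∀ d ∈ DD, ∀ i, 1 ≤ i → i < k → ∃ b : ℤ, |∑ j ∈ Ioc i k, (j.choose i : ℝ) * g j * (d:ℝ)^(j-i) - b| ≤ 2/(n:ℝ)^i) →
    ∃ Q : ℕ, 1 ≤ Q ∧ (∀ d ∈ DD, Q ∣ c*d) ∧ ∀ j, k - m < j → j ≤ k → ∃ a : ℤ, |g j - a/Q| ≤ C/((n:ℝ)^(j-1)*D) := by
  induction m with
  | zero => exact ⟨1, 1, le_rfl, le_rfl, fun n DD D g _ _ _ _ _ => ⟨1, le_rfl, fun d _ => one_dvd _, fun j h1 h2 => by omega⟩⟩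
  | succ m ih =>
    obtain ⟨C, c, hC, hc, ih⟩ := ih (by omega)
    set C' : ℝ := c*(2 + 2^(k+1)*C) with hC'
    have hcR : (1:ℝ) ≤ c := by exact_mod_cast hc
    have hC'1 : C ≤ C' := by
      have h2 : (1:ℝ) ≤ 2^(k+1) := one_le_pow₀ (by norm_num)
      have h3 : C ≤ 2^(k+1)*C := le_mul_of_one_le_left (by linarith) h2
      have h4 : (2 + 2^(k+1)*C) ≤ c*(2 + 2^(k+1)*C) := le_mul_of_one_le_left (by linarith) hcR
      linarith
    obtain ⟨i, hi⟩ : ∃ i, k - m = i+1 := ⟨k-m-1, by omega⟩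
    have hi1 : 1 ≤ i := by omega
    refine ⟨4*C', c*(i+1), by linarith, Nat.mul_pos hc (Nat.succ_pos i), ?_⟩
    intro n DD D g hn hD hDD hDn hyp
    have hnR : (1:ℝ) ≤ n := by exact_mod_cast hn
    have hDR : (1:ℝ) ≤ D := by exact_mod_cast (hDD D hD).1
    obtain ⟨Q, hQ, hQd, hQa⟩ := ih n DD D g hn hD hDD (le_trans (by gcongr; linarith) hDn) hyp
    have hQR : (0:ℝ) < Q := by exact_mod_cast hQ
    have hDn' : (D:ℝ) ≤ n := le_trans (le_mul_of_one_le_left (by linarith) (by linarith)) hDn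
    set η := C'/(n:ℝ)^i with hη
    set θ := (c:ℝ)*(i+1)*g (i+1) with hθ
    choose! a ha using hQa
    obtain ⟨t, ht, b, htd, hb⟩ := frac DD D hD hDD θ η (by
        have : (n:ℝ) ≤ (n:ℝ)^i := le_self_pow₀ hnR (by omega)
        rw [hη, mul_div_assoc', div_mul_eq_mul_div, div_lt_one (by positivity)]
        nlinarith) (by
      intro d hd
      obtain ⟨b, hb⟩ := hyp d hd i hi1 (by omega)
      obtain ⟨e, he⟩ := hQd d hd
      have hdR : (1:ℝ) ≤ d := by exact_mod_cast (hDD d hd).1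
      have hdD : (d:ℝ) ≤ D := by exact_mod_cast (hDD d hd).2
      have heR : (c:ℝ)*d = Q*e := by exact_mod_cast he
      refine ⟨c*b - ∑ j ∈ Ioc (i+1) k, (j.choose i:ℤ) * e * a j * (d:ℤ)^(j-i-1), ?_⟩
      have split : ∑ j ∈ Ioc i k, (j.choose i : ℝ) * g j * (d:ℝ)^(j-i) =
          (i+1)*g (i+1)*d + ∑ j ∈ Ioc (i+1) k, (j.choose i : ℝ) * g j * (d:ℝ)^(j-i) := by
        rw [show Ioc i k = insert (i+1) (Ioc (i+1) k) by
          ext j; simp only [mem_insert, mem_Ioc]; omega, sum_insert (by simp)]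
        congr 1
        rw [Nat.choose_succ_self_right, Nat.add_sub_cancel_left, pow_one]; push_cast; ring
      have heq : θ*d - ((c*b - ∑ j ∈ Ioc (i+1) k, (j.choose i:ℤ) * e * a j * (d:ℤ)^(j-i-1) : ℤ):ℝ) =
          c*(∑ j ∈ Ioc i k, (j.choose i : ℝ) * g j * (d:ℝ)^(j-i) - b) -
            ∑ j ∈ Ioc (i+1) k, (j.choose i:ℝ) * (c*(d:ℝ)^(j-i)*(g j - a j/Q)) := by
        rw [split]
        have : ∀ j ∈ Ioc (i+1) k, (j.choose i:ℝ) * (c*(d:ℝ)^(j-i)*(g j - a j/Q)) =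
            c*((j.choose i : ℝ) * g j * (d:ℝ)^(j-i)) - (j.choose i:ℝ) * e * a j * (d:ℝ)^(j-i-1) := by
          intro j hj
          have hj := mem_Ioc.1 hj
          have e1 : (d:ℝ)^(j-i) = d * (d:ℝ)^(j-i-1) := by rw [← pow_succ']; congr 1; omega
          have e2 : (c:ℝ)*d/Q = e := by rw [heR, mul_div_cancel_left₀ _ hQR.ne']
          rw [e1, ← e2]; ring
        rw [sum_congr rfl this, sum_sub_distrib, ← mul_sum]
        push_cast; rw [hθ]; ring
      rw [heq]
      have bd : ∀ j ∈ Ioc (i+1) k, |(j.choose i:ℝ) * (c*(d:ℝ)^(j-i)*(g j - a j/Q))| ≤ 2^j * (c*C/(n:ℝ)^i) := by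
        intro j hj
        have hj := mem_Ioc.1 hj
        have h1 := ha j (by omega) hj.2
        rw [abs_mul, abs_mul, abs_of_nonneg (show (0:ℝ) ≤ j.choose i by positivity), abs_of_nonneg (show (0:ℝ) ≤ c*(d:ℝ)^(j-i) by positivity)]
        have h2 : (j.choose i:ℝ) ≤ 2^j := by exact_mod_cast Nat.choose_le_two_pow j i
        have h3 : (d:ℝ)^(j-i) ≤ D * (n:ℝ)^(j-i-1) := by
          calc (d:ℝ)^(j-i) = d * (d:ℝ)^(j-i-1) := by rw [← pow_succ']; congr 1; omega
            _ ≤ _ := mul_le_mul hdD (pow_le_pow_left₀ (by positivity) (hdD.trans hDn') _) (by positivity) (by positivity)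
        calc _ ≤ 2^j * (c*(D * (n:ℝ)^(j-i-1)) * (C/((n:ℝ)^(j-1)*D))) := by gcongr
          _ = _ := by
            have : (n:ℝ)^(j-1) = (n:ℝ)^(j-i-1) * (n:ℝ)^i := by rw [← pow_add]; congr 1; omega
            rw [this]; field_simp
      calc _ ≤ |c*(∑ j ∈ Ioc i k, (j.choose i : ℝ) * g j * (d:ℝ)^(j-i) - b)| +
            |∑ j ∈ Ioc (i+1) k, (j.choose i:ℝ) * (c*(d:ℝ)^(j-i)*(g j - a j/Q))| := abs_sub _ _
        _ ≤ c*(2/(n:ℝ)^i) + ∑ j ∈ Ioc (i+1) k, 2^j * (c*C/(n:ℝ)^i) := by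
          refine add_le_add ?_ ((abs_sum_le_sum_abs _ _).trans (sum_le_sum bd))
          rw [abs_mul, abs_of_nonneg (by positivity)]; gcongr
        _ ≤ c*(2/(n:ℝ)^i) + 2^(k+1) * (c*C/(n:ℝ)^i) := by
          rw [← sum_mul]; gcongr
          have : ∑ j ∈ Ioc (i+1) k, 2^j ≤ 2^(k+1) := by
            calc ∑ j ∈ Ioc (i+1) k, 2^j ≤ ∑ j ∈ range (k+1), 2^j :=
                  Finset.sum_le_sum_of_subset (fun j hj => by simp at hj ⊢; omega)
              _ ≤ _ := by rw [Nat.geomSum_eq le_rfl]; exact (Nat.div_le_self _ _).trans (Nat.sub_le _ _)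
          exact_mod_cast this
        _ = _ := by rw [hη, hC']; ring)
    set w := c*(i+1)*t with hw
    have hw0 : 0 < w := by positivity
    have hl0 : 0 < Nat.lcm Q w := Nat.lcm_pos hQ hw0
    have conv : ∀ (q : ℕ) (z : ℤ), 0 < q → q ∣ Nat.lcm Q w → ∃ z' : ℤ, (z':ℝ)/(Nat.lcm Q w:ℕ) = z/q := by
      intro q z hq ⟨r, hr⟩
      have hr0 : r ≠ 0 := by rintro rfl; rw [mul_zero] at hr; exact absurd hr hl0.ne'
      refine ⟨z*r, ?_⟩
      rw [hr]; push_cast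
      rw [mul_div_mul_right _ _ (by exact_mod_cast hr0)]
    refine ⟨Nat.lcm Q w, hl0, ?_, ?_⟩
    · intro d hd
      refine Nat.lcm_dvd ?_ (Nat.mul_dvd_mul_left _ (htd d hd))
      exact (hQd d hd).trans (by rw [mul_right_comm]; exact dvd_mul_right _ _)
    · intro j hj1 hj2
      rcases Nat.eq_or_lt_of_le (show i+1 ≤ j by omega) with e | hlt
      · subst e
        obtain ⟨z, hz⟩ := conv w b hw0 (Nat.dvd_lcm_right _ _)
        refine ⟨z, ?_⟩
        rw [hz]
        have htR : (1:ℝ) ≤ t := by exact_mod_cast ht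
        have e : g (i+1) - b/(w:ℕ) = (θ - b/t)/((c:ℝ)*(i+1)) := by
          rw [hθ, hw]; push_cast; field_simp
        have hci : 1 ≤ (c:ℝ)*(i+1) := one_lm hcR (by linarith [show (0:ℝ) ≤ i by positivity])
        rw [e, abs_div, abs_of_pos (show (0:ℝ) < (c:ℝ)*(i+1) by linarith)]
        calc _ ≤ |θ - b/t| := div_le_self (abs_nonneg _) hci
          _ ≤ η/D := hb
          _ = C'/((n:ℝ)^i*D) := by rw [hη, div_div]
          _ ≤ _ := by rw [Nat.add_sub_cancel]; gcongr; linarith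
      · obtain ⟨z, hz⟩ := conv Q (a j) hQ (Nat.dvd_lcm_left _ _)
        refine ⟨z, ?_⟩
        rw [hz]
        exact (ha j (by omega) hj2).trans (by gcongr; linarith)
end

noncomputable section
open Polynomial

theorem Wy_le (P : ℝ[X]) (n : ℕ) : ‖Wy P n‖ ≤ n := by
  unfold Wy
  refine (norm_sum_le _ _).trans ?_
  simp [norm_ex]

theorem count_Q (DD : Finset ℕ) (D c Q : ℕ) (hQ : 1 ≤ Q) (hDD : ∀ d ∈ DD, 1 ≤ d ∧ d ≤ D) (hc : 1 ≤ c) (h : ∀ d ∈ DD, Q ∣ c*d) :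
    Q * DD.card ≤ c*D := by
  have : DD.card ≤ (Icc 1 (c*D/Q)).card := by
    refine Finset.card_le_card_of_injOn (fun d => c*d/Q) ?_ ?_
    · intro d hd
      have h1 := hDD d hd
      obtain ⟨e, he⟩ := h d hd
      simp only [Finset.coe_Icc, Set.mem_Icc]
      refine ⟨(Nat.one_le_div_iff hQ).2 (Nat.le_of_dvd (by nlinarith) (h d hd)), Nat.div_le_div_right (Nat.mul_le_mul_left _ h1.2)⟩
    · intro d hd d' hd' hdd
      have := (Nat.div_left_inj (h d hd) (h d' hd')).1 hdd
      exact Nat.eq_of_mul_eq_mul_left hc this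
  rw [Nat.card_Icc, Nat.add_sub_cancel] at this
  calc _ ≤ Q*(c*D/Q) := Nat.mul_le_mul_left _ this
    _ ≤ _ := Nat.mul_div_le _ _

theorem tay_diff (G : ℝ[X]) {k : ℕ} (hG : G.natDegree ≤ k) (d : ℝ) (i : ℕ) (hi : i ≤ k) :
    (taylor d G).coeff i - G.coeff i = ∑ j ∈ Ioc i k, (j.choose i : ℝ) * G.coeff j * d^(j-i) := by
  rw [tay_coeff G hG]
  have : range (k+1) = range i ∪ insert i (Ioc i k) := by
    ext j; simp only [Finset.mem_union, mem_insert, mem_Ioc, mem_range]; omega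
  rw [this, Finset.sum_union (by
    rw [Finset.disjoint_left]; intro j hj; simp only [mem_insert, mem_Ioc, mem_range] at *; omega),
    sum_insert (by simp), sum_eq_zero (by
      intro j hj; rw [Nat.choose_eq_zero_of_lt (mem_range.1 hj)]; simp)]
  simp

theorem tay_back (P : ℝ[X]) (k n y0 Q : ℕ) (hP : P.natDegree ≤ k) (hn : 1 ≤ n) (hy : y0 ≤ n) {E : ℝ} (hE : 0 ≤ E)
    (h : ∀ j, 1 < j → j ≤ k → ∃ a : ℤ, |(taylor (-(y0:ℝ)) P).coeff j - a/Q| ≤ E/(n:ℝ)^j) :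
    ∀ j, 1 < j → j ≤ k → ∃ a : ℤ, |P.coeff j - a/Q| ≤ (k+1)*2^k*E/(n:ℝ)^j := by
  intro j hj1 hj2
  choose! a ha using h
  set g := fun i => (taylor (-(y0:ℝ)) P).coeff i with hg
  have hnR : (1:ℝ) ≤ n := by exact_mod_cast hn
  have hyR : (y0:ℝ) ≤ n := by exact_mod_cast hy
  have e : P = taylor (y0:ℝ) (taylor (-(y0:ℝ)) P) := by rw [taylor_taylor]; simp
  refine ⟨∑ i ∈ range (k+1), (i.choose j:ℤ) * a i * (y0:ℤ)^(i-j), ?_⟩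
  have e2 : P.coeff j - ((∑ i ∈ range (k+1), (i.choose j:ℤ) * a i * (y0:ℤ)^(i-j) : ℤ):ℝ)/Q =
      ∑ i ∈ range (k+1), (i.choose j:ℝ) * (g i - a i/Q) * (y0:ℝ)^(i-j) := by
    conv_lhs => rw [e]
    rw [tay_coeff _ (k := k) (by rw [natDegree_taylor]; exact hP)]
    push_cast
    rw [sum_div, ← sum_sub_distrib]
    exact sum_congr rfl fun i _ => by rw [hg]; ring
  rw [e2]
  calc _ ≤ ∑ i ∈ range (k+1), |(i.choose j:ℝ) * (g i - a i/Q) * (y0:ℝ)^(i-j)| := abs_sum_le_sum_abs _ _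
    _ ≤ ∑ i ∈ range (k+1), 2^k*E/(n:ℝ)^j := by
      refine sum_le_sum fun i hi => ?_
      have hik := mem_range.1 hi
      rcases lt_or_ge i j with hij | hij
      · rw [Nat.choose_eq_zero_of_lt hij]; simp; positivity
      · have h1 := ha i (by omega) (by omega)
        have h2 : (i.choose j:ℝ) ≤ 2^k := by
          exact_mod_cast (Nat.choose_le_two_pow i j).trans (Nat.pow_le_pow_right (by norm_num) (by omega))
        rw [abs_mul, abs_mul, abs_of_nonneg (show (0:ℝ) ≤ i.choose j by positivity), abs_of_nonneg (show (0:ℝ) ≤ (y0:ℝ)^(i-j) by positivity)]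
        calc _ ≤ 2^k * (E/(n:ℝ)^i) * (n:ℝ)^(i-j) := by
              refine mul_le_mul (mul_le_mul h2 h1 (abs_nonneg _) (by positivity)) (pow_le_pow_left₀ (by positivity) hyR _) (by positivity) (by positivity)
          _ = _ := by
              have : (n:ℝ)^i = (n:ℝ)^(i-j) * (n:ℝ)^j := by rw [← pow_add]; congr 1; omega
              rw [this]; field_simp
    _ = _ := by rw [sum_const, card_range, nsmul_eq_mul]; push_cast; ring

theorem propB0 {K : ℕ} (hK : 1 ≤ K) {ε : ℝ} (hε : 0 < ε) : ∃ C : ℝ, 1 ≤ C ∧ ∀ (n : ℕ), 1 ≤ n → ∀ P : ℝ[X],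
    P.natDegree ≤ K+1 → ∀ T : ℝ, 0 < T → T ≤ ‖Wy P n‖ → ∀ Z : ℝ, Z = (n:ℝ)^ε * ((n:ℝ)/T)^(2*tri K) → C*Z ≤ n →
    ∃ Q : ℕ, 1 ≤ Q ∧ (Q:ℝ) ≤ C*Z ∧ ∀ j, 1 < j → j ≤ K+1 → ∃ a : ℤ, |P.coeff j - a/Q| ≤ C*Z/Q/(n:ℝ)^j := by
  obtain ⟨C1, hC1, horb⟩ := orbit hK hε
  obtain ⟨C2, c, hC2, hc, hst⟩ := structL (K+1) K le_rfl
  have hcR : (1:ℝ) ≤ c := by exact_mod_cast hc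
  set C3 : ℝ := 4*c*C1*C2 with hC3
  have h12 : 1 ≤ C1*C2 := one_lm hC1 hC2
  have hC3' : 4*(C1*C2) ≤ C3 := by rw [hC3]; nlinarith
  have hk2 : (1:ℝ) ≤ ((K+1:ℕ)+1)*2^(K+1) := one_lm (by simp; positivity) (one_le_pow₀ (by norm_num))
  set C := ((K+1:ℕ)+1)*2^(K+1)*(C2*C3) with hC
  have hCC : C3 ≤ C := by
    have : C3 ≤ C2*C3 := le_mul_of_one_le_left (by linarith) hC2
    exact this.trans (le_mul_of_one_le_left (by linarith) hk2)
  refine ⟨C, by linarith, ?_⟩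
  intro n hn P hP T hT0 hT Z hZ hCZ
  have hnR : (1:ℝ) ≤ n := by exact_mod_cast hn
  have hTn : T ≤ n := hT.trans (Wy_le P n)
  have hZ1 : 1 ≤ Z := by
    rw [hZ]
    exact one_lm (one_le_rpow hnR hε.le) (one_le_pow₀ ((one_le_div hT0).2 hTn))
  have hCn : C ≤ n := (le_mul_of_one_le_right (by linarith) hZ1).trans hCZ
  set Y := ⌊(n:ℝ)/C2⌋₊ with hY
  have hC20 : 0 < C2 := by linarith
  have hYle : (Y:ℝ) ≤ n/C2 := Nat.floor_le (by positivity)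
  have hYn : (Y:ℝ) ≤ n := hYle.trans (div_le_self (by linarith) hC2)
  have hYge : (n:ℝ)/(2*C2) ≤ Y := by
    have h1 : (n:ℝ)/C2 < Y + 1 := Nat.lt_floor_add_one _
    have h2 : 1 ≤ (n:ℝ)/(2*C2) := by rw [one_le_div (by positivity)]; nlinarith
    have h3 : (n:ℝ)/C2 = 2*(n/(2*C2)) := by field_simp
    linarith
  obtain ⟨YY, hsub, hdif, hcard⟩ := horb n Y hn (by exact_mod_cast hYn) P hP T hT0 hT
  have hZT : Z*T^(2*tri K) = (n:ℝ)^ε*(n:ℝ)^(2*tri K) := by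
    rw [hZ, div_pow, mul_assoc, div_mul_cancel₀ _ (by positivity)]
  have hM : (Y:ℝ) ≤ YY.card * (C1*Z) := by
    have : (0:ℝ) < T^(2*tri K) := by positivity
    refine le_of_mul_le_mul_right ?_ this
    calc _ ≤ _ := hcard
      _ = YY.card * (C1 * ((n:ℝ)^ε*(n:ℝ)^(2*tri K))) := by ring
      _ = _ := by rw [← hZT]; ring
  have hM2 : (n:ℝ) ≤ YY.card * (2*C1*C2*Z) := by
    rw [div_le_iff₀ (by positivity)] at hYge
    nlinarith
  have hMge : 2 ≤ YY.card := by
    have : (2:ℝ) ≤ YY.card := by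
      by_contra hlt
      push Not at hlt
      have h0 : 0 < 2*C1*C2*Z := by positivity
      have : (n:ℝ) < 2*(2*C1*C2*Z) := by nlinarith
      have : 4*(C1*C2)*Z ≤ C*Z := by gcongr; linarith
      nlinarith
    exact_mod_cast this
  have hne : YY.Nonempty := Finset.card_pos.1 (by omega)
  set y0 := YY.max' hne with hy0
  have hy0m : y0 ∈ YY := Finset.max'_mem _ _
  have hle : ∀ y ∈ YY, y ≤ y0 := fun y hy => Finset.le_max' _ _ hy
  set DD := (YY.erase y0).image (fun y => y0 - y) with hDD
  have hcDD : DD.card = YY.card - 1 := by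
    rw [hDD, Finset.card_image_of_injOn, Finset.card_erase_of_mem hy0m]
    intro y hy y' hy' h
    have h1 := hle y (mem_of_mem_erase hy)
    have h2 := hle y' (mem_of_mem_erase hy')
    simp only at h; omega
  have hneDD : DD.Nonempty := Finset.card_pos.1 (by omega)
  set D := DD.max' hneDD with hD
  have hDm : D ∈ DD := Finset.max'_mem _ _
  have hmem : ∀ d ∈ DD, ∃ y ∈ YY, y ≠ y0 ∧ y0 = y + d := by
    intro d hd
    obtain ⟨y, hy, rfl⟩ := mem_image.1 hd
    have := hle y (mem_of_mem_erase hy)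
    exact ⟨y, mem_of_mem_erase hy, Finset.ne_of_mem_erase hy, by omega⟩
  have hd1 : ∀ d ∈ DD, 1 ≤ d ∧ d ≤ D := by
    intro d hd
    obtain ⟨y, hy, h1, h2⟩ := hmem d hd
    exact ⟨by omega, Finset.le_max' _ _ hd⟩
  have hy0Y : y0 < Y := mem_range.1 (hsub hy0m)
  have hDY : D ≤ Y := by obtain ⟨y, _, _, h⟩ := hmem D hDm; omega
  have hDYR : (D:ℝ) ≤ Y := by exact_mod_cast hDY
  set G := taylor (-(y0:ℝ)) P with hG
  have hGd : G.natDegree ≤ K+1 := by rw [hG, natDegree_taylor]; exact hP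
  obtain ⟨Q, hQ, hQd, hQa⟩ := hst n DD D G.coeff hn hDm hd1 (by
      calc C2*D ≤ C2*(n/C2) := by gcongr; exact hDYR.trans hYle
        _ = n := by field_simp) (by
    intro d hd i hi1 hi2
    obtain ⟨y, hy, h1, h2⟩ := hmem d hd
    obtain ⟨b, hb⟩ := hdif y hy y0 hy0m (i-1) (by omega)
    rw [show i-1+1 = i by omega] at hb
    refine ⟨b, ?_⟩
    rw [← tay_diff G hGd d i (by omega), hG, taylor_taylor]
    rw [show (d:ℝ) + -(y0:ℝ) = -(y:ℝ) by rw [h2]; push_cast; ring]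
    exact hb)
  have hQR : (1:ℝ) ≤ Q := by exact_mod_cast hQ
  have hDR : (1:ℝ) ≤ D := by exact_mod_cast (hd1 D hDm).1
  have hcQ := count_Q DD D c Q hQ hd1 hc hQd
  have hcQ2 : (Q:ℝ) * YY.card ≤ 2*c*D := by
    have : Q * YY.card ≤ 2*c*D := by
      have : Q * YY.card ≤ Q*(2*DD.card) := Nat.mul_le_mul_left _ (by omega)
      nlinarith
    exact_mod_cast this
  have hQn : (Q:ℝ)*n ≤ C3*Z*D := by
    calc (Q:ℝ)*n ≤ Q*(YY.card * (2*C1*C2*Z)) := by gcongr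
      _ = (Q*YY.card)*(2*C1*C2*Z) := by ring
      _ ≤ (2*c*D)*(2*C1*C2*Z) := by gcongr
      _ = _ := by rw [hC3]; ring
  refine ⟨Q, hQ, ?_, ?_⟩
  · have h1 : C3*Z*D ≤ C3*Z*n := mll (hDYR.trans hYn) (by positivity)
    have h2 : (Q:ℝ) ≤ C3*Z := le_of_mul_le_mul_right (hQn.trans h1) (by linarith)
    exact h2.trans (by gcongr)
  · intro j hj1 hj2
    have := tay_back P (K+1) n y0 Q hP hn (by have : Y ≤ n := by exact_mod_cast hYn
                                              omega) (E := C2*C3*Z/Q) (by positivity) (by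
      intro j hj1 hj2
      obtain ⟨a, ha⟩ := hQa j (by omega) hj2
      refine ⟨a, ha.trans ?_⟩
      rw [div_div, div_le_div_iff₀ (by positivity) (by positivity)]
      have : (n:ℝ)^j = (n:ℝ)^(j-1)*n := by rw [← pow_succ]; congr 1; omega
      rw [this]
      calc C2*(Q*((n:ℝ)^(j-1)*n)) = C2*(n:ℝ)^(j-1)*(Q*n) := by ring
        _ ≤ C2*(n:ℝ)^(j-1)*(C3*Z*D) := by gcongr
        _ = _ := by ring) j hj1 hj2
    obtain ⟨a, ha⟩ := this
    refine ⟨a, ha.trans (le_of_eq ?_)⟩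
    rw [hC]; push_cast; ring
end

noncomputable section
open Polynomial

def gm (k : ℕ) (β : ℕ → ℝ) (u : ℝ) : ℝ := ∑ j ∈ Icc 1 k, β j * u^j

def az (k : ℕ) (a : ℕ → ℤ) (u : ℤ) : ℤ := ∑ j ∈ Icc 1 k, a j * u^j

def mr (n Q r : ℕ) : ℕ := (n + Q - 1 - r)/Q

theorem mr_iff {n Q r z : ℕ} (hr : r < Q) : z < mr n Q r ↔ r + Q*z < n := by
  unfold mr
  rw [Nat.lt_iff_add_one_le, Nat.le_div_iff_mul_le (by omega)]
  have : (z+1)*Q = Q*z + Q := by ring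
  omega

theorem sum_res (n Q : ℕ) (hQ : 1 ≤ Q) (F : ℕ → ℂ) : ∑ i ∈ range n, F i =
    ∑ r ∈ range Q, ∑ z ∈ range (mr n Q r), F (r + Q*z) := by
  rw [Finset.sum_sigma']
  refine sum_nbij' (fun i => ⟨i % Q, i/Q⟩) (fun x => x.1 + Q*x.2) ?_ ?_ ?_ ?_ ?_
  · intro i hi
    simp only [Finset.mem_sigma, mem_range] at *
    have h := Nat.mod_lt i hQ
    exact ⟨h, (mr_iff h).2 (by rw [Nat.mod_add_div]; exact hi)⟩
  · rintro ⟨r, z⟩ h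
    simp only [Finset.mem_sigma, mem_range] at *
    exact (mr_iff h.1).1 h.2
  · intro i hi; exact Nat.mod_add_div i Q
  · rintro ⟨r, z⟩ h
    simp only [Finset.mem_sigma, mem_range] at *
    rw [Nat.add_mul_mod_self_left, Nat.mod_eq_of_lt h.1, Nat.add_mul_div_left _ _ hQ, Nat.div_eq_of_lt h.1, zero_add]
  · intro i hi; simp only [Nat.mod_add_div]

theorem az_per (k : ℕ) (a : ℕ → ℤ) {Q : ℕ} (hQ : 1 ≤ Q) (u v : ℤ) (t : ℝ) (h : (Q:ℤ) ∣ u - v) :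
    ex (t + (az k a u:ℝ)/Q) = ex (t + (az k a v:ℝ)/Q) := by
  have : (Q:ℤ) ∣ az k a u - az k a v := by
    unfold az
    rw [← sum_sub_distrib]
    refine Finset.dvd_sum fun j _ => ?_
    rw [← mul_sub]
    exact Dvd.dvd.mul_left (h.trans (sub_dvd_pow_sub_pow _ _ _)) _
  obtain ⟨c, hc⟩ := this
  have hc' : (az k a u:ℝ) = az k a v + Q*c := by
    have : az k a u = az k a v + Q*c := by linarith
    exact_mod_cast this
  have hQR : (0:ℝ) < Q := by exact_mod_cast hQ
  rw [show t + (az k a u:ℝ)/Q = (t + (az k a v:ℝ)/Q) + (c:ℤ) by rw [hc']; field_simp; ring, ex_add_int]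

theorem gm_lip (k n : ℕ) (hn : 1 ≤ n) (β : ℕ → ℝ) (V : ℝ) (hV : ∀ j ∈ Icc 1 k, |β j| ≤ V/(n:ℝ)^j) (u v : ℝ)
    (hu0 : 0 ≤ u) (hu : u ≤ 2*n) (hv0 : 0 ≤ v) (hv : v ≤ 2*n) :
    |gm k β u - gm k β v| ≤ k*(k*2^k)*V/n*|u-v| := by
  have hnR : (1:ℝ) ≤ n := by exact_mod_cast hn
  unfold gm
  rw [← sum_sub_distrib]
  calc _ ≤ ∑ j ∈ Icc 1 k, |β j * u^j - β j * v^j| := abs_sum_le_sum_abs _ _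
    _ ≤ ∑ j ∈ Icc 1 k, (k*2^k)*V/n*|u-v| := by
      refine sum_le_sum fun j hj => ?_
      have hjm := mem_Icc.1 hj
      have hV0 : 0 ≤ V/(n:ℝ)^j := (abs_nonneg _).trans (hV j hj)
      have hmx : max |u| |v| ≤ 2*n := max_le (by rw [abs_of_nonneg hu0]; exact hu) (by rw [abs_of_nonneg hv0]; exact hv)
      rw [← mul_sub, abs_mul]
      calc _ ≤ (V/(n:ℝ)^j) * (|u-v| * j*(2*n:ℝ)^(j-1)) := by
            refine mul_le_mul (hV j hj) ((abs_pow_sub_pow_le u v j).trans ?_) (abs_nonneg _) hV0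
            gcongr
        _ = (V/(n:ℝ)^j) * ((n:ℝ)^(j-1) * (|u-v| * (j*2^(j-1)))) := by rw [mul_pow]; ring
        _ ≤ (V/(n:ℝ)^j) * ((n:ℝ)^(j-1) * (|u-v| * (k*2^k))) := by
            gcongr
            · exact hjm.2
            · norm_num
            · omega
        _ = _ := by
            have : (n:ℝ)^j = (n:ℝ)^(j-1)*n := by rw [← pow_succ]; congr 1; omega
            rw [this]; field_simp
    _ = _ := by rw [sum_const, Nat.card_Icc, nsmul_eq_mul]; simp; ring

theorem eval_split (P : ℝ[X]) (k Q : ℕ) (hP : P.natDegree ≤ k) (hQ : 1 ≤ Q) (a : ℕ → ℤ) (β : ℕ → ℝ)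
    (hβ : ∀ j ∈ Icc 1 k, P.coeff j = a j/Q + β j) (u : ℤ) :
    P.eval (u:ℝ) = P.coeff 0 + (az k a u:ℝ)/Q + gm k β u := by
  have : range (k+1) = insert 0 (Icc 1 k) := by
    ext j; simp only [mem_insert, mem_Icc, mem_range]; omega
  rw [eval_eq_sum_range' (n := k+1) (by omega), this, sum_insert (by simp), pow_zero, mul_one, add_assoc]
  congr 1
  unfold az gm; push_cast
  rw [sum_div, ← sum_add_distrib]
  refine sum_congr rfl fun j hj => ?_
  rw [hβ j hj]; ring

theorem alpha1 (k n Q : ℕ) (hk : 1 ≤ k) (hQ : 1 ≤ Q) (hQn : Q ≤ n) (P : ℝ[X]) (hP : P.natDegree ≤ k) {E : ℝ} (hE : 0 ≤ E) (a : ℕ → ℤ)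
    (h : ∀ j, 1 < j → j ≤ k → |P.coeff j - a j/Q| ≤ E/(n:ℝ)^j) :
    ‖Wy P n‖ * |Q*P.coeff 1 - round (Q*P.coeff 1)| ≤ Q*(1 + 4*pi*(k*(k*2^k))*E) := by
  set δ := |Q*P.coeff 1 - round (Q*P.coeff 1)| with hδ
  have hnR : (1:ℝ) ≤ n := by exact_mod_cast hQ.trans hQn
  have hQR : (1:ℝ) ≤ Q := by exact_mod_cast hQ
  have hQnR : (Q:ℝ) ≤ n := by exact_mod_cast hQn
  set a' : ℕ → ℤ := fun j => if j = 1 then 0 else a j with ha'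
  set β' : ℕ → ℝ := fun j => P.coeff j - a' j/Q with hβ'
  set β : ℕ → ℝ := fun j => if j = 1 then 0 else P.coeff j - a j/Q with hβ
  have hg : ∀ u, gm k β' u = P.coeff 1 * u + gm k β u := by
    intro u
    unfold gm
    have : Icc 1 k = insert 1 (Ioc 1 k) := by
      ext j; simp only [mem_insert, mem_Icc, mem_Ioc]; omega
    rw [this, sum_insert (by simp), sum_insert (by simp)]
    simp only [hβ, hβ', ha', if_true]
    simp only [Int.cast_zero, zero_div, sub_zero, zero_mul, zero_add, pow_one]
    congr 1
    refine sum_congr rfl fun j hj => ?_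
    have hj1 : j ≠ 1 := by have := mem_Ioc.1 hj; omega
    rw [if_neg hj1, if_neg hj1]
  have hpi := pi_pos
  have hδ0 : 0 ≤ δ := abs_nonneg _
  rcases hδ0.eq_or_lt with h0 | hpos
  · rw [← h0]; simp; positivity
  rw [← le_div_iff₀ hpos, Wy_range, sum_res n Q hQ]
  calc _ ≤ ∑ r ∈ range Q, ‖∑ z ∈ range (mr n Q r), ex (P.eval ((1 + (r + Q*z):ℕ):ℝ))‖ := norm_sum_le _ _
    _ ≤ ∑ r ∈ range Q, (1/2/δ)*(1 + 4*pi*(k*(k*2^k))*E) := by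
      refine sum_le_sum fun r hr => ?_
      have hr := mem_range.1 hr
      have hm : mr n Q r * Q ≤ 2*n := by
        unfold mr; exact (Nat.div_mul_le_self _ _).trans (by omega)
      have hmR : (mr n Q r:ℝ) * Q ≤ 2*n := by exact_mod_cast hm
      have hu : ∀ z ≤ mr n Q r, 1 + (r + Q*z) ≤ 2*n := by
        intro z hz
        have : mr n Q r * Q ≤ n + Q - 1 - r := Nat.div_mul_le_self _ _
        have : z*Q ≤ mr n Q r * Q := Nat.mul_le_mul_right _ hz
        have : Q*z = z*Q := mul_comm _ _
        omega
      have e : ∀ z, ex (P.eval ((1 + (r + Q*z):ℕ):ℝ)) = ex (P.coeff 0 + P.coeff 1 * (1+r) + (az k a' (1+r:ℤ):ℝ)/Q) *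
          (ex (z*(Q*P.coeff 1)) * ex (gm k β ((1 + (r + Q*z):ℕ):ℝ))) := by
        intro z
        have h1 := eval_split P k Q hP hQ a' β' (fun j _ => by simp [hβ']) ((1 + (r + Q*z):ℕ):ℤ)
        rw [Int.cast_natCast] at h1
        rw [h1, hg, show P.coeff 0 + (az k a' ((1 + (r + Q*z):ℕ):ℤ):ℝ)/Q + (P.coeff 1 * ((1 + (r + Q*z):ℕ):ℝ) + gm k β ((1 + (r + Q*z):ℕ):ℝ)) =
          (P.coeff 0 + P.coeff 1 * (1+r) + (az k a' ((1 + (r + Q*z):ℕ):ℤ):ℝ)/Q) + (z*(Q*P.coeff 1) + gm k β ((1 + (r + Q*z):ℕ):ℝ)) by push_cast; ring,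
          ex_add, ex_add (z*(Q*P.coeff 1)), az_per k a' hQ _ (1+r:ℤ) _ ⟨z, by push_cast; ring⟩]
      simp_rw [e]
      rw [← mul_sum, norm_mul, norm_ex, one_mul]
      refine (abel_bd (fun z => ex (z*(Q*P.coeff 1))) (fun z => ex (gm k β ((1 + (r + Q*z):ℕ):ℝ))) (mr n Q r)
        (B := 1/2/δ) (V := 4*pi*(k*(k*2^k))*E) (by positivity) ?_ (norm_ex _).le ?_)
      · intro m _
        rw [le_div_iff₀ hpos]; exact geo_bd _ _
      · calc _ ≤ ∑ z ∈ range (mr n Q r), 2*pi*(k*(k*2^k)*E/n*Q) := by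
              refine sum_le_sum fun z hz => ?_
              have hz := mem_range.1 hz
              refine (ex_sub_le _ _).trans (mll ?_ (by positivity))
              refine (gm_lip k n (hQ.trans hQn) β E ?_ _ _ (by positivity) (by exact_mod_cast hu (z+1) (by omega)) (by positivity)
                (by exact_mod_cast hu z (by omega))).trans (le_of_eq ?_)
              · intro j hj
                have hj := mem_Icc.1 hj
                simp only [hβ]
                split_ifs with hj1
                · simp; positivity
                · exact h j (by omega) hj.2
              · congr 1; push_cast
                rw [show (1 + (r + Q*((z:ℝ)+1)) - (1 + (r+Q*z)) : ℝ) = Q by ring]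
                exact abs_of_nonneg (by positivity)
          _ = (mr n Q r * Q) * (2*pi*(k*(k*2^k)*E)/n) := by
              rw [sum_const, card_range, nsmul_eq_mul]; ring
          _ ≤ (2*n)*(2*pi*(k*(k*2^k)*E)/n) := by gcongr
          _ = _ := by field_simp; ring
    _ ≤ _ := by
      rw [sum_const, card_range, nsmul_eq_mul, mul_div_assoc]
      refine mll ?_ (by positivity)
      rw [div_div, div_mul_eq_mul_div, div_le_div_iff₀ (by positivity) hpos]
      have : 0 ≤ 4*pi*(k*(k*2^k))*E := by positivity
      nlinarith [mul_nonneg hpos.le this]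

theorem propB {K : ℕ} (hK : 1 ≤ K) {ε : ℝ} (hε : 0 < ε) : ∃ C : ℝ, 1 ≤ C ∧ ∀ (n : ℕ), 1 ≤ n → ∀ P : ℝ[X],
    P.natDegree ≤ K+1 → ∀ T : ℝ, 0 < T → T ≤ ‖Wy P n‖ → ∀ Z : ℝ, Z = (n:ℝ)^ε * ((n:ℝ)/T)^(2*tri K) → C*Z ≤ n →
    ∃ (Q : ℕ) (a : ℕ → ℤ), 1 ≤ Q ∧ (Q:ℝ) ≤ C*Z ∧ ∀ j ∈ Icc 1 (K+1), |P.coeff j - a j/Q| ≤ C*Z/Q*(n/T)/(n:ℝ)^j := by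
  obtain ⟨C, hC, H⟩ := propB0 hK hε
  have hpi := pi_pos
  set c := 4*pi*((K+1:ℕ)*((K+1:ℕ)*2^(K+1))) with hc
  have hc0 : 0 ≤ c := by positivity
  refine ⟨C*(1+c), one_lm hC (by linarith), ?_⟩
  intro n hn P hP T hT0 hT Z hZ hCZ
  have hnR : (1:ℝ) ≤ n := by exact_mod_cast hn
  have hTn : T ≤ n := hT.trans (Wy_le P n)
  have hZ0 : 0 < Z := by rw [hZ]; positivity
  have hCC : C*Z ≤ C*(1+c)*Z := by gcongr; exact le_mul_of_one_le_right (by linarith) (by linarith)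
  obtain ⟨Q, hQ, hQZ, hQa⟩ := H n hn P hP T hT0 hT Z hZ (hCC.trans hCZ)
  have hQR : (1:ℝ) ≤ Q := by exact_mod_cast hQ
  choose! a ha using hQa
  have h1 := alpha1 (K+1) n Q (by omega) hQ (by exact_mod_cast hQZ.trans (hCC.trans hCZ)) P hP (E := C*Z/Q) (by positivity) a ha
  have hnT : 1 ≤ n/T := (one_le_div hT0).2 hTn
  refine ⟨Q, fun j => if j = 1 then round (Q*P.coeff 1) else a j, hQ, hQZ.trans hCC, ?_⟩
  intro j hj
  have hj := mem_Icc.1 hj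
  by_cases hj1 : j = 1
  · subst hj1
    simp only [if_true, pow_one]
    rw [← hc] at h1
    have e : P.coeff 1 - (round (Q*P.coeff 1):ℝ)/Q = (Q*P.coeff 1 - round (Q*P.coeff 1))/Q := by field_simp
    rw [e, abs_div, abs_of_pos (show (0:ℝ) < Q by linarith)]
    have h2 : T * |Q*P.coeff 1 - round (Q*P.coeff 1)| ≤ C*(1+c)*Z := by
      calc _ ≤ ‖Wy P n‖ * |Q*P.coeff 1 - round (Q*P.coeff 1)| := by gcongr
        _ ≤ _ := h1
        _ = Q + c*(C*Z) := by field_simp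
        _ ≤ _ := by nlinarith
    rw [show C*(1+c)*Z/Q*(n/T)/n = (C*(1+c)*Z/T)/Q by field_simp]
    gcongr
    rw [le_div_iff₀ hT0, mul_comm]; exact h2
  · simp only [if_neg hj1]
    refine (ha j (by omega) hj.2).trans ?_
    gcongr
    calc C*Z/Q ≤ C*(1+c)*Z/Q := by gcongr
      _ ≤ _ := le_mul_of_one_le_right (by positivity) hnT
end

noncomputable section
open Polynomial

theorem ex_cont : Continuous ex := by unfold ex; fun_prop
theorem gm_cont (k : ℕ) (β : ℕ → ℝ) : Continuous (gm k β) := by unfold gm; fun_prop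

def Io (k : ℕ) (β : ℕ → ℝ) (n : ℝ) : ℂ := ∫ t in (0:ℝ)..n, ex (gm k β t)

theorem sum_int (k n Q r : ℕ) (hQ : 1 ≤ Q) (hQn : Q ≤ n) (hr : r < Q) (β : ℕ → ℝ) (V : ℝ) (hV0 : 0 ≤ V)
    (hV : ∀ j ∈ Icc 1 k, |β j| ≤ V/(n:ℝ)^j) :
    ‖Q * ∑ z ∈ range (mr n Q r), ex (gm k β ((1 + (r + Q*z):ℕ):ℝ)) - Io k β n‖ ≤ Q*(2+4*pi*(k*(k*2^k))*V) := by
  set F : ℝ → ℂ := fun t => ex (gm k β t) with hF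
  have hFc : Continuous F := ex_cont.comp (gm_cont k β)
  have hFi : ∀ a b, IntervalIntegrable F MeasureTheory.volume a b := fun a b => hFc.intervalIntegrable a b
  have hnR : (1:ℝ) ≤ n := by exact_mod_cast hQ.trans hQn
  have hQR : (1:ℝ) ≤ Q := by exact_mod_cast hQ
  set m := mr n Q r with hm
  have hpi := pi_pos
  set u : ℕ → ℝ := fun z => ((1 + (r + Q*z):ℕ):ℝ) with hu
  set L := k*(k*2^k)*V/n with hL
  have hL0 : 0 ≤ L := by positivity
  have hmQ : m*Q ≤ n + Q - 1 - r := Nat.div_mul_le_self _ _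
  have hmQ' : n ≤ r + Q*m := by
    by_contra hlt; exact lt_irrefl _ ((mr_iff hr).2 (not_le.1 hlt))
  have hmm : Q*m = m*Q := mul_comm _ _
  have hu2 : ∀ z ≤ m, u z ≤ 2*n := by
    intro z hz
    have : z*Q ≤ m*Q := Nat.mul_le_mul_right _ hz
    have h2 : Q*z = z*Q := mul_comm _ _
    have : 1 + (r + Q*z) ≤ 2*n := by omega
    simp only [hu]; exact_mod_cast this
  have hu0 : ∀ z, 0 ≤ u z := fun z => by simp only [hu]; positivity
  have hstep : ∀ z, u (z+1) - u z = Q := fun z => by simp only [hu]; push_cast; ring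
  have hsum : ∑ z ∈ range m, ∫ t in (u z)..(u (z+1)), F t = ∫ t in (u 0)..(u m), F t :=
    intervalIntegral.sum_integral_adjacent_intervals (fun z _ => hFi _ _)
  have hFle : ∀ t, ‖F t‖ ≤ 1 := fun t => (norm_ex _).le
  have hpiece : ∀ z ∈ range m, ‖Q * F (u z) - ∫ t in (u z)..(u (z+1)), F t‖ ≤ 2*pi*(L*Q)*Q := by
    intro z hz
    have hz := mem_range.1 hz
    have e : (Q:ℂ) * F (u z) = ∫ t in (u z)..(u (z+1)), F (u z) := by
      rw [intervalIntegral.integral_const, hstep]; simp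
    rw [e, ← intervalIntegral.integral_sub (by simp) (hFi _ _)]
    have := intervalIntegral.norm_integral_le_of_norm_le_const (a := u z) (b := u (z+1)) (f := fun t => F (u z) - F t)
      (C := 2*pi*(L*Q)) (by
        intro t ht
        rw [Set.uIoc_of_le (by have := hstep z; linarith)] at ht
        refine (ex_sub_le _ _).trans (mll ?_ (by positivity))
        refine (gm_lip k n (hQ.trans hQn) β V hV _ _ (hu0 z) (hu2 z (by omega)) (by linarith [hu0 z, ht.1]) (ht.2.trans (hu2 (z+1) (by omega)))).trans ?_
        rw [← hL]
        refine mll ?_ hL0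
        rw [abs_sub_comm, abs_of_pos (by linarith [ht.1])]
        linarith [hstep z, ht.2])
    rw [hstep, abs_of_pos (show (0:ℝ) < Q by linarith)] at this
    exact this
  have hI : Io k β n = (∫ t in (0:ℝ)..(u 0), F t) + (∫ t in (u 0)..(u m), F t) - ∫ t in (n:ℝ)..(u m), F t := by
    rw [intervalIntegral.integral_add_adjacent_intervals (hFi _ _) (hFi _ _),
      ← intervalIntegral.integral_add_adjacent_intervals (hFi 0 n) (hFi n (u m)), add_sub_cancel_right]; rfl
  have hE1 : ‖∫ t in (0:ℝ)..(u 0), F t‖ ≤ Q := by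
    refine (intervalIntegral.norm_integral_le_of_norm_le_const (C := 1) (fun t _ => hFle t)).trans ?_
    rw [one_mul, sub_zero, abs_of_nonneg (hu0 0)]
    simp only [hu]; exact_mod_cast (by omega)
  have hE2 : ‖∫ t in (n:ℝ)..(u m), F t‖ ≤ Q := by
    refine (intervalIntegral.norm_integral_le_of_norm_le_const (C := 1) (fun t _ => hFle t)).trans ?_
    have h1 : (n:ℝ) ≤ u m := by simp only [hu]; exact_mod_cast (by omega)
    have h2 : u m ≤ n + Q := by simp only [hu]; exact_mod_cast (by omega)
    rw [one_mul, abs_of_nonneg (by linarith)]; linarith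
  have hmR : (m:ℝ)*Q ≤ 2*n := by exact_mod_cast (show m*Q ≤ 2*n by omega)
  calc _ = ‖∑ z ∈ range m, (Q * F (u z) - ∫ t in (u z)..(u (z+1)), F t) - (∫ t in (0:ℝ)..(u 0), F t) + ∫ t in (n:ℝ)..(u m), F t‖ := by
        rw [hI, sum_sub_distrib, hsum, mul_sum]; congr 1; ring
    _ ≤ (∑ z ∈ range m, 2*pi*(L*Q)*Q) + Q + Q := by
        refine (norm_add_le _ _).trans (add_le_add ((norm_sub_le _ _).trans (add_le_add ?_ hE1)) hE2)
        exact (norm_sum_le _ _).trans (sum_le_sum hpiece)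
    _ = (m*Q)*(2*pi*(L*Q)) + 2*Q := by rw [sum_const, card_range, nsmul_eq_mul]; ring
    _ ≤ (2*n)*(2*pi*(L*Q)) + 2*Q := by gcongr
    _ = _ := by rw [hL]; field_simp; ring

def Sq (k : ℕ) (a : ℕ → ℤ) (Q : ℕ) : ℂ := ∑ r ∈ range Q, ex ((az k a (1+r:ℤ):ℝ)/Q)

theorem major (k n Q : ℕ) (hQ : 1 ≤ Q) (hQn : Q ≤ n) (P : ℝ[X]) (hP : P.natDegree ≤ k) (a : ℕ → ℤ) (β : ℕ → ℝ) (V : ℝ) (hV0 : 0 ≤ V)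
    (hβ : ∀ j ∈ Icc 1 k, P.coeff j = a j/Q + β j)
    (hV : ∀ j ∈ Icc 1 k, |β j| ≤ V/(n:ℝ)^j) :
    Q * ‖Wy P n‖ ≤ ‖Sq k a Q‖ * ‖Io k β n‖ + Q*(Q*(2+4*pi*(k*(k*2^k))*V)) := by
  have key : Q * Wy P n - ex (P.coeff 0) * (Sq k a Q * Io k β n) = ∑ r ∈ range Q, ex (P.coeff 0 + (az k a (1+r:ℤ):ℝ)/Q) *
      (Q * ∑ z ∈ range (mr n Q r), ex (gm k β ((1 + (r + Q*z):ℕ):ℝ)) - Io k β n) := by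
    rw [Wy_range, sum_res n Q hQ]
    simp_rw [mul_sub]
    rw [sum_sub_distrib, mul_sum]
    congr 1
    · refine sum_congr rfl fun r _ => ?_
      rw [mul_left_comm]; congr 1
      rw [mul_sum]
      refine sum_congr rfl fun z _ => ?_
      have h1 := eval_split P k Q hP hQ a β hβ ((1 + (r + Q*z):ℕ):ℤ)
      rw [Int.cast_natCast] at h1
      rw [h1, ex_add, az_per k a hQ _ (1+r:ℤ) _ ⟨z, by push_cast; ring⟩]
    · unfold Sq
      rw [← sum_mul, ← mul_assoc, mul_sum]
      simp_rw [ex_add]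
  have h2 : ‖Q * Wy P n - ex (P.coeff 0) * (Sq k a Q * Io k β n)‖ ≤ Q*(Q*(2+4*pi*(k*(k*2^k))*V)) := by
    rw [key]
    calc _ ≤ ∑ r ∈ range Q, Q*(2+4*pi*(k*(k*2^k))*V) := by
          refine (norm_sum_le _ _).trans (sum_le_sum fun r hr => ?_)
          rw [norm_mul, norm_ex, one_mul]
          exact sum_int k n Q r hQ hQn (mem_range.1 hr) β V hV0 hV
      _ = _ := by rw [sum_const, card_range, nsmul_eq_mul]
  calc (Q:ℝ) * ‖Wy P n‖ = ‖Q * Wy P n‖ := by rw [norm_mul]; simp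
    _ = ‖ex (P.coeff 0) * (Sq k a Q * Io k β n) + (Q * Wy P n - ex (P.coeff 0) * (Sq k a Q * Io k β n))‖ := by congr 1; ring
    _ ≤ _ := (norm_add_le _ _).trans (add_le_add (by rw [norm_mul, norm_mul, norm_ex, one_mul]) h2)
end

noncomputable section
open Polynomial

theorem hasDeriv_ex (G : ℝ[X]) (t : ℝ) : HasDerivAt (fun t => ex (G.eval t)) (2*(pi:ℂ)*Complex.I*((G.derivative.eval t:ℝ):ℂ) * ex (G.eval t)) t := by
  have h1 : HasDerivAt (fun t : ℝ => ((G.eval t:ℝ):ℂ)) ((G.derivative.eval t:ℝ):ℂ) t := (G.hasDerivAt t).ofReal_comp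
  have h2 := (h1.const_mul (2*(pi:ℂ)*Complex.I)).cexp
  unfold ex
  convert h2 using 1; ring

theorem psign (p : ℝ[X]) (a b : ℝ) (h : ∀ t ∈ Set.Ioo a b, t ∉ p.roots) (hab : a < b) :
    (∀ t ∈ Set.Icc a b, 0 ≤ p.eval t) ∨ (∀ t ∈ Set.Icc a b, p.eval t ≤ 0) := by
  rcases eq_or_ne p 0 with rfl | hp
  · left; simp
  have hne : ∀ t ∈ Set.Ioo a b, p.eval t ≠ 0 := fun t ht h0 => h t ht ((mem_roots hp).2 h0)
  have hcl : ∀ (f : ℝ → ℝ), Continuous f → (∀ t ∈ Set.Ioo a b, 0 ≤ f t) → ∀ t ∈ Set.Icc a b, 0 ≤ f t := by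
    intro f hf h0 t ht
    rw [← closure_Ioo hab.ne] at ht
    exact closure_minimal (s := Set.Ioo a b) (t := {t | 0 ≤ f t}) h0 (isClosed_le continuous_const hf) ht
  by_contra hcon
  push Not at hcon
  obtain ⟨⟨x, hx, hx0⟩, ⟨y, hy, hy0⟩⟩ := hcon
  have hA : ∃ x ∈ Set.Ioo a b, p.eval x < 0 := by
    by_contra hc; push Not at hc
    exact absurd (hcl _ p.continuous hc x hx) (not_le.2 hx0)
  have hB : ∃ y ∈ Set.Ioo a b, 0 < p.eval y := by
    by_contra hc; push Not at hc
    have := hcl (fun t => -p.eval t) p.continuous.neg (fun t ht => by have := hc t ht; linarith) y hy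
    linarith
  obtain ⟨x, hx, hx0⟩ := hA
  obtain ⟨y, hy, hy0⟩ := hB
  have := isPreconnected_Ioo.intermediate_value hx hy p.continuous.continuousOn ⟨hx0.le, hy0.le⟩
  obtain ⟨z, hz, hz0⟩ := this
  exact hne z hz hz0

theorem ibp (G : ℝ[X]) (a b l : ℝ) (hab : a ≤ b) (hl : 0 < l) (h1 : ∀ t ∈ Set.Icc a b, l ≤ |G.derivative.eval t|)
    (h2 : (∀ t ∈ Set.Icc a b, 0 ≤ G.derivative.derivative.eval t) ∨ (∀ t ∈ Set.Icc a b, G.derivative.derivative.eval t ≤ 0)) :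
    ‖∫ t in a..b, ex (G.eval t)‖ ≤ 1/l := by
  set g1 := G.derivative with hg1
  set g2 := g1.derivative with hg2
  have hne : ∀ t ∈ Set.Icc a b, g1.eval t ≠ 0 := fun t ht h => by have := h1 t ht; rw [h] at this; simp at this; linarith
  have hpi := Real.pi_gt_three
  set u : ℝ → ℝ := fun t => (g1.eval t)⁻¹ with hu
  set u' : ℝ → ℝ := fun t => -(g2.eval t)/(g1.eval t)^2 with hu'
  set v : ℝ → ℂ := fun t => ex (G.eval t) with hv
  set v' : ℝ → ℂ := fun t => 2*(pi:ℂ)*Complex.I*((g1.eval t:ℝ):ℂ) * ex (G.eval t) with hv'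
  have hvc : Continuous v := ex_cont.comp G.continuous
  have hdu : ∀ t ∈ Set.uIcc a b, HasDerivAt u (u' t) t := by
    intro t ht
    rw [Set.uIcc_of_le hab] at ht
    exact (g1.hasDerivAt t).inv (hne t ht)
  have hu'c : ContinuousOn u' (Set.uIcc a b) := by
    rw [Set.uIcc_of_le hab]
    exact (g2.continuous.neg.continuousOn).div ((g1.continuous.pow 2).continuousOn) (fun t ht => pow_ne_zero _ (hne t ht))
  have hv'c : Continuous v' := (continuous_const.mul (Complex.continuous_ofReal.comp g1.continuous)).mul hvc
  have hu'i : IntervalIntegrable u' MeasureTheory.volume a b := hu'c.intervalIntegrable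
  have hub : ∀ t ∈ Set.Icc a b, |u t| ≤ 1/l := by
    intro t ht
    simp only [hu]
    rw [abs_inv, one_div]
    exact inv_anti₀ hl (h1 t ht)
  have ha : a ∈ Set.Icc a b := ⟨le_rfl, hab⟩
  have hb : b ∈ Set.Icc a b := ⟨hab, le_rfl⟩
  have hftc : ∫ t in a..b, u' t = u b - u a := intervalIntegral.integral_eq_sub_of_hasDerivAt hdu hu'i
  have hint := intervalIntegral.integral_mul_deriv_eq_deriv_mul (u := fun t => ((u t:ℝ):ℂ)) (v := v) (u' := fun t => ((u' t:ℝ):ℂ)) (v' := v')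
    (fun t ht => (hdu t ht).ofReal_comp) (fun t _ => hasDeriv_ex G t)
    ((Complex.continuous_ofReal.comp_continuousOn hu'c).intervalIntegrable) (hv'c.intervalIntegrable a b)
  have e1 : ∫ t in a..b, ((u t:ℝ):ℂ) * v' t = 2*(pi:ℂ)*Complex.I * ∫ t in a..b, ex (G.eval t) := by
    rw [← intervalIntegral.integral_const_mul]
    refine intervalIntegral.integral_congr fun t ht => ?_
    rw [Set.uIcc_of_le hab] at ht
    have : ((g1.eval t:ℝ):ℂ) ≠ 0 := by exact_mod_cast hne t ht
    simp only [hu, hv']; push_cast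
    field_simp
  have e2 : ‖∫ t in a..b, ((u' t:ℝ):ℂ) * v t‖ ≤ 2/l := by
    have h3 : ‖∫ t in a..b, ((u' t:ℝ):ℂ) * v t‖ ≤ ∫ t in a..b, |u' t| := by
      refine (intervalIntegral.norm_integral_le_integral_norm hab).trans (le_of_eq ?_)
      refine intervalIntegral.integral_congr fun t _ => ?_
      simp only [norm_mul, hv, norm_ex, mul_one, Complex.norm_real, Real.norm_eq_abs]
    refine h3.trans ?_
    have h4 : ∫ t in a..b, |u' t| ≤ |u b - u a| := by
      rcases h2 with h2 | h2
      · have : ∫ t in a..b, |u' t| = ∫ t in a..b, -(u' t) := by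
          refine intervalIntegral.integral_congr fun t ht => ?_
          rw [Set.uIcc_of_le hab] at ht
          refine abs_of_nonpos ?_
          exact div_nonpos_of_nonpos_of_nonneg (by linarith [h2 t ht]) (by positivity)
        rw [this, intervalIntegral.integral_neg, hftc]; exact neg_le_abs _
      · have : ∫ t in a..b, |u' t| = ∫ t in a..b, (u' t) := by
          refine intervalIntegral.integral_congr fun t ht => ?_
          rw [Set.uIcc_of_le hab] at ht
          refine abs_of_nonneg ?_
          exact div_nonneg (by linarith [h2 t ht]) (by positivity)
        rw [this, hftc]; exact le_abs_self _
    refine h4.trans ((abs_sub _ _).trans ?_)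
    have := hub a ha; have := hub b hb
    rw [show 2/l = 1/l+1/l by ring]; linarith
  have e3 : ‖2*(pi:ℂ)*Complex.I * ∫ t in a..b, ex (G.eval t)‖ = 2*pi*‖∫ t in a..b, ex (G.eval t)‖ := by
    simp [abs_of_pos pi_pos]
  have e4 : 2*pi*‖∫ t in a..b, ex (G.eval t)‖ ≤ 1/l + 1/l + 2/l := by
    rw [← e3, ← e1, hint]
    refine (norm_sub_le _ _).trans (add_le_add ((norm_sub_le _ _).trans (add_le_add ?_ ?_)) e2)
    · simp only [norm_mul, hv, norm_ex, mul_one, Complex.norm_real, Real.norm_eq_abs]; exact hub b hb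
    · simp only [norm_mul, hv, norm_ex, mul_one, Complex.norm_real, Real.norm_eq_abs]; exact hub a ha
  have h6 : 6*‖∫ t in a..b, ex (G.eval t)‖ ≤ 2*pi*‖∫ t in a..b, ex (G.eval t)‖ := by gcongr; linarith
  have : 1/l + 1/l + 2/l = 4*(1/l) := by ring
  have h0 : 0 < 1/l := by positivity
  linarith

open MeasureTheory in
theorem split_int (G : ℝ[X]) (l : ℝ) (hl : 0 < l) (R : Finset ℝ)
    (hR : ∀ t, t ∈ (G.derivative - C l).roots ∨ t ∈ (G.derivative + C l).roots ∨ t ∈ G.derivative.derivative.roots → t ∈ R) :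
    ∀ N : ℕ, ∀ a b : ℝ, a < b → (R.filter (fun t => t ∈ Set.Ioo a b)).card ≤ N →
    ‖∫ t in a..b, ex (G.eval t)‖ ≤ volume.real ({t | |G.derivative.eval t| ≤ l} ∩ Set.Ioc a b) + (N+1)*(1/l) := by
  have hmE : MeasurableSet {t | |G.derivative.eval t| ≤ l} :=
    (isClosed_le (G.derivative.continuous.abs) continuous_const).measurableSet
  have hi : ∀ a b, IntervalIntegrable (fun t => ex (G.eval t)) volume a b := fun a b => (ex_cont.comp G.continuous).intervalIntegrable a b
  have hfin : ∀ a b, volume ({t | |G.derivative.eval t| ≤ l} ∩ Set.Ioc a b) ≠ ⊤ := fun a b =>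
    ((measure_mono Set.inter_subset_right).trans_lt measure_Ioc_lt_top).ne
  have hl1 : 0 < 1/l := by positivity
  intro N
  induction N using Nat.strong_induction_on with
  | _ N ih =>
  intro a b hab hN
  rcases (R.filter (fun t => t ∈ Set.Ioo a b)).eq_empty_or_nonempty with hemp | ⟨c, hc⟩
  · have hno : ∀ t ∈ Set.Ioo a b, t ∉ R := by
      intro t ht htR
      have : t ∈ R.filter (fun t => t ∈ Set.Ioo a b) := mem_filter.2 ⟨htR, ht⟩
      rw [hemp] at this; simp at this
    have s1 := psign (G.derivative - C l) a b (fun t ht h => hno t ht (hR t (Or.inl h))) hab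
    have s2 := psign (G.derivative + C l) a b (fun t ht h => hno t ht (hR t (Or.inr (Or.inl h)))) hab
    have s3 := psign G.derivative.derivative a b (fun t ht h => hno t ht (hR t (Or.inr (Or.inr h)))) hab
    simp only [eval_sub, eval_add, eval_C] at s1 s2
    have big : (∀ t ∈ Set.Icc a b, l ≤ |G.derivative.eval t|) → ‖∫ t in a..b, ex (G.eval t)‖ ≤ volume.real ({t | |G.derivative.eval t| ≤ l} ∩ Set.Ioc a b) + (N+1)*(1/l) := by
      intro h
      have h1 := ibp G a b l hab.le hl h s3
      have : 0 ≤ (N:ℝ)*(1/l) := by positivity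
      have : 0 ≤ volume.real ({t | |G.derivative.eval t| ≤ l} ∩ Set.Ioc a b) := measureReal_nonneg
      linarith
    rcases s1 with s1 | s1
    · exact big fun t ht => le_trans (by linarith [s1 t ht]) (le_abs_self _)
    rcases s2 with s2 | s2
    · have hsub : {t | |G.derivative.eval t| ≤ l} ∩ Set.Ioc a b = Set.Ioc a b := by
        refine Set.inter_eq_right.2 fun t ht => ?_
        have ht' : t ∈ Set.Icc a b := ⟨ht.1.le, ht.2⟩
        have q1 := s1 t ht'
        have q2 := s2 t ht'
        show |G.derivative.eval t| ≤ l
        exact abs_le.2 ⟨by linarith, by linarith⟩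
      rw [hsub, Real.volume_real_Ioc_of_le hab.le]
      have := intervalIntegral.norm_integral_le_of_norm_le_const (a := a) (b := b) (f := fun t => ex (G.eval t)) (C := 1) (fun t _ => (norm_ex _).le)
      rw [one_mul, abs_of_pos (by linarith)] at this
      have : 0 ≤ ((N:ℝ)+1)*(1/l) := by positivity
      linarith
    · exact big fun t ht => le_trans (by linarith [s2 t ht]) (neg_le_abs _)
  · obtain ⟨hcR, hc1, hc2⟩ := mem_filter.1 hc
    set N1 := (R.filter (fun t => t ∈ Set.Ioo a c)).card with hN1
    set N2 := (R.filter (fun t => t ∈ Set.Ioo c b)).card with hN2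
    have hcard : N1 + N2 + 1 ≤ N := by
      have hd : Disjoint (R.filter (fun t => t ∈ Set.Ioo a c)) (R.filter (fun t => t ∈ Set.Ioo c b)) := by
        rw [Finset.disjoint_left]; intro t h1 h2
        exact lt_asymm (mem_filter.1 h1).2.2 (mem_filter.1 h2).2.1
      have hnc : c ∉ (R.filter (fun t => t ∈ Set.Ioo a c)) ∪ (R.filter (fun t => t ∈ Set.Ioo c b)) := by
        simp
      have := card_le_card (s := insert c ((R.filter (fun t => t ∈ Set.Ioo a c)) ∪ (R.filter (fun t => t ∈ Set.Ioo c b))))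
        (t := R.filter (fun t => t ∈ Set.Ioo a b)) (by
          intro t ht
          simp only [mem_insert, Finset.mem_union, mem_filter, Set.mem_Ioo] at ht ⊢
          rcases ht with rfl | ht | ht
          · exact ⟨hcR, hc1, hc2⟩
          · exact ⟨ht.1, ht.2.1, ht.2.2.trans hc2⟩
          · exact ⟨ht.1, hc1.trans ht.2.1, ht.2.2⟩)
      rw [Finset.card_insert_of_notMem hnc, Finset.card_union_of_disjoint hd] at this
      omega
    have i1 := ih N1 (by omega) a c hc1 le_rfl
    have i2 := ih N2 (by omega) c b hc2 le_rfl
    rw [← intervalIntegral.integral_add_adjacent_intervals (hi a c) (hi c b)]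
    have hu : {t | |G.derivative.eval t| ≤ l} ∩ Set.Ioc a b = ({t | |G.derivative.eval t| ≤ l} ∩ Set.Ioc a c) ∪ ({t | |G.derivative.eval t| ≤ l} ∩ Set.Ioc c b) := by
      rw [← Set.inter_union_distrib_left, Set.Ioc_union_Ioc_eq_Ioc hc1.le hc2.le]
    rw [hu, measureReal_union ((Set.Ioc_disjoint_Ioc_of_le le_rfl).mono Set.inter_subset_right Set.inter_subset_right) (hmE.inter measurableSet_Ioc) (hfin _ _) (hfin _ _)]
    refine (norm_add_le _ _).trans ?_
    have : ((N1:ℝ)+N2+1) ≤ N := by exact_mod_cast hcard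
    nlinarith
end

noncomputable section
open Polynomial

open MeasureTheory in
theorem greedy (E : Set ℝ) (d : ℕ) (r : ℝ) (hr : 0 < r) (hm : 2*r*d < volume.real E) :
    ∀ i ≤ d+1, ∃ s : Finset ℝ, (↑s ⊆ E) ∧ s.card = i ∧ ∀ x ∈ s, ∀ y ∈ s, x ≠ y → r ≤ |x-y| := by
  intro i
  induction i with
  | zero => intro _; exact ⟨∅, by simp, rfl, by simp⟩
  | succ i ih =>
    intro hi
    obtain ⟨s, hsE, hsc, hs⟩ := ih (by omega)
    have : ∃ y ∈ E, ∀ x ∈ s, y ∉ Set.Ioo (x-r) (x+r) := by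
      by_contra hcon
      push Not at hcon
      have hsub : E ⊆ ⋃ x ∈ s, Set.Ioo (x-r) (x+r) := by
        intro y hy
        obtain ⟨x, hx, hxy⟩ := hcon y hy
        exact Set.mem_biUnion hx hxy
      have h1 : volume.real E ≤ volume.real (⋃ x ∈ s, Set.Ioo (x-r) (x+r)) :=
        measureReal_mono hsub ((measure_biUnion_lt_top s.finite_toSet (fun x _ => measure_Ioo_lt_top)).ne)
      have h2 := measureReal_biUnion_finset_le (μ := (volume : Measure ℝ)) s (fun x => Set.Ioo (x-r) (x+r))
      have h3 : ∑ x ∈ s, volume.real (Set.Ioo (x-r) (x+r)) = i*(2*r) := by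
        rw [sum_congr rfl (g := fun _ => 2*r) (fun x _ => by rw [Real.volume_real_Ioo_of_le (by linarith)]; ring),
          sum_const, hsc, nsmul_eq_mul]
      have h4 : (i:ℝ) ≤ d := by exact_mod_cast (by omega)
      nlinarith
    obtain ⟨y, hy, hys⟩ := this
    have hyr : ∀ x ∈ s, r ≤ |x-y| := by
      intro x hx
      by_contra hlt; push Not at hlt
      rw [abs_lt] at hlt
      exact hys x hx ⟨by linarith, by linarith⟩
    have hyn : y ∉ s := fun h => by have := hyr y h; simp at this; linarith
    refine ⟨insert y s, ?_, by rw [Finset.card_insert_of_notMem hyn, hsc], ?_⟩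
    · rw [Finset.coe_insert, Set.insert_subset_iff]; exact ⟨hy, hsE⟩
    · intro x hx z hz hxz
      rcases mem_insert.1 hx with rfl | hx2 <;> rcases mem_insert.1 hz with rfl | hz2
      · exact absurd rfl hxz
      · rw [abs_sub_comm]; exact hyr z hz2
      · exact hyr x hx2
      · exact hs x hx2 z hz2 hxz

theorem prod_coeff (s : Finset ℝ) (c : ℝ → ℝ) (M : ℝ) (hM : 0 ≤ M) (hc : ∀ x ∈ s, |c x| ≤ M) (hx : ∀ x ∈ s, |x| ≤ 1) :
    ∀ i, |(∏ x ∈ s, (C (c x) * (X - C x))).coeff i| ≤ (2*M)^s.card := by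
  classical
  induction s using Finset.induction_on with
  | empty => intro i; simp [coeff_one]; split_ifs <;> simp
  | insert y s hy ih =>
    intro i
    have ih' := ih (fun x h => hc x (Finset.mem_insert_of_mem h)) (fun x h => hx x (Finset.mem_insert_of_mem h))
    rw [Finset.prod_insert hy, Finset.card_insert_of_notMem hy, mul_assoc, coeff_C_mul, sub_mul, coeff_sub, coeff_C_mul, abs_mul, pow_succ']
    have h1 : |(X * ∏ x ∈ s, (C (c x) * (X - C x))).coeff i| ≤ (2*M)^s.card := by
      cases i with
      | zero => simp; positivity
      | succ i => rw [coeff_X_mul]; exact ih' i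
    have h2 : |y * (∏ x ∈ s, (C (c x) * (X - C x))).coeff i| ≤ (2*M)^s.card := by
      rw [abs_mul]
      exact (mul_le_of_le_one_left (abs_nonneg _) (hx y (Finset.mem_insert_self _ _))).trans (ih' i)
    calc _ ≤ M * ((2*M)^s.card + (2*M)^s.card) :=
          mul_le_mul (hc y (Finset.mem_insert_self _ _)) ((abs_sub _ _).trans (add_le_add h1 h2)) (abs_nonneg _) hM
      _ = _ := by ring

open MeasureTheory in
theorem sublevel (h : ℝ[X]) (d : ℕ) (hd : 1 ≤ d) (hh : h.natDegree ≤ d) (l : ℝ) (hl : 0 < l) (i : ℕ) :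
    (volume.real ({t | |h.eval t| ≤ l} ∩ Set.Ioc 0 1))^d * |h.coeff i| ≤ (d+1)*(2*(2*d+1))^d * l := by
  classical
  set m := volume.real ({t | |h.eval t| ≤ l} ∩ Set.Ioc 0 1) with hm
  have hm0 : 0 ≤ m := measureReal_nonneg
  rcases hm0.eq_or_lt with h0 | hpos
  · rw [← h0, zero_pow (by omega), zero_mul]; positivity
  set r := m/(2*d+1) with hr
  have hr0 : 0 < r := by positivity
  obtain ⟨s, hsE, hsc, hs⟩ := greedy ({t | |h.eval t| ≤ l} ∩ Set.Ioc 0 1) d r hr0 (by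
    rw [← hm, hr, mul_div_assoc', div_mul_eq_mul_div, div_lt_iff₀ (by positivity)]; nlinarith) (d+1) le_rfl
  have hdeg : h.degree < s.card := by
    rw [hsc]; exact (degree_le_natDegree).trans_lt (by exact_mod_cast (by omega))
  have hint := Lagrange.eq_interpolate (s := s) (v := id) (Set.injOn_id _) hdeg
  have hx1 : ∀ x ∈ s, |x| ≤ 1 := fun x hx => by
    have := (hsE hx).2; rw [abs_of_pos this.1]; exact this.2
  have hco : |h.coeff i| ≤ ∑ x ∈ s, l * (2*(1/r))^d := by
    conv_lhs => rw [hint]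
    rw [Lagrange.interpolate_apply, finset_sum_coeff]
    refine (abs_sum_le_sum_abs _ _).trans (sum_le_sum fun x hx => ?_)
    rw [coeff_C_mul, abs_mul]
    refine mul_le_mul (hsE hx).1 ?_ (abs_nonneg _) hl.le
    have := prod_coeff (s.erase x) (fun y => (x-y)⁻¹) (1/r) (by positivity) (by
      intro y hy
      rw [abs_inv, one_div]
      exact inv_anti₀ hr0 (hs x hx y (mem_of_mem_erase hy) (Finset.ne_of_mem_erase hy).symm))
      (fun y hy => hx1 y (mem_of_mem_erase hy)) i
    rw [Finset.card_erase_of_mem hx, hsc, Nat.add_sub_cancel] at this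
    exact this
  rw [sum_const, hsc, nsmul_eq_mul] at hco
  calc m^d * |h.coeff i| ≤ m^d * (((d+1:ℕ):ℝ) * (l * (2*(1/r))^d)) := by gcongr
    _ = ((d:ℝ)+1) * l * (m * (2*(1/r)))^d := by rw [mul_pow]; push_cast; ring
    _ = _ := by
      rw [show m * (2*(1/r)) = 2*(2*d+1) by rw [hr]; field_simp]; ring

theorem osc (k : ℕ) (hk : 2 ≤ k) : ∃ C : ℝ, 1 ≤ C ∧ ∀ G : ℝ[X], G.natDegree ≤ k → ∀ j, 1 ≤ j →
    ‖∫ t in (0:ℝ)..1, ex (G.eval t)‖^k * |G.coeff j| ≤ C := by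
  classical
  set D : ℝ := ((k-1:ℕ):ℝ)+1 with hD
  set A : ℝ := D*(2*(2*((k-1:ℕ):ℝ)+1))^(k-1) with hA
  have hk0 : (0:ℝ) ≤ ((k-1:ℕ):ℝ) := by positivity
  have hA1 : 1 ≤ A := one_lm (by linarith) (one_le_pow₀ (by linarith))
  refine ⟨2^k*A*(3*k+1), one_lm (one_lm (one_le_pow₀ (by norm_num)) hA1) (by simp), ?_⟩
  intro G hG j hj
  set I := ‖∫ t in (0:ℝ)..1, ex (G.eval t)‖ with hI
  have hI0 : 0 ≤ I := norm_nonneg _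
  rcases hI0.eq_or_lt with h0 | hpos
  · rw [← h0, zero_pow (by omega), zero_mul]; positivity
  set l := 2*(3*k+1)/I with hl
  have hl0 : 0 < l := by positivity
  have hd1 : G.derivative.natDegree ≤ k-1 := (natDegree_derivative_le G).trans (by omega)
  set R : Finset ℝ := (G.derivative - C l).roots.toFinset ∪ (G.derivative + C l).roots.toFinset ∪ G.derivative.derivative.roots.toFinset with hR
  have hRc : R.card ≤ 3*k := by
    have c1 : ∀ p : ℝ[X], p.natDegree ≤ k → p.roots.toFinset.card ≤ k := fun p hp =>
      (Multiset.toFinset_card_le _).trans ((card_roots' p).trans hp)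
    have a1 := c1 (G.derivative - C l) ((natDegree_sub_C).trans_le (by omega))
    have a2 := c1 (G.derivative + C l) ((natDegree_add_C).trans_le (by omega))
    have a3 := c1 G.derivative.derivative ((natDegree_derivative_le _).trans (by omega))
    have := Finset.card_union_le ((G.derivative - C l).roots.toFinset ∪ (G.derivative + C l).roots.toFinset) G.derivative.derivative.roots.toFinset
    have := Finset.card_union_le (G.derivative - C l).roots.toFinset (G.derivative + C l).roots.toFinset
    rw [hR]; omega
  have h1 := split_int G l hl0 R (by
    intro t ht
    simp only [hR, Finset.mem_union, Multiset.mem_toFinset]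
    tauto) (3*k) 0 1 one_pos ((Finset.card_filter_le _ _).trans hRc)
  have h2 := sublevel G.derivative (k-1) (by omega) hd1 l hl0 (j-1)
  set m := MeasureTheory.volume.real ({t | |G.derivative.eval t| ≤ l} ∩ Set.Ioc 0 1) with hm
  rw [← hI] at h1
  have h3 : ((3*k:ℕ):ℝ)+1 = l*I/2 := by rw [hl]; field_simp; push_cast; ring
  have h4 : I/2 ≤ m := by
    rw [h3] at h1
    have : l*I/2*(1/l) = I/2 := by field_simp
    linarith
  have h5 : |G.coeff j| ≤ |G.derivative.coeff (j-1)| := by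
    rw [coeff_derivative, show j-1+1 = j by omega, abs_mul]
    refine le_mul_of_one_le_right (abs_nonneg _) ?_
    rw [abs_of_nonneg (by positivity)]; simp
  have h6 : (I/2)^(k-1) * |G.coeff j| ≤ A * l := by
    calc _ ≤ m^(k-1) * |G.derivative.coeff (j-1)| := by gcongr
      _ ≤ _ := by rw [hA, hD]; exact h2
  calc I^k * |G.coeff j| = 2^(k-1)*I*((I/2)^(k-1) * |G.coeff j|) := by
        rw [div_pow, show I^k = I^(k-1)*I by rw [← pow_succ]; congr 1; omega]; field_simp
    _ ≤ 2^(k-1)*I*(A*l) := by gcongr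
    _ = _ := by
      rw [hl, show (2:ℝ)^k = 2^(k-1)*2 by rw [← pow_succ]; congr 1; omega]; field_simp

theorem Io_bd (k : ℕ) (hk : 2 ≤ k) : ∃ C : ℝ, 1 ≤ C ∧ ∀ (β : ℕ → ℝ) (n : ℝ), 0 < n → ∀ j ∈ Icc 1 k,
    ‖Io k β n‖^k * (|β j| * n^j) ≤ C * n^k := by
  obtain ⟨C0, hC0, H⟩ := osc k hk
  refine ⟨C0, hC0, ?_⟩
  intro β n hn j hj
  have hjm := mem_Icc.1 hj
  set G : ℝ[X] := ∑ i ∈ Icc 1 k, monomial i (β i * n^i) with hG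
  have hdeg : G.natDegree ≤ k := natDegree_sum_le_of_forall_le _ _ fun i hi => (natDegree_monomial_le _).trans (mem_Icc.1 hi).2
  have hco : G.coeff j = β j * n^j := by
    rw [hG, finset_sum_coeff, sum_eq_single j]
    · simp
    · intro i _ hij; rw [coeff_monomial, if_neg hij]
    · intro h; exact absurd hj h
  have hev : ∀ s, G.eval s = gm k β (s*n) := by
    intro s
    unfold gm
    rw [hG, eval_finset_sum]
    refine sum_congr rfl fun i _ => ?_
    rw [eval_monomial, mul_pow]; ring
  have hint : Io k β n = n * ∫ t in (0:ℝ)..1, ex (G.eval t) := by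
    simp_rw [hev]
    have := intervalIntegral.smul_integral_comp_mul_right (a := 0) (b := 1) (fun t => ex (gm k β t)) n
    rw [zero_mul, one_mul] at this
    unfold Io
    rw [← this]; simp
  have := H G hdeg j hjm.1
  rw [hco, abs_mul, abs_of_pos (pow_pos hn j)] at this
  rw [hint, norm_mul, mul_pow]
  simp only [Complex.norm_real, Real.norm_eq_abs, abs_of_pos hn]
  calc _ = n^k * (‖∫ t in (0:ℝ)..1, ex (G.eval t)‖^k * (|β j| * n^j)) := by ring
    _ ≤ n^k * C0 := by gcongr
    _ = _ := by ring

theorem Io_triv (k : ℕ) (β : ℕ → ℝ) (n : ℝ) (hn : 0 ≤ n) : ‖Io k β n‖ ≤ n := by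
  have := intervalIntegral.norm_integral_le_of_norm_le_const (a := 0) (b := n) (f := fun t => ex (gm k β t)) (C := 1) (fun t _ => (norm_ex _).le)
  rwa [one_mul, sub_zero, abs_of_nonneg hn] at this
end

noncomputable section
open Polynomial

section mord
variable {p : ℕ} [hp : Fact p.Prime]

theorem cast_ne {j d : ℕ} (h1 : 1 ≤ j) (h2 : j ≤ d) (hd : d < p) : (j : ZMod p) ≠ 0 := by
  rw [Ne, ZMod.natCast_eq_zero_iff]
  exact fun h => by have := Nat.le_of_dvd (by omega) h; omega

theorem std_sum {N : ℕ} [NeZero N] {ι : Type*} (s : Finset ι) (w : ι → ZMod N) :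
    (stdAddChar (∑ j ∈ s, w j) : ℂ) = ∏ j ∈ s, stdAddChar (w j) := by
  classical
  induction s using Finset.induction_on with
  | empty => simp
  | insert a s ha ih => rw [sum_insert ha, Finset.prod_insert ha, map_add_eq_mul, ih]

theorem newton {d : ℕ} (hd : d < p) (x y : Fin d → ZMod p) (h : ∀ j : Fin d, ∑ i, x i^((j:ℕ)+1) = ∑ i, y i^((j:ℕ)+1)) :
    ∀ i, ∃ i', x i = y i' := by
  have he : ∀ j ≤ d, MvPolynomial.aeval x (MvPolynomial.esymm (Fin d) (ZMod p) j) = MvPolynomial.aeval y (MvPolynomial.esymm (Fin d) (ZMod p) j) := by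
    intro j
    induction j using Nat.strong_induction_on with
    | _ j ih =>
    intro hj
    rcases Nat.eq_zero_or_pos j with rfl | hj0
    · simp
    refine mul_left_cancel₀ (cast_ne hj0 hj hd) ?_
    have e := MvPolynomial.mul_esymm_eq_sum (Fin d) (ZMod p) j
    have ex := congrArg (MvPolynomial.aeval x) e
    have ey := congrArg (MvPolynomial.aeval y) e
    simp only [map_mul, map_natCast, map_pow, map_neg, map_one, map_sum] at ex ey
    rw [ex, ey]
    congr 1
    refine sum_congr rfl fun a ha => ?_
    obtain ⟨ha1, ha2⟩ := mem_filter.1 ha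
    have ha3 := Finset.HasAntidiagonal.mem_antidiagonal.1 ha1
    rw [ih a.1 ha2 (by omega)]
    congr 1
    have := h ⟨a.2-1, by omega⟩
    simp only [show a.2-1+1 = a.2 by omega] at this
    simpa [MvPolynomial.psum] using this
  have hprod : (((univ.val.map x).map fun t => X - C t).prod : (ZMod p)[X]) = ((univ.val.map y).map fun t => X - C t).prod := by
    rw [Multiset.prod_X_sub_X_eq_sum_esymm, Multiset.prod_X_sub_X_eq_sum_esymm]
    have hc : ∀ x : Fin d → ZMod p, Multiset.card (univ.val.map x) = d := fun x => by simp
    rw [hc, hc]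
    refine sum_congr rfl fun j hj => ?_
    have := he j (by have := mem_range.1 hj; omega)
    rw [MvPolynomial.aeval_esymm_eq_multiset_esymm, MvPolynomial.aeval_esymm_eq_multiset_esymm] at this
    rw [this]
  intro i
  rw [Multiset.map_map, Multiset.map_map] at hprod
  have h1 : (∏ i, (X - C (x i)) : (ZMod p)[X]) = ∏ i, (X - C (y i)) := hprod
  have h2 := congrArg (fun q => q.eval (x i)) h1
  simp only [eval_prod, eval_sub, eval_X, eval_C] at h2
  rw [Finset.prod_eq_zero (mem_univ i) (sub_self _)] at h2
  obtain ⟨i', _, hi'⟩ := Finset.prod_eq_zero_iff.1 h2.symm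
  exact ⟨i', sub_eq_zero.1 hi'⟩

def Gd (p : ℕ) [NeZero p] (d : ℕ) (c : Fin d → ZMod p) : ℂ := ∑ x : ZMod p, stdAddChar (∑ j, c j * x^((j:ℕ)+1))

theorem charsum {d : ℕ} (w : Fin d → ZMod p) : ∑ c : Fin d → ZMod p, stdAddChar (∑ j, c j * w j) =
    if w = 0 then (p:ℂ)^d else 0 := by
  have h1 : ∀ c : Fin d → ZMod p, (stdAddChar (∑ j, c j * w j) : ℂ) = ∏ j, stdAddChar (c j * w j) := fun c =>
    std_sum _ _
  simp_rw [h1]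
  rw [← Fintype.piFinset_univ, ← Finset.prod_univ_sum (fun _ => univ) (fun j (c : ZMod p) => (stdAddChar (c * w j) : ℂ))]
  simp_rw [AddChar.sum_mulShift _ (ZMod.isPrimitive_stdAddChar p)]
  split_ifs with hw
  · subst hw; simp [ZMod.card]
  · obtain ⟨j, hj⟩ := Function.ne_iff.1 hw
    refine Finset.prod_eq_zero (mem_univ j) ?_
    rw [if_neg (by simpa using hj)]; simp

theorem moment {d : ℕ} (hd : d < p) : ∑ c, ‖Gd p d c‖^(2*d) ≤ (d:ℝ)^d * (p:ℝ)^(2*d) := by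
  classical
  set w : (Fin d → ZMod p) → (Fin d → ZMod p) → Fin d → ZMod p := fun x y j => ∑ i, x i^((j:ℕ)+1) - ∑ i, y i^((j:ℕ)+1) with hw
  have hpw : ∀ c, Gd p d c^d = ∑ x : Fin d → ZMod p, stdAddChar (∑ j, c j * ∑ i, x i^((j:ℕ)+1)) := by
    intro c
    unfold Gd
    rw [Fintype.sum_pow]
    refine sum_congr rfl fun x _ => ?_
    rw [← std_sum, sum_comm]
    simp_rw [mul_sum]
  have hc : ((∑ c, ‖Gd p d c‖^(2*d) : ℝ):ℂ) = ∑ x, ∑ y, ∑ c : Fin d → ZMod p, (stdAddChar (∑ j, c j * w x y j) : ℂ) := by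
    have : ∀ c, ((‖Gd p d c‖^(2*d):ℝ):ℂ) = ∑ x, ∑ y, (stdAddChar (∑ j, c j * w x y j) : ℂ) := by
      intro c
      rw [show ((‖Gd p d c‖^(2*d):ℝ):ℂ) = Gd p d c^d * (starRingEnd ℂ) (Gd p d c^d) by
        rw [Complex.mul_conj, Complex.normSq_eq_norm_sq, norm_pow]; push_cast; ring]
      rw [hpw, map_sum, sum_mul_sum]
      refine sum_congr rfl fun x _ => sum_congr rfl fun y _ => ?_
      rw [← AddChar.map_neg_eq_conj, ← map_add_eq_mul]
      congr 1
      rw [← Finset.sum_neg_distrib, ← sum_add_distrib]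
      refine sum_congr rfl fun j _ => ?_
      simp only [hw]; ring
    push_cast at this ⊢
    simp_rw [this]
    rw [sum_comm]
    refine sum_congr rfl fun x _ => ?_
    rw [sum_comm]
  simp_rw [charsum] at hc
  have hr : ∑ c, ‖Gd p d c‖^(2*d) = ∑ y, ∑ x, if w x y = 0 then (p:ℝ)^d else 0 := by
    rw [sum_comm]; apply Complex.ofReal_injective
    rw [hc]; push_cast
    refine sum_congr rfl fun x _ => sum_congr rfl fun y _ => ?_
    split_ifs <;> simp
  rw [hr]
  calc _ ≤ ∑ y : Fin d → ZMod p, (d:ℝ)^d*(p:ℝ)^d := by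
        refine sum_le_sum fun y _ => ?_
        rw [← sum_filter, sum_const, nsmul_eq_mul]
        refine mlr ?_ (by positivity)
        have hsub : (univ.filter fun x => w x y = 0) ⊆ Fintype.piFinset (fun _ : Fin d => univ.image y) := by
          intro x hx
          rw [Fintype.mem_piFinset]
          intro i
          obtain ⟨i', hi'⟩ := newton hd x y (fun j => by
            have := congrFun (mem_filter.1 hx).2 j
            simp only [hw, Pi.zero_apply] at this
            exact sub_eq_zero.1 this) i
          exact mem_image.2 ⟨i', mem_univ _, hi'.symm⟩
        have := card_le_card hsub
        rw [Fintype.card_piFinset, Finset.prod_const, Finset.card_univ, Fintype.card_fin] at this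
        have h2 : (univ.image y).card ≤ d := Finset.card_image_le.trans (by simp)
        exact_mod_cast this.trans (Nat.pow_le_pow_left h2 _)
    _ = _ := by
        rw [sum_const, nsmul_eq_mul, Finset.card_univ, Fintype.card_fun, ZMod.card, Fintype.card_fin]; push_cast; ring

theorem mordF (f : (ZMod p)[X]) (d : ℕ) (hd : 2 ≤ d) (hf : f.natDegree = d) (hdp : d < p) :
    ‖∑ x : ZMod p, stdAddChar (f.eval x)‖^(2*d) ≤ 2*(d:ℝ)^(d+1)*(p:ℝ)^(2*d-2) := by
  classical
  set S := ‖∑ x : ZMod p, stdAddChar (f.eval x)‖ with hS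
  set U : Finset (ZMod p × ZMod p) := univ.filter (fun a => a.1 ≠ 0) with hU
  have hUc : (U.card:ℝ) = (p-1)*p := by
    have h1 : U = (univ.erase (0:ZMod p)) ×ˢ (univ : Finset (ZMod p)) := by
      ext a; simp [hU]
    rw [h1, Finset.card_product, Finset.card_erase_of_mem (mem_univ _), Finset.card_univ, ZMod.card]
    push_cast [hp.out.one_lt.le]; ring
  set g : ZMod p × ZMod p → (ZMod p)[X] := fun a => (taylor a.2 f).comp (C a.1 * X) with hg
  set φ : ZMod p × ZMod p → (Fin d → ZMod p) := fun a j => (g a).coeff ((j:ℕ)+1) with hφ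
  have hgc : ∀ a i, (g a).coeff i = (taylor a.2 f).coeff i * a.1^i := fun a i => comp_C_mul_X_coeff ..
  have hGS : ∀ a ∈ U, ‖Gd p d (φ a)‖ = S := by
    intro a ha
    have ha0 : a.1 ≠ 0 := (mem_filter.1 ha).2
    have hdeg : (g a).natDegree < d+1 := by
      refine Nat.lt_succ_of_le ((natDegree_comp_le).trans ?_)
      rw [natDegree_taylor, hf]
      exact (Nat.mul_le_mul_left _ ((natDegree_C_mul_le _ _).trans natDegree_X_le)).trans (by omega)
    have h1 : ∀ x, (g a).eval x = (g a).coeff 0 + ∑ j : Fin d, φ a j * x^((j:ℕ)+1) := by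
      intro x
      rw [eval_eq_sum_range' hdeg, sum_range_succ', Finset.sum_range]
      simp [hφ, add_comm]
    have h2 : ∑ x : ZMod p, (stdAddChar (f.eval x) : ℂ) = ∑ x : ZMod p, stdAddChar ((g a).eval x) := by
      refine (Fintype.sum_equiv ((Equiv.mulLeft₀ a.1 ha0).trans (Equiv.addRight a.2)) _ _ fun x => ?_).symm
      simp [hg, eval_comp, taylor_eval]
    rw [hS, h2]
    simp_rw [h1, map_add_eq_mul]
    rw [← mul_sum, norm_mul, AddChar.norm_apply, one_mul]; rfl
  have hfib : ∀ c, ((U.filter fun a => φ a = c).card:ℝ) ≤ d := by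
    intro c
    have hlead : f.coeff d ≠ 0 := by rw [← hf]; exact leadingCoeff_ne_zero.2 (by rintro rfl; simp at hf; omega)
    set c1 := c ⟨d-1, by omega⟩ with hc1
    set r : (ZMod p)[X] := C (f.coeff d) * X^d - C c1 with hr
    have hrd : r.natDegree ≤ d := by
      rw [hr]; compute_degree
    have hr0 : r ≠ 0 := by
      intro h
      have := congrArg (fun q => q.coeff d) h
      simp only [hr, coeff_sub, coeff_C_mul, coeff_X_pow, if_true, mul_one, coeff_C, coeff_zero] at this
      rw [if_neg (by omega), sub_zero] at this
      exact hlead this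
    have hco : ∀ a ∈ U.filter (fun a => φ a = c), f.coeff d * a.1^d = c1 := by
      intro a ha
      have h1 := congrFun (mem_filter.1 ha).2 ⟨d-1, by omega⟩
      simp only [hφ] at h1
      rw [show d-1+1 = d by omega, hgc, tay_top f hf.le] at h1
      exact h1
    have hle : (U.filter fun a => φ a = c).card ≤ r.roots.toFinset.card := by
      refine Finset.card_le_card_of_injOn Prod.fst ?_ ?_
      · intro a ha
        rw [Finset.mem_coe, Multiset.mem_toFinset, mem_roots hr0, IsRoot.def, hr]
        simp [hco a ha]
      · intro a ha b hb hab
        refine Prod.ext hab ?_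
        have ha0 : a.1 ≠ 0 := (mem_filter.1 (mem_filter.1 ha).1).2
        have h1 := congrFun (mem_filter.1 ha).2 ⟨d-2, by omega⟩
        have h2 := congrFun (mem_filter.1 hb).2 ⟨d-2, by omega⟩
        rw [← h2] at h1
        simp only [hφ] at h1
        rw [show d-2+1 = d-1 by omega, hgc, hgc, ← hab] at h1
        have h3 := mul_right_cancel₀ (pow_ne_zero _ ha0) h1
        have hco2 : ∀ μ : ZMod p, (taylor μ f).coeff (d-1) = f.coeff (d-1) + d*f.coeff d*μ := by
          intro μ
          rw [tay_coeff f hf.le, sum_range_succ, show range d = insert (d-1) (range (d-1)) by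
            ext j; simp only [mem_insert, mem_range]; omega, sum_insert (by simp), sum_eq_zero (by
              intro j hj; rw [Nat.choose_eq_zero_of_lt (mem_range.1 hj)]; simp)]
          have : d.choose (d-1) = d := by
            obtain ⟨e, rfl⟩ : ∃ e, d = e+1 := ⟨d-1, by omega⟩
            simp
          rw [this, show d-(d-1) = 1 by omega]; simp
        rw [hco2, hco2] at h3
        have h4 := add_left_cancel h3
        exact mul_left_cancel₀ (mul_ne_zero (cast_ne (by omega) le_rfl hdp) hlead) h4
    exact_mod_cast hle.trans ((Multiset.toFinset_card_le _).trans ((card_roots' r).trans hrd))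
  have hsum : (((p:ℝ)-1)*p) * S^(2*d) ≤ d * ((d:ℝ)^d * (p:ℝ)^(2*d)) := by
    calc (((p:ℝ)-1)*p) * S^(2*d) = ∑ a ∈ U, ‖Gd p d (φ a)‖^(2*d) := by
          rw [sum_congr rfl (g := fun _ => S^(2*d)) (fun a ha => by rw [hGS a ha]), sum_const, nsmul_eq_mul, hUc]
      _ = ∑ c, ∑ a ∈ U with φ a = c, ‖Gd p d c‖^(2*d) := (Finset.sum_fiberwise' U φ (fun c => ‖Gd p d c‖^(2*d))).symm
      _ ≤ ∑ c, d * ‖Gd p d c‖^(2*d) := by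
          refine sum_le_sum fun c _ => ?_
          rw [sum_const, nsmul_eq_mul]
          exact mlr (hfib c) (by positivity)
      _ ≤ _ := by rw [← mul_sum]; exact mll (moment hdp) (by positivity)
  have hp2 : (2:ℝ) ≤ p := by exact_mod_cast hp.out.two_le
  have h1 : (p:ℝ)^2/2 ≤ (p-1)*p := by nlinarith
  have h2 : (p:ℝ)^2/2 * S^(2*d) ≤ d * ((d:ℝ)^d * (p:ℝ)^(2*d)) := (mlr h1 (by positivity)).trans hsum
  have h3 : (p:ℝ)^(2*d) = (p:ℝ)^(2*d-2) * (p:ℝ)^2 := by rw [← pow_add]; congr 1; omega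
  have h4 : 0 < (p:ℝ)^2/2 := by positivity
  refine le_of_mul_le_mul_left (h2.trans (le_of_eq ?_)) h4
  rw [h3]; ring
end mord
end

noncomputable section
open Polynomial

def ep (N : ℕ) (z : ℤ) : ℂ := ex ((z:ℝ)/N)

theorem ep_add (N : ℕ) (u v : ℤ) : ep N (u+v) = ep N u * ep N v := by
  unfold ep; rw [← ex_add]; congr 1; push_cast; ring

theorem norm_ep (N : ℕ) (u : ℤ) : ‖ep N u‖ = 1 := norm_ex _

theorem ep_congr {N : ℕ} (hN : 0 < N) {u v : ℤ} (h : (N:ℤ) ∣ u - v) : ep N u = ep N v := by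
  obtain ⟨w, hw⟩ := h
  unfold ep
  rw [← ex_add_int ((v:ℝ)/N) w]; congr 1
  have : (u:ℝ) = v + N*w := by
    have : u = v + N*w := by linarith
    exact_mod_cast this
  rw [this]; field_simp

theorem ep_mul (M N : ℕ) (hM : 0 < M) (u : ℤ) : ep (M*N) (M*u) = ep N u := by
  unfold ep; congr 1; push_cast
  exact mul_div_mul_left _ _ (by positivity)

def SS (N : ℕ) (f : ℤ[X]) : ℂ := ∑ x ∈ range N, ep N (f.eval (x:ℤ))

theorem SS_le (N : ℕ) (f : ℤ[X]) : ‖SS N f‖ ≤ N := by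
  refine (norm_sum_le _ _).trans ?_
  simp [norm_ep]

theorem sum_shift (N : ℕ) (F : ℕ → ℂ) (hF : ∀ x, F (x+N) = F x) (c : ℕ) :
    ∑ x ∈ range N, F (x+c) = ∑ x ∈ range N, F x := by
  induction c with
  | zero => rfl
  | succ c ih =>
    rw [← ih]
    have h1 := sum_range_succ (fun x => F (x+c)) N
    have h2 := sum_range_succ' (fun x => F (x+c)) N
    rw [h1] at h2
    have h3 : F (N+c) = F (0+c) := by rw [zero_add, add_comm, hF]
    rw [h3] at h2
    rw [add_right_cancel h2]
    exact sum_congr rfl fun x _ => by congr 1; ring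

theorem ep_per {N : ℕ} (hN : 0 < N) (f : ℤ[X]) {u v : ℤ} (h : (N:ℤ) ∣ u - v) : ep N (f.eval u) = ep N (f.eval v) :=
  ep_congr hN (h.trans (sub_dvd_eval_sub u v f))

theorem sum_periods (N : ℕ) (F : ℕ → ℂ) (hF : ∀ x, F (x+N) = F x) (c : ℕ) :
    ∑ x ∈ range (N*c), F x = c * ∑ x ∈ range N, F x := by
  have hF2 : ∀ c x, F (x+N*c) = F x := by
    intro c; induction c with
    | zero => intro x; rfl
    | succ c ih => intro x; rw [mul_add, mul_one, ← add_assoc, hF, ih]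
  induction c with
  | zero => simp
  | succ c ih =>
    rw [mul_add, mul_one, Finset.sum_range_add, ih, sum_congr rfl (f := fun x => F (N*c+x)) (g := F) (fun x _ => by rw [add_comm, hF2])]
    push_cast; ring

theorem ep_orth {p : ℕ} (hp : 0 < p) (c : ℤ) : ∑ y ∈ range p, ep p (y*c) = if (p:ℤ) ∣ c then (p:ℂ) else 0 := by
  split_ifs with h
  · rw [sum_congr rfl (g := fun _ => (1:ℂ)) (fun y _ => by
      rw [ep_congr (v := 0) hp (by rw [sub_zero]; exact h.mul_left _)]; simp [ep, ex_zero])]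
    simp
  · have h0 : ex ((c:ℝ)/p) ≠ 1 := by
      intro h1
      have := ex_sub_one_ge ((c:ℝ)/p)
      rw [h1, sub_self, norm_zero] at this
      have h2 : (c:ℝ)/p - round ((c:ℝ)/p) = 0 := by
        have := abs_nonneg ((c:ℝ)/p - round ((c:ℝ)/p)); exact abs_eq_zero.1 (by linarith)
      refine h ⟨round ((c:ℝ)/p), ?_⟩
      have h3 : (c:ℝ) = p * (round ((c:ℝ)/p) : ℤ) := by
        have hp' : (p:ℝ) ≠ 0 := by positivity
        have h4 : (c:ℝ)/p = round ((c:ℝ)/p) := by linarith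
        rw [← h4]; field_simp
      exact_mod_cast h3
    have h1 : ∀ y : ℕ, ep p (y*c) = ex ((c:ℝ)/p)^y := by
      intro y; rw [← ex_nat_mul]; unfold ep; congr 1; push_cast; ring
    simp_rw [h1]
    have h2 := mul_geom_sum (ex ((c:ℝ)/p)) p
    rw [← h1 p, ep_congr (v := 0) hp (by simp)] at h2
    rw [show ep p 0 = 1 by simp [ep, ex_zero], sub_self] at h2
    exact (mul_eq_zero.1 h2).resolve_left (sub_ne_zero.2 h0)

theorem hua_red {p : ℕ} (hp : p.Prime) (f h : ℤ[X]) (t m : ℕ) (hf : f.derivative = C ((p:ℤ)^t) * h) (hm : 2*t+2 ≤ m) :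
    SS (p^m) f = ∑ r ∈ range p, if (p:ℤ) ∣ h.eval (r:ℤ) then
      ∑ z ∈ range (p^(m-1)), ep (p^m) (f.eval ((r:ℤ)+p*z)) else 0 := by
  have hp0 := hp.pos
  have hN : 0 < p^m := by positivity
  obtain ⟨s, hs⟩ : ∃ s, m = s+t+1 := ⟨m-t-1, by omega⟩
  have h1 : (p:ℂ) * SS (p^m) f = ∑ x ∈ range (p^m), ep (p^m) (f.eval (x:ℤ)) * ∑ y ∈ range p, ep p (y * h.eval (x:ℤ)) := by
    simp_rw [mul_sum]
    rw [sum_comm]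
    rw [sum_congr rfl (g := fun _ => SS (p^m) f)]
    · simp
    intro y _
    unfold SS
    rw [← sum_shift (p^m) (fun x => ep (p^m) (f.eval (x:ℤ))) (fun x => ep_per hN f (by push_cast; simp)) (p^s*y)]
    refine sum_congr rfl fun x _ => ?_
    rw [show ep p (y * h.eval (x:ℤ)) = ep (p^m) ((p^(s+t):ℕ) * (y*h.eval (x:ℤ))) by
      rw [hs, pow_succ, ep_mul _ _ (by positivity)], ← ep_add]
    refine ep_congr hN ?_
    obtain ⟨K, hK⟩ := binomExpansion f (x:ℤ) ((p:ℤ)^s*y)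
    push_cast
    rw [hK, hf, eval_mul, eval_C]
    have : ((p:ℤ)^m) ∣ ((p:ℤ)^s)^2 := by rw [← pow_mul]; exact pow_dvd_pow _ (by omega)
    obtain ⟨w, hw⟩ := this
    refine ⟨-(K*w*y^2), ?_⟩
    rw [pow_add, mul_pow, hw]; ring
  simp_rw [ep_orth hp0] at h1
  have hpC : (p:ℂ) ≠ 0 := by exact_mod_cast hp0.ne'
  have h2 : SS (p^m) f = ∑ x ∈ range (p^m), if (p:ℤ) ∣ h.eval (x:ℤ) then ep (p^m) (f.eval (x:ℤ)) else 0 := by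
    apply mul_left_cancel₀ hpC
    rw [h1, mul_sum]
    refine sum_congr rfl fun x _ => ?_
    split_ifs <;> ring
  rw [h2, sum_res (p^m) p hp0]
  refine sum_congr rfl fun r hr => ?_
  have hmr : mr (p^m) p r = p^(m-1) := by
    have key : ∀ z, z < mr (p^m) p r ↔ z < p^(m-1) := by
      intro z
      have hr' := mem_range.1 hr
      rw [mr_iff hr', show p^m = p*p^(m-1) by rw [← pow_succ']; congr 1; omega]
      constructor
      · intro h; by_contra hc
        have := Nat.mul_le_mul_left p (not_lt.1 hc); omega
      · intro h
        have := Nat.mul_le_mul_left p (Nat.succ_le_of_lt h)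
        rw [Nat.succ_eq_add_one, mul_add, mul_one] at this; omega
    have h3 := key (mr (p^m) p r)
    have h4 := key (p^(m-1))
    omega
  rw [hmr]
  have hdv : ∀ z : ℕ, ((p:ℤ) ∣ h.eval ((r+p*z:ℕ):ℤ)) ↔ (p:ℤ) ∣ h.eval (r:ℤ) := by
    intro z
    have : (p:ℤ) ∣ h.eval ((r+p*z:ℕ):ℤ) - h.eval (r:ℤ) := by
      refine dvd_trans ?_ (sub_dvd_eval_sub _ _ h); push_cast; simp
    exact (dvd_iff_dvd_of_dvd_sub this)
  simp_rw [hdv]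
  split_ifs
  · exact sum_congr rfl fun z _ => by push_cast; rfl
  · simp
end

noncomputable section
open Polynomial

theorem extractp {p : ℕ} (hp : p.Prime) (F : ℤ[X]) (hF : F ≠ 0) :
    ∃ (t : ℕ) (h : ℤ[X]), F = C ((p:ℤ)^t) * h ∧ ∃ i, ¬ (p:ℤ) ∣ h.coeff i := by
  have hpi : Prime (p:ℤ) := Nat.prime_iff_prime_int.1 hp
  have hfin : FiniteMultiplicity (C (p:ℤ)) F := FiniteMultiplicity.of_not_isUnit (fun h => hpi.not_unit (isUnit_C.1 h)) hF
  obtain ⟨h, h1, h2⟩ := hfin.exists_eq_pow_mul_and_not_dvd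
  refine ⟨_, h, by rw [C_pow]; exact h1, ?_⟩
  rw [C_dvd_iff_dvd_coeff] at h2
  push_neg at h2; exact h2

abbrev mp (p : ℕ) (h : ℤ[X]) : (ZMod p)[X] := h.map (Int.castRingHom (ZMod p))

theorem mp_coeff (p : ℕ) (h : ℤ[X]) (i : ℕ) : (mp p h).coeff i = 0 ↔ (p:ℤ) ∣ h.coeff i := by
  rw [mp, coeff_map, eq_intCast, ZMod.intCast_zmod_eq_zero_iff_dvd]

theorem mp_taylor (p : ℕ) (h : ℤ[X]) (ξ : ℤ) : mp p (taylor ξ h) = taylor (ξ : ZMod p) (mp p h) := by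
  simp [mp, taylor_apply, map_comp]

theorem comp_lin (h : ℤ[X]) (ξ P : ℤ) (i : ℕ) : (h.comp (C P * X + C ξ)).coeff i = (taylor ξ h).coeff i * P^i := by
  rw [← comp_C_mul_X_coeff, taylor_apply, comp_assoc]; simp

theorem root_coeff {p : ℕ} [Fact p.Prime] (h : (ZMod p)[X]) (hh : h ≠ 0) (ξ : ZMod p) :
    (taylor ξ h).coeff (h.rootMultiplicity ξ) ≠ 0 := by
  obtain ⟨r, h1, h2⟩ := exists_eq_pow_rootMultiplicity_mul_and_not_dvd h hh ξ
  set μ := h.rootMultiplicity ξ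
  have : taylor ξ h = X^μ * taylor ξ r := by
    rw [h1, taylor_mul]; congr 1; simp [taylor_apply]
  rw [this, coeff_X_pow_mul', if_pos le_rfl, Nat.sub_self, taylor_coeff_zero]
  exact fun h3 => h2 (dvd_iff_isRoot.2 h3)

theorem hua_step {p k : ℕ} [hp : Fact p.Prime] (f h : ℤ[X]) (t : ℕ) (hk : f.natDegree ≤ k) (hf0 : ∃ j, 1 ≤ j ∧ ¬ (p:ℤ) ∣ f.coeff j)
    (hf : f.derivative = C ((p:ℤ)^t) * h) (hh : ∃ i, ¬ (p:ℤ) ∣ h.coeff i) (ξ : ℤ) :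
    ∃ (σ : ℕ) (g : ℤ[X]), 1 ≤ σ ∧ σ ≤ k ∧ (∀ z : ℤ, f.eval (ξ+p*z) = f.eval ξ + (p:ℤ)^σ * g.eval z) ∧ g.natDegree ≤ k ∧
      (∃ i, 1 ≤ i ∧ ¬ (p:ℤ) ∣ g.coeff i) ∧ ∀ (t' : ℕ) (h' : ℤ[X]), g.derivative = C ((p:ℤ)^t') * h' → (mp p h').natDegree ≤ (mp p h).rootMultiplicity (ξ : ZMod p) := by
  have hp0 : (p:ℤ) ≠ 0 := by exact_mod_cast hp.out.ne_zero
  have hpi : Prime (p:ℤ) := Nat.prime_iff_prime_int.1 hp.out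
  set F := f.comp (C (p:ℤ) * X + C ξ) with hF
  have hFc : ∀ i, F.coeff i = (taylor ξ f).coeff i * (p:ℤ)^i := fun i => comp_lin f ξ p i
  obtain ⟨d, hd1, hdk, hd⟩ : ∃ d, 1 ≤ d ∧ d ≤ k ∧ ¬ (p:ℤ) ∣ (taylor ξ f).coeff d := by
    obtain ⟨j, hj1, hj⟩ := hf0
    rw [← mp_coeff] at hj
    have hjd : j ≤ (mp p f).natDegree := le_natDegree_of_ne_zero hj
    refine ⟨(mp p f).natDegree, by omega, natDegree_map_le.trans hk, ?_⟩
    rw [← mp_coeff, mp_taylor, ← natDegree_taylor (mp p f) (ξ : ZMod p)]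
    refine leadingCoeff_ne_zero.2 fun h0 => ?_
    have := natDegree_taylor (mp p f) (ξ : ZMod p)
    rw [h0, natDegree_zero] at this; omega
  have hG0 : F - C (f.eval ξ) ≠ 0 := by
    intro h0
    have := congrArg (fun q => q.coeff d) h0
    simp only [coeff_sub, coeff_C, hFc, coeff_zero] at this
    rw [if_neg (by omega), sub_zero] at this
    rcases mul_eq_zero.1 this with h1 | h1
    · exact hd (by rw [h1]; exact dvd_zero _)
    · exact pow_ne_zero _ hp0 h1
  obtain ⟨σ, g, hg, i0, hi0⟩ := extractp hp.out _ hG0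
  have hgc : ∀ i, (p:ℤ)^σ * g.coeff i = F.coeff i - (C (f.eval ξ)).coeff i := by
    intro i; rw [← coeff_sub, hg, coeff_C_mul]
  have hgi : ∀ i, 1 ≤ i → (p:ℤ)^σ * g.coeff i = (taylor ξ f).coeff i * (p:ℤ)^i := by
    intro i hi; rw [hgc, hFc, coeff_C, if_neg (by omega), sub_zero]
  have hi1 : 1 ≤ i0 := by
    by_contra hc
    have : i0 = 0 := by omega
    subst this
    have h1 := hgc 0
    rw [hFc, pow_zero, mul_one, taylor_coeff_zero, coeff_C_zero, sub_self] at h1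
    rcases mul_eq_zero.1 h1 with h1 | h1
    · exact pow_ne_zero _ hp0 h1
    · exact hi0 (by rw [h1]; exact dvd_zero _)
  refine ⟨σ, g, ?_, ?_, ?_, ?_, ⟨i0, hi1, hi0⟩, ?_⟩
  · by_contra hc
    have : σ = 0 := by omega
    subst this
    have h1 := hgi i0 hi1
    rw [pow_zero, one_mul] at h1
    exact hi0 (by rw [h1]; exact (dvd_pow_self _ (by omega)).mul_left _)
  · by_contra hc
    have h1 := hgi d hd1
    have h2 : (p:ℤ)^d * p ∣ (p:ℤ)^d * (taylor ξ f).coeff d := by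
      rw [← pow_succ, mul_comm _ ((taylor ξ f).coeff d), ← h1]
      exact (pow_dvd_pow _ (by omega)).mul_right _
    exact hd ((mul_dvd_mul_iff_left (pow_ne_zero _ hp0)).1 h2)
  · intro z
    have := congrArg (fun q => q.eval z) hg
    simp only [eval_sub, eval_C, eval_mul, hF, eval_comp, eval_add, eval_X] at this
    rw [add_comm ξ]; linarith
  · rw [← natDegree_C_mul (pow_ne_zero σ hp0), ← hg]
    refine (natDegree_sub_C (p := F) (a := f.eval ξ)).le.trans (natDegree_comp_le.trans ?_)
    refine (Nat.mul_le_mul hk (show (C (p:ℤ) * X + C ξ).natDegree ≤ 1 by compute_degree)).trans (le_of_eq (mul_one k))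
  · intro t' h' hg'
    have hd1 : C ((p:ℤ)^σ) * (C ((p:ℤ)^t') * h') = C ((p:ℤ)^(t+1)) * h.comp (C (p:ℤ) * X + C ξ) := by
      have := congrArg derivative hg
      rw [derivative_sub, derivative_C, sub_zero, hF, derivative_comp, hf, derivative_C_mul, hg'] at this
      rw [← this]
      simp; ring
    have hc : ∀ i, (p:ℤ)^(σ+t') * h'.coeff i = (p:ℤ)^(t+1+i) * (taylor ξ h).coeff i := by
      intro i
      have := congrArg (fun q => q.coeff i) hd1
      simp only [coeff_C_mul, comp_lin] at this
      rw [pow_add, pow_add _ (t+1) i]; linarith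
    have hmh : mp p h ≠ 0 := by
      obtain ⟨i, hi⟩ := hh
      intro h0; rw [← mp_coeff, h0] at hi; exact hi rfl
    have hb := root_coeff (mp p h) hmh (ξ : ZMod p)
    set μ := (mp p h).rootMultiplicity (ξ : ZMod p) with hμ
    rw [← mp_taylor, Ne, mp_coeff] at hb
    have hA : σ + t' ≤ t+1+μ := by
      by_contra hcon
      have h2 : (p:ℤ)^(t+1+μ) * p ∣ (p:ℤ)^(t+1+μ) * (taylor ξ h).coeff μ := by
        rw [← pow_succ, ← hc]
        exact (pow_dvd_pow _ (by omega)).mul_right _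
      exact hb ((mul_dvd_mul_iff_left (pow_ne_zero _ hp0)).1 h2)
    rw [natDegree_le_iff_coeff_eq_zero]
    intro j hj
    rw [mp_coeff]
    have h3 := hc j
    rw [show t+1+j = (σ+t') + (t+1+j-(σ+t')) by omega, pow_add _ (σ+t'), mul_assoc] at h3
    rw [mul_left_cancel₀ (pow_ne_zero _ hp0) h3]
    exact (dvd_pow_self _ (by omega)).mul_right _

theorem root_sum {p : ℕ} [hp : Fact p.Prime] (h : ℤ[X]) (hh : ∃ i, ¬ (p:ℤ) ∣ h.coeff i) :
    ∑ r ∈ (range p).filter (fun r : ℕ => (p:ℤ) ∣ h.eval (r:ℤ)), (mp p h).rootMultiplicity (r : ZMod p) ≤ (mp p h).natDegree := by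
  classical
  have hmh : mp p h ≠ 0 := by
    obtain ⟨i, hi⟩ := hh
    intro h0; rw [← mp_coeff, h0] at hi; exact hi rfl
  refine le_trans ?_ (card_roots' (mp p h))
  rw [← Multiset.toFinset_sum_count_eq]
  simp_rw [count_roots]
  rw [← Finset.sum_image (f := fun a => (mp p h).rootMultiplicity a) (g := fun r : ℕ => (r : ZMod p))]
  · refine Finset.sum_le_sum_of_subset ?_
    intro a ha
    obtain ⟨r, hr, rfl⟩ := mem_image.1 ha
    rw [Multiset.mem_toFinset, mem_roots hmh, IsRoot.def]
    have h1 := (mem_filter.1 hr).2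
    rw [← ZMod.intCast_zmod_eq_zero_iff_dvd] at h1
    rw [← h1]
    have := eval_intCast_map (Int.castRingHom (ZMod p)) h (r:ℤ)
    simpa using this
  · intro a ha b hb hab
    have ha' := mem_range.1 (mem_filter.1 ha).1
    have hb' := mem_range.1 (mem_filter.1 hb).1
    have := (ZMod.natCast_eq_natCast_iff' a b p).1 hab
    rwa [Nat.mod_eq_of_lt ha', Nat.mod_eq_of_lt hb'] at this

theorem root_pos {p : ℕ} [hp : Fact p.Prime] (h : ℤ[X]) (hh : ∃ i, ¬ (p:ℤ) ∣ h.coeff i) (r : ℕ) (hr : (p:ℤ) ∣ h.eval (r:ℤ)) :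
    1 ≤ (mp p h).rootMultiplicity (r : ZMod p) := by
  have hmh : mp p h ≠ 0 := by
    obtain ⟨i, hi⟩ := hh
    intro h0; rw [← mp_coeff, h0] at hi; exact hi rfl
  refine (rootMultiplicity_pos hmh).2 ?_
  rw [IsRoot.def]
  rw [← ZMod.intCast_zmod_eq_zero_iff_dvd] at hr
  rw [← hr]
  have := eval_intCast_map (Int.castRingHom (ZMod p)) h (r:ℤ)
  simpa using this
end

noncomputable section
open Polynomial

theorem SS_prime {p : ℕ} [hp : Fact p.Prime] (f : ℤ[X]) : SS p f = ∑ x : ZMod p, stdAddChar ((mp p f).eval x) := by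
  unfold SS
  refine sum_nbij' (fun x : ℕ => (x : ZMod p)) (fun x => x.val) (by simp) (by intro a _; exact mem_range.2 (ZMod.val_lt a))
    (by intro a ha; exact ZMod.val_cast_of_lt (mem_range.1 ha)) (by intro a _; simp) ?_
  intro x _
  have := eval_intCast_map (Int.castRingHom (ZMod p)) f (x:ℤ)
  simp only [Int.cast_natCast, eq_intCast] at this
  rw [mp, this, std_ex]; rfl

theorem rho_pow {p k i : ℕ} (hp : 1 ≤ p) (hi : 1 ≤ i) (hik : i ≤ k) : (p:ℝ)^(i-1) ≤ ((p:ℝ)^(1-1/(k:ℝ)))^i := by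
  have hp' : (1:ℝ) ≤ p := by exact_mod_cast hp
  rw [← rpow_natCast, ← rpow_natCast, ← rpow_mul (by positivity)]
  refine rpow_le_rpow_of_exponent_le hp' ?_
  have hk : (0:ℝ) < k := by exact_mod_cast (by omega : 0 < k)
  have h1 : (i:ℝ)/k ≤ 1 := by rw [div_le_one hk]; exact_mod_cast hik
  rw [Nat.cast_sub hi]; push_cast
  have : (1-1/(k:ℝ))*i = i - i/k := by ring
  rw [this]; linarith

theorem hua_one {p k : ℕ} [hp : Fact p.Prime] (hk : 2 ≤ k) (f : ℤ[X]) (hfk : f.natDegree ≤ k) (hf0 : ∃ j, 1 ≤ j ∧ ¬ (p:ℤ) ∣ f.coeff j) :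
    ‖SS p f‖ ≤ (2*k^3) * (p:ℝ)^(1-1/(k:ℝ)) := by
  have hp1 : (1:ℝ) ≤ p := by exact_mod_cast hp.out.one_lt.le
  have hk1 : (2:ℝ) ≤ k := by exact_mod_cast hk
  have hρ : 1 ≤ (p:ℝ)^(1-1/(k:ℝ)) := one_le_rpow hp1 (by
    rw [sub_nonneg, div_le_one (by linarith)]; linarith)
  set ρ := (p:ℝ)^(1-1/(k:ℝ)) with hρd
  have hkk : (k:ℝ) ≤ 2*k^3 := by nlinarith [sq_nonneg (k:ℝ), mul_pos (show (0:ℝ)<k by linarith) (show (0:ℝ)<k by linarith)]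
  rcases le_or_gt p k with hpk | hpk
  · have h1 : (p:ℝ) ≤ k := by exact_mod_cast hpk
    refine (SS_le p f).trans (h1.trans (hkk.trans ?_))
    exact le_mul_of_one_le_right (by positivity) hρ
  rw [SS_prime]
  set d := (mp p f).natDegree with hd
  have hdk : d ≤ k := natDegree_map_le.trans hfk
  have hd1 : 1 ≤ d := by
    obtain ⟨j, hj1, hj⟩ := hf0
    rw [← mp_coeff] at hj
    have hjd : j ≤ (mp p f).natDegree := le_natDegree_of_ne_zero hj
    omega
  rcases Nat.lt_or_ge d 2 with hd2 | hd2
  · have hde : d = 1 := by omega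
    have hc : (mp p f).coeff 1 ≠ 0 := by
      rw [← hde]; exact leadingCoeff_ne_zero.2 (fun h0 => by rw [h0, natDegree_zero] at hd; omega)
    have he : ∀ x, (mp p f).eval x = (mp p f).coeff 0 + x * (mp p f).coeff 1 := by
      intro x
      rw [eval_eq_sum_range' (show (mp p f).natDegree < 2 by omega)]; simp [sum_range_succ]; ring
    simp_rw [he, map_add_eq_mul]
    rw [← mul_sum, AddChar.sum_mulShift _ (ZMod.isPrimitive_stdAddChar p), if_neg hc]
    simp; positivity
  · have h1 := mordF (mp p f) d hd2 hd.symm (by omega)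
    set S := ‖∑ x : ZMod p, stdAddChar ((mp p f).eval x)‖
    refine le_of_pow_le_pow_left₀ (n := 2*d) (by omega) (by positivity) (h1.trans ?_)
    have h2 : (p:ℝ)^(2*d-2) ≤ ρ^(2*d) := by
      have := rho_pow hp.out.one_lt.le hd1 hdk
      have h3 := pow_le_pow_left₀ (by positivity) this 2
      rw [← pow_mul, ← pow_mul] at h3
      rwa [show 2*d-2 = (d-1)*2 by omega, mul_comm 2 d]
    rw [mul_pow]
    refine mul_le_mul ?_ h2 (by positivity) (by positivity)
    have hdk' : (d:ℝ) ≤ k := by exact_mod_cast hdk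
    calc 2*(d:ℝ)^(d+1) ≤ 2*(k:ℝ)^(d+1) := by gcongr
      _ ≤ 2^(2*d) * (k:ℝ)^(3*(2*d)) := by
          refine mul_le_mul (le_self_pow₀ (by norm_num) (by omega)) (pow_le_pow_right₀ (by linarith) (by omega)) (by positivity) (by positivity)
      _ = _ := by rw [mul_pow, pow_mul (k:ℝ) 3]

theorem hua_pow {p k : ℕ} [hp : Fact p.Prime] (hk : 2 ≤ k) : ∀ (m : ℕ) (f h : ℤ[X]) (t : ℕ), f.natDegree ≤ k → (∃ j, 1 ≤ j ∧ ¬ (p:ℤ) ∣ f.coeff j) →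
    f.derivative = C ((p:ℤ)^t) * h → (∃ i, ¬ (p:ℤ) ∣ h.coeff i) →
    ‖SS (p^m) f‖ ≤ (2*k^3) * (max 1 (mp p h).natDegree : ℕ) * ((p:ℝ)^(1-1/(k:ℝ)))^m := by
  have hp1 : (1:ℝ) ≤ p := by exact_mod_cast hp.out.one_lt.le
  have hpp := hp.out.pos
  have hk1 : (2:ℝ) ≤ k := by exact_mod_cast hk
  have hρ : 1 ≤ (p:ℝ)^(1-1/(k:ℝ)) := one_le_rpow hp1 (by
    rw [sub_nonneg, div_le_one (by linarith)]; linarith)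
  have hC : 1 ≤ 2*(k:ℝ)^3 := by nlinarith [one_le_pow₀ (n := 3) (show (1:ℝ) ≤ k by linarith)]
  intro m
  induction m using Nat.strong_induction_on with
  | _ m ih =>
  intro f h t hfk hf0 hf hh
  set ρ := (p:ℝ)^(1-1/(k:ℝ)) with hρd
  have hmax : (1:ℝ) ≤ (max 1 (mp p h).natDegree : ℕ) := by exact_mod_cast le_max_left _ _
  rcases le_or_gt (2*t+2) m with hm | hm
  · rw [hua_red hp.out f h t m hf hm]
    rw [← sum_filter]
    refine (norm_sum_le _ _).trans ?_
    have key : ∀ r ∈ (range p).filter (fun r : ℕ => (p:ℤ) ∣ h.eval (r:ℤ)),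
        ‖∑ z ∈ range (p^(m-1)), ep (p^m) (f.eval ((r:ℤ)+p*z))‖ ≤ (2*k^3) * ((mp p h).rootMultiplicity (r : ZMod p) : ℕ) * ρ^m := by
      intro r hr
      have hμ := root_pos h hh r (mem_filter.1 hr).2
      obtain ⟨σ, g, hσ1, hσk, hg, hgk, hg0, hgh⟩ := hua_step f h t hfk hf0 hf hh (r:ℤ)
      rw [Int.cast_natCast] at hgh
      set μ := (mp p h).rootMultiplicity (r : ZMod p)
      have hμ' : (1:ℝ) ≤ μ := by exact_mod_cast hμ
      rcases le_or_gt m σ with hms | hms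
      · calc _ ≤ (p:ℝ)^(m-1) := by
              refine (norm_sum_le _ _).trans ?_; simp [norm_ep]
          _ ≤ ρ^m := rho_pow hpp (by omega) (by omega)
          _ ≤ _ := le_mul_of_one_le_left (by positivity) (by nlinarith)
      · obtain ⟨l, hl⟩ : ∃ l, m = σ + l := ⟨m-σ, by omega⟩
        have hg'0 : g.derivative ≠ 0 := by
          intro h0
          obtain ⟨i, hi1, hi⟩ := hg0
          have := natDegree_eq_zero_of_derivative_eq_zero h0
          exact hi (by rw [coeff_eq_zero_of_natDegree_lt (by omega)]; exact dvd_zero _)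
        obtain ⟨t', h', e', hh'⟩ := extractp hp.out _ hg'0
        have hI := ih l (by omega) g h' t' hgk hg0 e' hh'
        have hdeg := hgh t' h' e'
        have e1 : ∑ z ∈ range (p^(m-1)), ep (p^m) (f.eval ((r:ℤ)+p*z)) = ep (p^m) (f.eval (r:ℤ)) * ((p^(σ-1) : ℕ) * SS (p^l) g) := by
          have : ∀ z : ℕ, ep (p^m) (f.eval ((r:ℤ)+p*z)) = ep (p^m) (f.eval (r:ℤ)) * ep (p^l) (g.eval (z:ℤ)) := by
            intro z
            rw [hg, ep_add]; congr 1
            rw [hl, pow_add, ← ep_mul (p^σ) (p^l) (by positivity)]; push_cast; rfl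
          simp_rw [this]
          rw [← mul_sum, show p^(m-1) = p^l*p^(σ-1) by rw [← pow_add]; congr 1; omega,
            sum_periods (p^l) (fun z => ep (p^l) (g.eval (z:ℤ))) (fun x => ep_per (by positivity) g (by push_cast; simp))]
          rfl
        rw [e1, norm_mul, norm_ep, one_mul, norm_mul, Complex.norm_natCast]
        have hmx : ((max 1 (mp p h').natDegree : ℕ):ℝ) ≤ μ := by exact_mod_cast max_le hμ hdeg
        calc ((p^(σ-1):ℕ):ℝ) * ‖SS (p^l) g‖ ≤ ρ^σ * ((2*k^3) * μ * ρ^l) := by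
              refine mul_le_mul (by push_cast; exact rho_pow hpp hσ1 hσk) (hI.trans ?_) (norm_nonneg _) (by positivity)
              gcongr
          _ = _ := by rw [hl, pow_add]; ring
    refine (sum_le_sum key).trans ?_
    rw [← sum_mul, ← mul_sum]
    have h1 : ((∑ r ∈ (range p).filter (fun r : ℕ => (p:ℤ) ∣ h.eval (r:ℤ)), (mp p h).rootMultiplicity (r : ZMod p) : ℕ):ℝ) ≤ (max 1 (mp p h).natDegree : ℕ) := by
      exact_mod_cast (root_sum h hh).trans (le_max_right _ _)
    push_cast at h1 ⊢
    gcongr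
  · rcases Nat.eq_zero_or_pos t with rfl | ht
    · rcases Nat.eq_zero_or_pos m with rfl | hm0
      · have := SS_le (p^0) f
        refine this.trans ?_
        simp only [pow_zero, Nat.cast_one, mul_one]
        nlinarith
      · have : m = 1 := by omega
        subst this
        rw [pow_one, pow_one]
        refine (hua_one hk f hfk hf0).trans ?_
        refine mlr ?_ (by positivity)
        exact le_mul_of_one_le_right (by positivity) hmax
    · obtain ⟨j, hj1, hj⟩ := hf0
      have hjk : j ≤ k := by
        by_contra hc
        exact hj (by rw [coeff_eq_zero_of_natDegree_lt (by omega)]; exact dvd_zero _)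
      have h1 := congrArg (fun q => q.coeff (j-1)) hf
      simp only [coeff_derivative, coeff_C_mul] at h1
      rw [show j-1+1 = j by omega] at h1
      have hpi : Prime (p:ℤ) := Nat.prime_iff_prime_int.1 hp.out
      have h2 : (p:ℤ)^t ∣ (j:ℤ) := by
        have h3 : (p:ℤ)^t ∣ f.coeff j * j := ⟨h.coeff (j-1), by
          rw [← h1]; congr 1; push_cast [hj1]; ring⟩
        exact hpi.pow_dvd_of_dvd_mul_left t hj h3
      have h3 : p^t ∣ j := by exact_mod_cast h2
      have h4 : p^t ≤ k := (Nat.le_of_dvd (by omega) h3).trans hjk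
      have h5 : p^m ≤ k^3 := by
        calc p^m ≤ p^(t*3) := Nat.pow_le_pow_right hpp (by omega)
          _ = (p^t)^3 := pow_mul _ _ _
          _ ≤ _ := Nat.pow_le_pow_left h4 3
      have h6 : ((p^m:ℕ):ℝ) ≤ (k:ℝ)^3 := by exact_mod_cast h5
      refine (SS_le _ f).trans (h6.trans ?_)
      have h7 : 1 ≤ ρ^m := one_le_pow₀ hρ
      have h8 : (0:ℝ) < (k:ℝ)^3 := by positivity
      calc (k:ℝ)^3 ≤ 2*(k:ℝ)^3*1*1 := by linarith
        _ ≤ _ := by gcongr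

theorem hua {p k : ℕ} (hp : p.Prime) (hk : 2 ≤ k) (m : ℕ) (f : ℤ[X]) (hfk : f.natDegree ≤ k) (hf0 : ∃ j, 1 ≤ j ∧ ¬ (p:ℤ) ∣ f.coeff j) :
    ‖SS (p^m) f‖ ≤ (2*k^4) * ((p^m:ℕ):ℝ)^(1-1/(k:ℝ)) := by
  haveI : Fact p.Prime := ⟨hp⟩
  have h0 : f.derivative ≠ 0 := by
    intro h0
    obtain ⟨i, hi1, hi⟩ := hf0
    have := natDegree_eq_zero_of_derivative_eq_zero h0
    exact hi (by rw [coeff_eq_zero_of_natDegree_lt (by omega)]; exact dvd_zero _)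
  obtain ⟨t, h, e, hh⟩ := extractp hp _ h0
  have h1 := hua_pow hk m f h t hfk hf0 e hh
  have h2 : (mp p h).natDegree ≤ k := by
    refine natDegree_map_le.trans ?_
    have hp0 : (p:ℤ) ≠ 0 := by exact_mod_cast hp.ne_zero
    rw [← natDegree_C_mul (pow_ne_zero t hp0), ← e]
    exact (natDegree_derivative_le f).trans (by omega)
  have h3 : ((max 1 (mp p h).natDegree : ℕ):ℝ) ≤ k := by exact_mod_cast max_le (by omega) h2
  refine h1.trans ?_
  rw [show ((p^m:ℕ):ℝ)^(1-1/(k:ℝ)) = ((p:ℝ)^(1-1/(k:ℝ)))^m by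
    push_cast; rw [← rpow_natCast, ← rpow_natCast, ← rpow_mul (by positivity), ← rpow_mul (by positivity), mul_comm]]
  calc _ ≤ (2*(k:ℝ)^3) * k * ((p:ℝ)^(1-1/(k:ℝ)))^m := by gcongr
    _ = _ := by ring
end

noncomputable section
open Polynomial

theorem SS_mul {q r : ℕ} (hq : 0 < q) (hr : 0 < r) (hc : q.Coprime r) (u v : ℤ) (huv : u*r+v*q = 1) (f : ℤ[X]) :
    SS (q*r) f = SS q (C u * f) * SS r (C v * f) := by
  unfold SS
  rw [sum_mul_sum, ← Finset.sum_product' (f := fun x y : ℕ => ep q ((C u * f).eval (x:ℤ)) * ep r ((C v * f).eval (y:ℤ)))]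
  refine sum_nbij' (fun x => (x % q, x % r)) (fun y => (Nat.chineseRemainder hc y.1 y.2 : ℕ)) ?_ ?_ ?_ ?_ ?_
  · intro x _
    exact Finset.mem_product.2 ⟨mem_range.2 (Nat.mod_lt _ hq), mem_range.2 (Nat.mod_lt _ hr)⟩
  · intro y _
    exact mem_range.2 (Nat.chineseRemainder_lt_mul hc _ _ hq.ne' hr.ne')
  · intro x hx
    have h1 := (Nat.chineseRemainder hc (x%q) (x%r)).2
    have h2 : (Nat.chineseRemainder hc (x%q) (x%r) : ℕ) ≡ x [MOD q*r] :=
      (Nat.modEq_and_modEq_iff_modEq_mul hc).1 ⟨h1.1.trans (Nat.mod_modEq _ _), h1.2.trans (Nat.mod_modEq _ _)⟩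
    exact Nat.ModEq.eq_of_lt_of_lt h2 (Nat.chineseRemainder_lt_mul hc _ _ hq.ne' hr.ne') (mem_range.1 hx)
  · intro y hy
    have h1 := (Nat.chineseRemainder hc y.1 y.2).2
    obtain ⟨hy1, hy2⟩ := Finset.mem_product.1 hy
    refine Prod.ext ?_ ?_
    · exact (Eq.trans h1.1 (Nat.mod_eq_of_lt (mem_range.1 hy1)))
    · exact (Eq.trans h1.2 (Nat.mod_eq_of_lt (mem_range.1 hy2)))
  · intro x _
    have hm : ∀ n : ℕ, (n:ℤ) ∣ ((x % n : ℕ):ℤ) - (x:ℤ) := by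
      intro n
      rw [← Int.modEq_iff_dvd]
      push_cast; exact (Int.mod_modEq _ _).symm
    rw [ep_per hq (C u * f) (hm q), ep_per hr (C v * f) (hm r)]
    simp only [eval_mul, eval_C]
    unfold ep
    rw [← ex_add]; congr 1
    have hq' : (q:ℝ) ≠ 0 := by positivity
    have hr' : (r:ℝ) ≠ 0 := by positivity
    have huv' : (u:ℝ)*r+v*q = 1 := by exact_mod_cast huv
    push_cast
    field_simp
    linear_combination (-((f.eval (x:ℤ) : ℤ) : ℝ)) * huv'

theorem SS_all {k : ℕ} (hk : 2 ≤ k) (q : ℕ) : 1 ≤ q → ∀ f : ℤ[X], f.natDegree ≤ k → (∀ p, p.Prime → p ∣ q → ∃ j, 1 ≤ j ∧ ¬ (p:ℤ) ∣ f.coeff j) →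
    ‖SS q f‖ ≤ (2*(k:ℝ)^4)^(q.primeFactors.card) * (q:ℝ)^(1-1/(k:ℝ)) := by
  induction q using Nat.recOnPosPrimePosCoprime with
  | prime_pow p n hp hn =>
    intro _ f hfk hf
    rw [Nat.primeFactors_prime_pow hn.ne' hp, Finset.card_singleton, pow_one]
    exact hua hp hk n f hfk (hf p hp (dvd_pow_self _ hn.ne'))
  | zero => intro h; omega
  | one =>
    intro _ f _ _
    refine (SS_le 1 f).trans ?_
    simp
  | coprime a b ha hb hab iha ihb =>
    intro _ f hfk hf
    obtain ⟨u, v, huv⟩ : ∃ u v : ℤ, u*b+v*a = 1 := by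
      have h1 := (Nat.isCoprime_iff_coprime.2 hab)
      obtain ⟨v, u, h⟩ := h1
      exact ⟨u, v, by linarith⟩
    rw [SS_mul (by omega) (by omega) hab u v huv f, norm_mul]
    have hdeg : ∀ w : ℤ, (C w * f).natDegree ≤ k := fun w => (natDegree_C_mul_le _ _).trans hfk
    have h1 := iha (by omega) (C u * f) (hdeg u) (by
      intro p hp hpa
      obtain ⟨j, hj1, hj⟩ := hf p hp (hpa.mul_right _)
      refine ⟨j, hj1, ?_⟩
      rw [coeff_C_mul]
      intro h
      have hpi : Prime (p:ℤ) := Nat.prime_iff_prime_int.1 hp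
      rcases hpi.dvd_or_dvd h with h | h
      · have : (p:ℤ) ∣ 1 := by rw [← huv]; exact dvd_add (h.mul_right _) ((Int.natCast_dvd_natCast.2 hpa).mul_left _)
        exact hpi.not_unit (isUnit_of_dvd_one this)
      · exact hj h)
    have h2 := ihb (by omega) (C v * f) (hdeg v) (by
      intro p hp hpb
      obtain ⟨j, hj1, hj⟩ := hf p hp (hpb.mul_left _)
      refine ⟨j, hj1, ?_⟩
      rw [coeff_C_mul]
      intro h
      have hpi : Prime (p:ℤ) := Nat.prime_iff_prime_int.1 hp
      rcases hpi.dvd_or_dvd h with h | h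
      · have : (p:ℤ) ∣ 1 := by rw [← huv]; exact dvd_add ((Int.natCast_dvd_natCast.2 hpb).mul_left _) (h.mul_right _)
        exact hpi.not_unit (isUnit_of_dvd_one this)
      · exact hj h)
    rw [hab.primeFactors_mul, Finset.card_union_of_disjoint hab.disjoint_primeFactors, Nat.cast_mul, mul_rpow (by positivity) (by positivity), pow_add]
    calc _ ≤ _ := mul_le_mul h1 h2 (norm_nonneg _) (by positivity)
      _ = _ := by ring

theorem omega_bd (A ε : ℝ) (hA : 1 ≤ A) (hε : 0 < ε) : ∃ D : ℝ, 1 ≤ D ∧ ∀ q : ℕ, 1 ≤ q → A^(q.primeFactors.card) ≤ D * (q:ℝ)^ε := by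
  set P := ⌈A^(1/ε)⌉₊ with hP
  refine ⟨A^P, one_le_pow₀ hA, fun q hq => ?_⟩
  have h1 : ∀ p ∈ q.primeFactors, A ≤ (if p < P then A else 1) * (p:ℝ)^ε := by
    intro p hp
    have hp1 : (1:ℝ) ≤ p := by exact_mod_cast (Nat.prime_of_mem_primeFactors hp).one_lt.le
    split_ifs with h
    · exact le_mul_of_one_le_right (by linarith) (one_le_rpow hp1 hε.le)
    · rw [one_mul]
      have h2 : A^(1/ε) ≤ p := (Nat.le_ceil _).trans (by exact_mod_cast not_lt.1 h)
      have := rpow_le_rpow (by positivity) h2 hε.le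
      rwa [← rpow_mul (by linarith), one_div_mul_cancel hε.ne', rpow_one] at this
  calc A^(q.primeFactors.card) = ∏ p ∈ q.primeFactors, A := by rw [Finset.prod_const]
    _ ≤ ∏ p ∈ q.primeFactors, (if p < P then A else 1) * (p:ℝ)^ε := Finset.prod_le_prod (fun _ _ => by linarith) h1
    _ = A^((q.primeFactors.filter (· < P)).card) * (∏ p ∈ q.primeFactors, (p:ℝ))^ε := by
        rw [Finset.prod_mul_distrib, Real.finsetProd_rpow _ _ (fun _ _ => by positivity), ← Finset.prod_filter, Finset.prod_const]
    _ ≤ _ := by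
        refine mul_le_mul (pow_le_pow_right₀ hA ?_) (rpow_le_rpow (by positivity) ?_ hε.le) (by positivity) (by positivity)
        · calc _ ≤ (range P).card := card_le_card (fun p hp => mem_range.2 (mem_filter.1 hp).2)
            _ = P := card_range P
        · rw [← Nat.cast_prod]; exact Nat.cast_le.2 (Nat.le_of_dvd hq (Nat.prod_primeFactors_dvd q))

theorem Sq_bd {k : ℕ} (hk : 2 ≤ k) {ε : ℝ} (hε : 0 < ε) : ∃ D : ℝ, 1 ≤ D ∧ ∀ q : ℕ, 1 ≤ q → ∀ a : ℕ → ℤ,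
    (∀ p, p.Prime → p ∣ q → ∃ j ∈ Icc 1 k, ¬ (p:ℤ) ∣ a j) → ‖Sq k a q‖ ≤ D * (q:ℝ)^(1-1/(k:ℝ)+ε) := by
  have hk1 : (2:ℝ) ≤ k := by exact_mod_cast hk
  obtain ⟨D, hD, hb⟩ := omega_bd (2*(k:ℝ)^4) ε (by nlinarith [one_le_pow₀ (n := 4) (show (1:ℝ) ≤ k by linarith)]) hε
  refine ⟨D, hD, fun q hq a ha => ?_⟩
  set f : ℤ[X] := ∑ j ∈ Icc 1 k, C (a j) * X^j with hf
  have hfc : ∀ j ∈ Icc 1 k, f.coeff j = a j := by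
    intro j hj
    simp only [hf, finset_sum_coeff, coeff_C_mul, coeff_X_pow, mul_ite, mul_one, mul_zero]
    rw [Finset.sum_ite_eq]; simp only [hj, if_true]
  have hfe : ∀ u : ℤ, f.eval u = az k a u := by
    intro u; simp [hf, az, eval_finset_sum]
  have hfd : f.natDegree ≤ k := by
    refine natDegree_sum_le_of_forall_le _ _ fun j hj => ?_
    exact (natDegree_C_mul_X_pow_le _ _).trans (mem_Icc.1 hj).2
  have e1 : Sq k a q = SS q f := by
    unfold SS Sq
    rw [← sum_shift q (fun x => ep q (f.eval (x:ℤ))) (fun x => ep_per (by omega) f (by push_cast; simp)) 1]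
    refine sum_congr rfl fun r _ => ?_
    rw [hfe, ep]; push_cast; rw [add_comm (r:ℤ) 1]
  rw [e1]
  refine (SS_all hk q hq f hfd ?_).trans ?_
  · intro p hp hpq
    obtain ⟨j, hj, h⟩ := ha p hp hpq
    exact ⟨j, (mem_Icc.1 hj).1, by rwa [hfc j hj]⟩
  · have hq0 : (0:ℝ) < q := by exact_mod_cast hq
    rw [rpow_add hq0]
    calc _ ≤ D * (q:ℝ)^ε * (q:ℝ)^(1-1/(k:ℝ)) := mlr (hb q hq) (by positivity)
      _ = _ := by ring
end

noncomputable section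
open Polynomial

theorem reduce (k Q : ℕ) (hQ : 1 ≤ Q) (a : ℕ → ℤ) : ∃ (q : ℕ) (b : ℕ → ℤ), 1 ≤ q ∧ q ≤ Q ∧
    (∀ j ∈ Icc 1 k, ((a j:ℝ)/Q) = (b j:ℝ)/q) ∧ ∀ p, p.Prime → p ∣ q → ∃ j ∈ Icc 1 k, ¬ (p:ℤ) ∣ b j := by
  set g := Q.gcd ((Icc 1 k).gcd (fun j => (a j).natAbs)) with hg
  have hg0 : 0 < g := Nat.gcd_pos_of_pos_left _ hQ
  obtain ⟨q, hq⟩ : g ∣ Q := Nat.gcd_dvd_left _ _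
  have hdv : ∀ j ∈ Icc 1 k, (g:ℤ) ∣ a j := fun j hj =>
    Int.natCast_dvd.2 ((Nat.gcd_dvd_right _ _).trans (Finset.gcd_dvd hj))
  have hab : ∀ j ∈ Icc 1 k, a j = g * (a j / g) := fun j hj => (Int.mul_ediv_cancel' (hdv j hj)).symm
  have hq0 : 1 ≤ q := by
    rcases Nat.eq_zero_or_pos q with h | h
    · rw [h, mul_zero] at hq; omega
    · exact h
  refine ⟨q, fun j => a j / g, hq0, ?_, ?_, ?_⟩
  · rw [hq]; exact Nat.le_mul_of_pos_left _ hg0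
  · intro j hj
    have h1 : (a j:ℝ) = g * ((a j / g : ℤ):ℝ) := by exact_mod_cast hab j hj
    have h2 : (Q:ℝ) = g * q := by exact_mod_cast hq
    rw [h2]; nth_rw 1 [h1]
    exact mul_div_mul_left _ _ (by positivity)
  · intro p hp hpq
    by_contra hc
    push_neg at hc
    have h1 : g * p ∣ g := by
      conv_rhs => rw [hg]
      refine Nat.dvd_gcd ?_ (Finset.dvd_gcd fun j hj => ?_)
      · rw [hq]; exact mul_dvd_mul_left _ hpq
      · rw [← Int.natCast_dvd, hab j hj]; push_cast; exact mul_dvd_mul_left _ (hc j hj)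
    have := Nat.le_of_dvd hg0 h1
    have h2 := hp.two_le
    nlinarith

theorem core {k : ℕ} (hk : 3 ≤ k) {ε : ℝ} (hε : 0 < ε) : ∃ C : ℝ, 1 ≤ C ∧ ∀ n : ℕ, 1 ≤ n → ∀ P : ℝ[X], P.natDegree ≤ k →
    ∀ T : ℝ, 0 < T → T ≤ ‖Wy P n‖ → C * ((n:ℝ)^ε * ((n:ℝ)/T)^(k*(k-1)+1)) ≤ T →
    ∃ (q : ℕ) (b : ℕ → ℤ), 1 ≤ q ∧ (q:ℝ) ≤ C * ((n:ℝ)^ε * ((n:ℝ)/T)^k) ∧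
      ∀ j ∈ Icc 1 k, |q * P.coeff j - b j| ≤ C * ((n:ℝ)^ε * ((n:ℝ)/T)^k) / (n:ℝ)^j := by
  obtain ⟨C0, hC0, H0⟩ := propB (show 1 ≤ k-1 by omega) hε
  obtain ⟨C1, hC1, H1⟩ := Io_bd k (by omega)
  have hkpos : (0:ℝ) < k := by exact_mod_cast (by omega : 0 < k)
  obtain ⟨D, hD, H2⟩ := Sq_bd (show 2 ≤ k by omega) (div_pos hε hkpos)
  have hpi := pi_pos
  set c := 4*pi*(k*(k*2^k)) with hc
  have hc0 : 0 ≤ c := by positivity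
  set E := (2*D)^k with hE
  have hE1 : 1 ≤ E := one_le_pow₀ (by linarith)
  have hEC : E ≤ E*C1 := le_mul_of_one_le_right (by linarith) hC1
  have hX0 : 0 ≤ 2*C0*(2+c) := by positivity
  refine ⟨2*C0*(2+c) + E*C1, by linarith, ?_⟩
  intro n hn P hP T hT0 hT hsm
  have hn0 : (0:ℝ) < n := by exact_mod_cast hn
  have hTn : T ≤ n := hT.trans (Wy_le P n)
  set R := (n:ℝ)/T with hR
  have hR1 : 1 ≤ R := (one_le_div hT0).2 hTn
  have hnε : 0 < (n:ℝ)^ε := by positivity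
  set Z := (n:ℝ)^ε * R^(2*tri (k-1)) with hZ
  have htri : 2*tri (k-1) = k*(k-1) := by rw [two_tri, show k-1+1 = k by omega, mul_comm]
  have hZ0 : 0 < Z := by positivity
  have hZR : (n:ℝ)^ε * R^(k*(k-1)+1) = Z*R := by rw [hZ, htri, pow_succ]; ring
  rw [hZR] at hsm
  have hZR1 : Z ≤ Z*R := le_mul_of_one_le_right hZ0.le hR1
  have hZRp : 0 < Z*R := by positivity
  have hsm2 : 2*C0*(2+c)*(Z*R) ≤ T := le_trans (mlr (by linarith) hZRp.le) hsm
  have hCZn : C0*Z ≤ n := by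
    calc C0*Z ≤ C0*(Z*R) := mll hZR1 (by linarith)
      _ ≤ 2*C0*(2+c)*(Z*R) := by
          refine mlr ?_ hZRp.le
          nlinarith
      _ ≤ n := hsm2.trans hTn
  obtain ⟨Q, a, hQ1, hQZ, hQa⟩ := H0 n hn P (by omega) T hT0 hT Z rfl hCZn
  rw [show k-1+1 = k by omega] at hQa
  obtain ⟨q, b, hq1, hqQ, hab, hcop⟩ := reduce k Q hQ1 a
  have hq0 : (0:ℝ) < q := by exact_mod_cast hq1
  have hQ0 : (0:ℝ) < Q := by exact_mod_cast hQ1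
  have hqQ' : (q:ℝ) ≤ Q := by exact_mod_cast hqQ
  set β : ℕ → ℝ := fun j => P.coeff j - a j/Q with hβ
  set V := C0*Z/Q*R with hV
  have hV0 : 0 ≤ V := by positivity
  have hqn : q ≤ n := by
    have : (q:ℝ) ≤ n := hqQ'.trans (hQZ.trans hCZn)
    exact_mod_cast this
  have hmaj := major k n q hq1 hqn P hP b β V hV0 (fun j hj => by rw [hβ, ← hab j hj]; ring) hQa
  have herr : (q:ℝ)*(2+c*V) ≤ T/2 := by
    have h1 : (q:ℝ)*(2+c*V) ≤ Q*(2+c*V) := mlr hqQ' (by positivity)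
    have h2 : (Q:ℝ)*(2+c*V) = 2*Q + c*(C0*(Z*R)) := by rw [hV]; field_simp
    have h3 : C0*Z ≤ C0*(Z*R) := mll hZR1 (by linarith)
    rw [h2] at h1
    have h4 : 2*C0*(2+c)*(Z*R) = 2*(2*(C0*(Z*R)) + c*(C0*(Z*R))) := by ring
    linarith
  have hmain : (q:ℝ)*T ≤ 2*(‖Sq k b q‖ * ‖Io k β n‖) := by
    have h1 : (q:ℝ)*T ≤ q*‖Wy P n‖ := mll hT hq0.le
    have h2 := mll herr hq0.le
    linarith
  have hS := H2 q hq1 b hcop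
  set I := ‖Io k β n‖ with hI
  have hI0 : 0 ≤ I := norm_nonneg _
  have hSk : (D*(q:ℝ)^(1-1/(k:ℝ)+ε/k))^k ≤ D^k*((q:ℝ)^(k-1) * (n:ℝ)^ε) := by
    rw [mul_pow]
    refine mll ?_ (by positivity)
    have h1 : ((q:ℝ)^(1-1/(k:ℝ)+ε/k))^k = (q:ℝ)^(k-1) * (q:ℝ)^ε := by
      rw [← rpow_natCast, ← rpow_mul hq0.le, ← rpow_natCast, ← rpow_add hq0]
      congr 1
      rw [Nat.cast_sub (by omega)]; push_cast; field_simp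
    rw [h1]
    exact mll (rpow_le_rpow hq0.le (by exact_mod_cast hqn) hε.le) (by positivity)
  have hqT : (q:ℝ)*T^k ≤ E*(n:ℝ)^ε*I^k := by
    have h1 : ((q:ℝ)*T)^k ≤ (2*(D*(q:ℝ)^(1-1/(k:ℝ)+ε/k)*I))^k := by
      refine pow_le_pow_left₀ (by positivity) (hmain.trans ?_) k
      exact mll (mlr hS hI0) (by norm_num)
    have h2 : (2*(D*(q:ℝ)^(1-1/(k:ℝ)+ε/k)*I))^k = (2:ℝ)^k*(D*(q:ℝ)^(1-1/(k:ℝ)+ε/k))^k*I^k := by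
      rw [mul_pow, mul_pow]; ring
    rw [h2, mul_pow] at h1
    have h3 : (q:ℝ)^k = (q:ℝ)^(k-1)*q := by rw [← pow_succ]; congr 1; omega
    have h4 : (2:ℝ)^k*(D*(q:ℝ)^(1-1/(k:ℝ)+ε/k))^k*I^k ≤ (2:ℝ)^k*(D^k*((q:ℝ)^(k-1) * (n:ℝ)^ε))*I^k := by
      refine mlr ?_ (by positivity)
      exact mll hSk (by positivity)
    have h5 : (q:ℝ)^(k-1) * ((q:ℝ)*T^k) ≤ (q:ℝ)^(k-1) * (E*(n:ℝ)^ε*I^k) := by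
      calc _ = (q:ℝ)^k*T^k := by rw [h3]; ring
        _ ≤ _ := h1.trans h4
        _ = _ := by rw [hE, mul_pow]; ring
    exact le_of_mul_le_mul_left h5 (by positivity)
  have hTk : 0 < T^k := by positivity
  have hRk : R^k*T^k = (n:ℝ)^k := by rw [hR, div_pow]; field_simp
  have hEC2 : E*C1 ≤ 2*C0*(2+c) + E*C1 := by linarith
  refine ⟨q, b, hq1, ?_, ?_⟩
  · have hIn : I^k ≤ (n:ℝ)^k := pow_le_pow_left₀ hI0 (Io_triv k β n hn0.le) k
    have h1 : (q:ℝ) ≤ E * ((n:ℝ)^ε*R^k) := by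
      refine le_of_mul_le_mul_right ?_ hTk
      calc (q:ℝ)*T^k ≤ E*(n:ℝ)^ε*(n:ℝ)^k := hqT.trans (mll hIn (by positivity))
        _ = _ := by rw [← hRk]; ring
    exact h1.trans (mlr (hEC.trans hEC2) (by positivity))
  · intro j hj
    have h1 : (q:ℝ)*P.coeff j - b j = q*β j := by
      have h := hab j hj
      rw [hβ]; simp only; rw [h]; field_simp
    rw [h1, abs_mul, abs_of_pos hq0]
    have h2 := H1 β n hn0 j hj
    have hnj : (0:ℝ) < (n:ℝ)^j := by positivity
    have h3 : (q:ℝ) * |β j| ≤ E*C1*((n:ℝ)^ε*R^k)/(n:ℝ)^j := by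
      rw [le_div_iff₀ hnj]
      refine le_of_mul_le_mul_right ?_ hTk
      calc (q:ℝ) * |β j| * (n:ℝ)^j * T^k = (q:ℝ)*T^k * (|β j| * (n:ℝ)^j) := by ring
        _ ≤ E*(n:ℝ)^ε*I^k * (|β j| * (n:ℝ)^j) := mlr hqT (by positivity)
        _ = E*(n:ℝ)^ε*(I^k * (|β j| * (n:ℝ)^j)) := by ring
        _ ≤ E*(n:ℝ)^ε*(C1*(n:ℝ)^k) := mll h2 (by positivity)
        _ = _ := by rw [← hRk]; ring
    refine h3.trans (div_le_div_of_nonneg_right ?_ hnj.le)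
    exact mlr hEC2 (by positivity)
end

open Polynomial in
theorem fsum_Wy (k : ℕ) (α : Fin k → ℝ) (X : ℝ) : ∃ P : ℝ[X], P.natDegree ≤ k ∧ (∀ j : Fin k, P.coeff ((j:ℕ)+1) = α j) ∧
    fsum k α X = Wy P ⌊X⌋₊ := by
  refine ⟨∑ j : Fin k, C (α j) * Polynomial.X^((j:ℕ)+1), ?_, ?_, ?_⟩
  · refine natDegree_sum_le_of_forall_le _ _ fun j _ => ?_
    exact (natDegree_C_mul_X_pow_le _ _).trans (by have := j.2; omega)
  · intro j
    simp only [finset_sum_coeff, coeff_C_mul, coeff_X_pow, mul_ite, mul_one, mul_zero]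
    rw [sum_eq_single j]
    · simp
    · intro i _ hi
      rw [if_neg]
      intro h; exact hi (Fin.ext (by omega))
    · simp
  · unfold fsum Wy
    refine sum_congr rfl fun x _ => ?_
    simp [ex, eval_finset_sum]

theorem large_weyl_sum_implies_good_approximation (k : ℕ) (hk : 3 ≤ k) (τ δ : ℝ)
    (hτ : 1 / τ > 4 * ((k : ℝ) - 1) * ((k : ℝ) - 2)) (hδ : δ > k * τ) :
    ∃ X₀ : ℝ, ∀ X : ℝ, X ≥ X₀ → ∀ α : Fin k → ℝ,
      ‖fsum k α X‖ > X ^ (1 - τ) →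
      ∃ (q : ℤ) (a : Fin k → ℤ), 1 ≤ q ∧ (q : ℝ) ≤ X ^ δ ∧
        ∀ j : Fin k, |(q : ℝ) * α j - (a j : ℝ)| ≤ X ^ (δ - (((j : ℕ) : ℝ) + 1)) := by
  have hk3 : (3:ℝ) ≤ k := by exact_mod_cast hk
  have hB : 0 < 4 * ((k : ℝ) - 1) * ((k : ℝ) - 2) := by
    have h1 : (0:ℝ) < k - 1 := by linarith
    have h2 : (0:ℝ) < k - 2 := by linarith
    positivity
  have hτ0 : 0 < τ := one_div_pos.1 (hB.trans hτ)
  have hτ1 : τ * (4 * ((k : ℝ) - 1) * ((k : ℝ) - 2)) < 1 := by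
    have := mul_lt_mul_of_pos_left hτ hτ0
    rwa [mul_one_div_cancel hτ0.ne'] at this
  have hτ2 : τ * ((k:ℝ)*(k-1)+2) < 1 := by
    refine lt_of_le_of_lt (mll ?_ hτ0.le) hτ1
    nlinarith [mul_nonneg (show (0:ℝ) ≤ 3*k-2 by linarith) (show (0:ℝ) ≤ k-3 by linarith)]
  obtain ⟨ε, hε, hε1, hε2⟩ : ∃ ε : ℝ, 0 < ε ∧ ε + k*τ + ε ≤ δ ∧ ε + τ * ((k:ℝ)*(k-1)+2) + ε ≤ 1 := by
    refine ⟨min ((δ-k*τ)/2) ((1-τ * ((k:ℝ)*(k-1)+2))/2), lt_min (by linarith) (by linarith), ?_, ?_⟩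
    · have := min_le_left ((δ-k*τ)/2) ((1-τ * ((k:ℝ)*(k-1)+2))/2); linarith
    · have := min_le_right ((δ-k*τ)/2) ((1-τ * ((k:ℝ)*(k-1)+2))/2); linarith
  obtain ⟨C, hC, H⟩ := core hk hε
  refine ⟨max 2 ((C*2^k)^(1/ε)), fun X hX α hα => ?_⟩
  have hX2 : 2 ≤ X := (le_max_left _ _).trans hX
  have hX0 : 0 < X := by linarith
  have hX1 : 1 ≤ X := by linarith
  have hCX2 : C*2^k ≤ X^ε := by
    have h1 : (C*2^k)^(1/ε) ≤ X := (le_max_right _ _).trans hX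
    have := rpow_le_rpow (by positivity) h1 hε.le
    rwa [← rpow_mul (by positivity), one_div_mul_cancel hε.ne', rpow_one] at this
  have hCX : C ≤ X^ε := le_trans (le_mul_of_one_le_right (by linarith) (one_le_pow₀ (by norm_num))) hCX2
  obtain ⟨P, hP, hPc, hPW⟩ := fsum_Wy k α X
  set n := ⌊X⌋₊ with hn
  have hn1 : 1 ≤ n := Nat.le_floor (by exact_mod_cast hX1)
  have hnX : (n:ℝ) ≤ X := Nat.floor_le hX0.le
  have hXn : X < n + 1 := Nat.lt_floor_add_one X
  have hn1' : (1:ℝ) ≤ n := by exact_mod_cast hn1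
  have hn2 : X/2 ≤ n := by linarith
  set T := X^(1-τ) with hT
  have hT0 : 0 < T := by positivity
  have hR : (n:ℝ)/T ≤ X^τ := by
    rw [div_le_iff₀ hT0, hT, ← rpow_add hX0]
    simpa using hnX
  have hR0 : 0 ≤ (n:ℝ)/T := by positivity
  have hnε : (n:ℝ)^ε ≤ X^ε := rpow_le_rpow (by positivity) hnX hε.le
  have hpw : ∀ m : ℕ, (n:ℝ)^ε*((n:ℝ)/T)^m ≤ X^(ε+τ*m) := by
    intro m
    rw [rpow_add hX0, rpow_mul hX0.le, rpow_natCast]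
    exact mul_le_mul hnε (pow_le_pow_left₀ hR0 hR m) (by positivity) (by positivity)
  rw [hPW] at hα
  obtain ⟨q, b, hq1, hq, hb⟩ := H n hn1 P hP T hT0 hα.le (by
    calc C * ((n:ℝ)^ε * ((n:ℝ)/T)^(k*(k-1)+1)) ≤ X^ε * X^(ε+τ*((k*(k-1)+1:ℕ):ℝ)) :=
          mul_le_mul hCX (hpw _) (by positivity) (by positivity)
      _ = X^(ε + (ε+τ*((k*(k-1)+1:ℕ):ℝ))) := (rpow_add hX0 _ _).symm
      _ ≤ T := by
          refine rpow_le_rpow_of_exponent_le hX1 ?_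
          push_cast [show 1 ≤ k by omega]
          linarith)
  refine ⟨q, fun j => b ((j:ℕ)+1), by exact_mod_cast hq1, ?_, ?_⟩
  · push_cast
    calc (q:ℝ) ≤ X^ε * X^(ε+τ*k) := hq.trans (mul_le_mul hCX (hpw _) (by positivity) (by positivity))
      _ = X^(ε + (ε+τ*k)) := (rpow_add hX0 _ _).symm
      _ ≤ _ := rpow_le_rpow_of_exponent_le hX1 (by linarith)
  · intro j
    have h1 := hb ((j:ℕ)+1) (mem_Icc.2 ⟨by omega, j.2⟩)
    rw [hPc j] at h1
    push_cast
    refine h1.trans ?_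
    have hnj : (X/2)^((j:ℕ)+1) ≤ (n:ℝ)^((j:ℕ)+1) := pow_le_pow_left₀ (by positivity) hn2 _
    have h2k : (2:ℝ)^((j:ℕ)+1) ≤ 2^k := pow_le_pow_right₀ (by norm_num) j.2
    calc _ ≤ C * X^(ε+τ*k) / (X/2)^((j:ℕ)+1) :=
          div_le_div₀ (by positivity) (mll (hpw k) (by linarith)) (by positivity) hnj
      _ = C * 2^((j:ℕ)+1) * X^(ε+τ*k) / X^((j:ℕ)+1) := by rw [div_pow]; field_simp
      _ ≤ X^ε * X^(ε+τ*k) / X^((j:ℕ)+1) := by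
          refine div_le_div_of_nonneg_right (mlr ?_ (by positivity)) (by positivity)
          exact (mll h2k (by linarith)).trans hCX2
      _ = X^(ε + (ε+τ*k) - (((j:ℕ):ℝ)+1)) := by
          rw [Real.rpow_sub hX0, rpow_add hX0 ε (ε+τ*k), show (((j:ℕ):ℝ)+1) = (((j:ℕ)+1:ℕ):ℝ) by push_cast; rfl, rpow_natCast]
      _ ≤ _ := rpow_le_rpow_of_exponent_le hX1 (by linarith)
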